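/- arXiv:1510.03622 — 2 statements merged into one kernel-verified Lean document; each statement's English description precedes it below -/
import Mathlib

section
/- Let U ⊆ ℚ_p^n be a nonempty open set, let f, g : U → ℚ_p be nonzero p-adic analytic functions such that there is no constant c ∈ ℚ_p with f(x) = c·g(x) for all x ∈ U, and let D = {x ∈ U : f(x)·g(x) = 0}. Then the following are equivalent: (i) there exists a nonempty compact open set W ⊆ U such that the set {σ ∈ ℝ : σ ≥ 0 and x ↦ |f(x)/g(x)|_p^σ is integrable on W ∖ D} is bounded above; (ii) there exist a compact set A ⊆ U and a sequence (a_k)_{k∈ℕ} with a_k ∈ A ∖ D for all k such that |f(a_k)/g(a_k)|_p → +∞ as k → ∞. -/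
section Preliminaries

open Filter Topology

section AnalyticGerms

variable {𝕜 : Type*} [NontriviallyNormedField 𝕜] {E : Type*} [NormedAddCommGroup E]
  [NormedSpace 𝕜 E]

/-- A telescoping form of the difference of the diagonal values of a multilinear map at `x` and
at a projection `P x` of `x`. -/
theorem ContinuousMultilinearMap.sub_eq_smul_sum_curryMid {n : ℕ}
    (f : ContinuousMultilinearMap 𝕜 (fun _ : Fin (n + 1) => E) 𝕜) (P : E →L[𝕜] E)
    (ℓ : E →L[𝕜] 𝕜) (e : E) (hP : ∀ x, x = P x + ℓ x • e) (x : E) :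
    f (fun _ => x) - f (fun _ => P x) =
      ℓ x * (∑ i : Fin (n + 1), (f.compContinuousLinearMap
        (fun j => if j < i then P else ContinuousLinearMap.id 𝕜 E)).curryMid i e)
        (fun _ => x) := by
  set g : ℕ → Fin (n + 1) → E := fun i j => if (j : ℕ) < i then P x else x with hg
  have h0 : f (fun _ => x) - f (fun _ => P x) = ∑ i ∈ Finset.range (n + 1),
      (f (g i) - f (g (i + 1))) := by
    rw [Finset.sum_range_sub' (fun i => f (g i))]
    congr 2
    ext j
    simp only [hg, j.is_lt, if_true]
  rw [h0, Finset.sum_range (fun i => f (g i) - f (g (i + 1))), sum_apply,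
    Finset.mul_sum]
  refine Finset.sum_congr rfl fun i _ => ?_
  have h1 : g i = Function.update (g i) i x := by
    ext j
    by_cases h : j = i
    · subst h; simp [hg]
    · simp [h]
  have h2 : g (i + 1) = Function.update (g i) i (P x) := by
    ext j
    by_cases h : j = i
    · subst h; simp [hg]
    · have : (j : ℕ) ≠ i := fun h' => h (Fin.ext h')
      have h3 : (j : ℕ) < i + 1 ↔ (j : ℕ) < i := by omega
      simp [h, hg, h3]
  have h4 : f (g i) - f (g (i + 1)) = f (Function.update (g i) i (ℓ x • e)) := by
    rw [h2]
    nth_rw 1 [h1]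
    rw [← f.map_update_sub]
    congr 2
    rw [sub_eq_iff_eq_add']
    exact hP x
  rw [h4, f.map_update_smul, smul_eq_mul, ContinuousMultilinearMap.curryMid_apply,
    ContinuousMultilinearMap.compContinuousLinearMap_apply]
  congr 2
  ext j
  rcases Fin.eq_self_or_eq_succAbove i j with h | ⟨k, h⟩
  · subst h; simp
  · rw [h]
    have hne : i.succAbove k ≠ i := Fin.succAbove_ne i k
    simp only [Function.update_of_ne hne, Fin.insertNth_apply_succAbove, hg, Fin.val_fin_lt]
    split_ifs <;> rfl

/-- Division of an analytic function by a linear coordinate. -/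
theorem AnalyticAt.exists_eq_add_mul [CompleteSpace 𝕜] {F : E → 𝕜} (hF : AnalyticAt 𝕜 F 0)
    (P : E →L[𝕜] E) (ℓ : E →L[𝕜] 𝕜) (e : E) (hP : ∀ x, x = P x + ℓ x • e) :
    ∃ G : E → 𝕜, AnalyticAt 𝕜 G 0 ∧ ∀ᶠ x in 𝓝 0, F x = F (P x) + ℓ x * G x := by
  obtain ⟨p, r, hp⟩ := hF
  set q : FormalMultilinearSeries 𝕜 E 𝕜 := fun n =>
    ∑ i : Fin (n + 1), ((p (n + 1)).compContinuousLinearMap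
        (fun j => if j < i then P else ContinuousLinearMap.id 𝕜 E)).curryMid i e with hq
  set A : ℝ := max ‖P‖ 1 with hA
  have hA1 : 1 ≤ A := le_max_right _ _
  have hA0 : 0 < A := by linarith
  have hqn : ∀ n, ‖q n‖ ≤ (n + 1) * (‖p (n + 1)‖ * A ^ (n + 1) * ‖e‖) := by
    intro n
    have : ∀ i : Fin (n + 1), ‖((p (n + 1)).compContinuousLinearMap
        (fun j => if j < i then P else ContinuousLinearMap.id 𝕜 E)).curryMid i e‖ ≤
        ‖p (n + 1)‖ * A ^ (n + 1) * ‖e‖ := by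
      intro i
      refine (ContinuousLinearMap.le_opNorm _ _).trans ?_
      rw [ContinuousMultilinearMap.norm_curryMid]
      gcongr
      refine (ContinuousMultilinearMap.norm_compContinuousLinearMap_le _ _).trans ?_
      gcongr
      calc _ ≤ ∏ j : Fin (n + 1), A := by
            refine Finset.prod_le_prod (fun _ _ => norm_nonneg _) fun j _ => ?_
            split_ifs
            · exact le_max_left _ _
            · exact ContinuousLinearMap.norm_id_le.trans hA1
        _ = A ^ (n + 1) := by simp
    refine (norm_sum_le_of_le _ fun i _ => this i).trans ?_
    simp
  obtain ⟨ρ, hρ0, hρr⟩ := ENNReal.lt_iff_exists_nnreal_btwn.1 (hp.r_pos.trans_le hp.r_le)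
  have hρ0' : (0 : ℝ) < ρ := by exact_mod_cast hρ0
  obtain ⟨C, hC0, hC⟩ := p.norm_mul_pow_le_of_lt_radius hρr
  have hrad : 0 < q.radius := by
    let s : NNReal := ⟨ρ / (2 * A), by positivity⟩
    have hs : 0 < s := by
      change (0 : ℝ) < ρ / (2 * A)
      positivity
    refine lt_of_lt_of_le (by exact_mod_cast hs)
      (q.le_radius_of_bound (C * (2 * A / ρ) * ‖e‖) (r := s) fun n => ?_)
    have h2 : (n + 1 : ℝ) ≤ 2 ^ (n + 1) := by
      have := (Nat.lt_two_pow_self (n := n + 1)).le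
      exact_mod_cast this
    calc ‖q n‖ * (s : ℝ) ^ n
        ≤ ((n + 1) * (‖p (n + 1)‖ * A ^ (n + 1) * ‖e‖)) * (ρ / (2 * A)) ^ n := by
          gcongr
          · exact hqn n
          · exact le_rfl
      _ = (n + 1) / 2 ^ (n + 1) * (‖p (n + 1)‖ * ρ ^ (n + 1)) * (2 * A / ρ) * ‖e‖ := by
          rw [div_pow, mul_pow]
          field_simp
          ring
      _ ≤ 1 * C * (2 * A / ρ) * ‖e‖ := by
          gcongr
          · rw [div_le_one (by positivity)]; exact h2
          · exact hC (n + 1)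
      _ = _ := by ring
  have hqs := q.hasFPowerSeriesOnBall hrad
  refine ⟨q.sum, hqs.analyticAt, ?_⟩
  have hPt : Tendsto P (𝓝 0) (𝓝 0) := by simpa using P.continuous.tendsto 0
  have e1 : ∀ᶠ x in 𝓝 (0 : E), x ∈ Metric.eball (0 : E) r := Metric.eball_mem_nhds _ hp.r_pos
  have e2 : ∀ᶠ x in 𝓝 (0 : E), x ∈ Metric.eball (0 : E) q.radius := Metric.eball_mem_nhds _ hrad
  filter_upwards [e1, e2, hPt.eventually e1] with x h1 h2 h3
  have s1 := (hp.hasSum h1).sub (hp.hasSum h3)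
  have s2 := (hqs.hasSum h2).mul_left (ℓ x)
  simp only [zero_add] at s1 s2
  rw [← hasSum_nat_add_iff' 1] at s1
  have : (fun n => (p (n + 1) fun _ => x) - (p (n + 1) fun _ => P x)) =
      fun n => ℓ x * (q n fun _ => x) := by
    ext n
    exact (p (n + 1)).sub_eq_smul_sum_curryMid P ℓ e hP x
  rw [this] at s1
  have h5 := s1.unique s2
  have h6 : p 0 (fun _ => x) = p 0 (fun _ => P x) := by congr 1; ext i; exact i.elim0
  simp only [Finset.range_one, Finset.sum_singleton, h6, sub_self, sub_zero] at h5
  rw [← h5]; ring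

/-- A function analytic at `a` that vanishes near a point sufficiently close to `a` vanishes
near `a`. -/
theorem AnalyticAt.eventually_eventuallyEq_zero_imp [CompleteSpace 𝕜] {F : E → 𝕜} {a : E}
    (hF : AnalyticAt 𝕜 F a) :
    ∀ᶠ x in 𝓝 a, (F =ᶠ[𝓝 x] 0) → F =ᶠ[𝓝 a] 0 := by
  obtain ⟨p, r, hp⟩ := hF
  obtain ⟨ρ, hρ0, hρr⟩ := ENNReal.lt_iff_exists_nnreal_btwn.1 hp.r_pos
  have hρ0' : (0 : ℝ) < ρ := by exact_mod_cast hρ0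
  have hp' : HasFPowerSeriesOnBall F p a ρ := hp.mono (by exact_mod_cast hρ0) hρr.le
  filter_upwards [Metric.ball_mem_nhds a (by positivity : (0 : ℝ) < ρ / 4)] with x hx hFx
  rw [Metric.mem_ball, dist_eq_norm] at hx
  have hlt : (‖x - a‖₊ : ENNReal) < ρ := by
    have : ‖x - a‖ < ρ := by linarith
    exact_mod_cast this
  have hq := hp'.changeOrigin hlt
  rw [add_sub_cancel] at hq
  have hz : ∀ n (y : E), (p.changeOrigin (x - a)) n (fun _ => y) = 0 :=
    (hq.hasFPowerSeriesAt.congr hFx).apply_eq_zero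
  filter_upwards [Metric.ball_mem_nhds a (by positivity : (0 : ℝ) < ρ / 4)] with y hy
  rw [Metric.mem_ball, dist_eq_norm] at hy
  have hyx : y - x ∈ Metric.eball (0 : E) ((ρ : ENNReal) - ‖x - a‖₊) := by
    rw [← ENNReal.coe_sub, Metric.eball_coe, mem_ball_zero_iff]
    have h1 : ‖x - a‖₊ ≤ ρ := by
      have : ‖x - a‖ ≤ ρ := by linarith
      exact_mod_cast this
    rw [NNReal.coe_sub h1, coe_nnnorm]
    have : ‖y - x‖ ≤ ‖y - a‖ + ‖x - a‖ := by
      have := norm_sub_le (y - a) (x - a)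
      simpa using this
    linarith
  have hs := hq.hasSum hyx
  simp only [hz, add_sub_cancel] at hs
  exact hs.unique hasSum_zero

/-- The ring of germs of analytic functions is a domain. -/
theorem AnalyticAt.eventuallyEq_zero_or_of_mul [CompleteSpace 𝕜] {F G : E → 𝕜} {a : E}
    (hF : AnalyticAt 𝕜 F a) (hG : AnalyticAt 𝕜 G a) (h : ∀ᶠ x in 𝓝 a, F x * G x = 0) :
    F =ᶠ[𝓝 a] 0 ∨ G =ᶠ[𝓝 a] 0 := by
  by_contra! hc
  obtain ⟨hcF, hcG⟩ := hc
  have h1 : ∃ᶠ x in 𝓝 a, G x ≠ 0 := fun h' => hcG (h'.mono fun x hx => not_not.1 hx)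
  obtain ⟨x, hx, ⟨hxz, hxG⟩, hxF⟩ := (h1.and_eventually
    ((h.eventually_nhds.and (hG.eventually_analyticAt)).and
      hF.eventually_eventuallyEq_zero_imp)).exists
  refine hcF (hxF ?_)
  filter_upwards [hxz, hxG.continuousAt.eventually_ne hx] with y h2 h3
  exact (mul_eq_zero.1 h2).resolve_right h3

end AnalyticGerms

section Tschirnhausen

variable {𝕜 : Type*} [NontriviallyNormedField 𝕜] [CompleteSpace 𝕜] {E : Type*}
  [NormedAddCommGroup E] [NormedSpace 𝕜 E]

/-- Taylor expansion with analytic coefficients in the last variable. -/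
theorem AnalyticAt.exists_taylor_snd (d : ℕ) {F : E × 𝕜 → 𝕜} (hF : AnalyticAt 𝕜 F 0) :
    ∃ (c : ℕ → E → 𝕜) (R : E × 𝕜 → 𝕜), (∀ i, AnalyticAt 𝕜 (c i) 0) ∧ AnalyticAt 𝕜 R 0 ∧
      ∀ᶠ q in 𝓝 (0 : E × 𝕜),
        F q = ∑ i ∈ Finset.range d, c i q.1 * q.2 ^ i + q.2 ^ d * R q := by
  induction d generalizing F with
  | zero => exact ⟨fun _ _ => 0, F, fun _ => analyticAt_const, hF, by simp⟩
  | succ d ih =>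
    obtain ⟨G, hG, hFG⟩ := hF.exists_eq_add_mul
      ((ContinuousLinearMap.inl 𝕜 E 𝕜).comp (ContinuousLinearMap.fst 𝕜 E 𝕜))
      (ContinuousLinearMap.snd 𝕜 E 𝕜) (0, 1) (by intro x; ext <;> simp)
    obtain ⟨c, R, hc, hR, hGc⟩ := ih hG
    refine ⟨fun i => Nat.casesOn i (fun x => F (x, 0)) c, R, ?_, hR, ?_⟩
    · rintro (_ | i)
      · refine AnalyticAt.comp_of_eq (f := fun x : E => (x, (0 : 𝕜))) (y := (0 : E × 𝕜)) hF ?_ rfl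
        exact analyticAt_id.prod analyticAt_const
      · exact hc i
    · filter_upwards [hFG, hGc] with q h1 h2
      rw [h1, Finset.sum_range_succ']
      change F (q.1, 0) + q.2 * G q =
        ∑ i ∈ Finset.range d, c i q.1 * q.2 ^ (i + 1) + F (q.1, 0) * q.2 ^ 0 +
          q.2 ^ (d + 1) * R q
      rw [h2, mul_add, Finset.mul_sum,
        Finset.sum_congr rfl fun i _ => show q.2 * (c i q.1 * q.2 ^ i) = c i q.1 * q.2 ^ (i + 1) by
          ring]
      ring

omit [CompleteSpace 𝕜] in
/-- A polynomial of degree less than `d` that is `O(t ^ d)` at `0` vanishes. -/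
theorem eq_zero_of_sum_mul_pow_eq_pow_mul {d : ℕ} {a : ℕ → 𝕜} {A : 𝕜 → 𝕜} {L : 𝕜}
    (hA : Tendsto A (𝓝[≠] 0) (𝓝 L))
    (h : ∀ᶠ t in 𝓝[≠] (0 : 𝕜), ∑ i ∈ Finset.range d, a i * t ^ i = t ^ d * A t) :
    ∀ i < d, a i = 0 := by
  induction d generalizing a with
  | zero => simp
  | succ d ih =>
    have hid : Tendsto (fun t : 𝕜 => t) (𝓝[≠] 0) (𝓝 0) :=
      tendsto_id.mono_left nhdsWithin_le_nhds
    have h1 : Tendsto (fun t : 𝕜 => ∑ i ∈ Finset.range (d + 1), a i * t ^ i) (𝓝[≠] 0)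
        (𝓝 (a 0)) := by
      have : Continuous fun t : 𝕜 => ∑ i ∈ Finset.range (d + 1), a i * t ^ i := by fun_prop
      have h2 := (this.tendsto 0).mono_left (nhdsWithin_le_nhds (s := {0}ᶜ))
      simpa [Finset.sum_range_succ'] using h2
    have h2 : Tendsto (fun t : 𝕜 => t ^ (d + 1) * A t) (𝓝[≠] 0) (𝓝 0) := by
      simpa using (hid.pow (d + 1)).mul hA
    have h0 : a 0 = 0 := tendsto_nhds_unique (h1.congr' h) h2
    have h3 : ∀ᶠ t in 𝓝[≠] (0 : 𝕜), ∑ i ∈ Finset.range d, a (i + 1) * t ^ i = t ^ d * A t := by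
      filter_upwards [h, self_mem_nhdsWithin] with t ht ht0
      refine mul_left_cancel₀ (show t ≠ 0 from ht0) ?_
      rw [Finset.sum_range_succ', h0] at ht
      rw [Finset.mul_sum]
      simp only [zero_mul, add_zero] at ht
      rw [← mul_assoc, ← pow_succ', ← ht]
      exact Finset.sum_congr rfl fun i _ => by ring
    rintro (_ | i) hi
    · exact h0
    · exact ih h3 i (by omega)

/-- The analytic implicit function theorem for a scalar equation. -/
theorem AnalyticAt.exists_implicit [CompleteSpace E] {c : E × 𝕜 → 𝕜} (hc : AnalyticAt 𝕜 c 0)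
    (h0 : c 0 = 0) (h1 : fderiv 𝕜 c 0 (0, 1) ≠ 0) :
    ∃ φ : E → 𝕜, AnalyticAt 𝕜 φ 0 ∧ φ 0 = 0 ∧ ∀ᶠ x in 𝓝 0, c (x, φ x) = 0 := by
  set c' := fderiv 𝕜 c 0 with hc'
  set b := c' (0, 1) with hb
  have hsplit : ∀ (x : E) (t : 𝕜), c' (x, t) = c' (x, 0) + t * b := by
    intro x t
    have : (x, t) = (x, (0 : 𝕜)) + t • ((0 : E), (1 : 𝕜)) := by simp
    rw [this, map_add, map_smul, smul_eq_mul]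
  let i : (E × 𝕜) ≃L[𝕜] (E × 𝕜) := ContinuousLinearEquiv.equivOfInverse
    ((ContinuousLinearMap.fst 𝕜 E 𝕜).prod c')
    ((ContinuousLinearMap.fst 𝕜 E 𝕜).prod (b⁻¹ • (ContinuousLinearMap.snd 𝕜 E 𝕜 -
      (c'.comp (ContinuousLinearMap.inl 𝕜 E 𝕜)).comp (ContinuousLinearMap.fst 𝕜 E 𝕜))))
    (by
      rintro ⟨x, t⟩
      ext
      · simp
      · simp [hsplit x t]
        field_simp)
    (by
      rintro ⟨x, t⟩
      ext
      · simp
      · simp [hsplit x (b⁻¹ * (t - c' (x, 0)))]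
        field_simp
        ring)
  set Ψ : E × 𝕜 → E × 𝕜 := fun q => (q.1, c q) with hΨ
  have hΨa : AnalyticAt 𝕜 Ψ 0 := analyticAt_fst.prod hc
  have hΨ' : HasStrictFDerivAt Ψ (i : (E × 𝕜) →L[𝕜] (E × 𝕜)) 0 := by
    have h2 : HasStrictFDerivAt c c' 0 := hc.hasStrictFDerivAt
    exact (hasStrictFDerivAt_fst).prodMk h2
  have hΨ0 : Ψ 0 = 0 := by simp [hΨ, h0]
  set e := hΨ'.toOpenPartialHomeomorph Ψ with he
  have hes : (0 : E × 𝕜) ∈ e.source := hΨ'.mem_toOpenPartialHomeomorph_source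
  have hecoe : (e : E × 𝕜 → E × 𝕜) = Ψ := hΨ'.toOpenPartialHomeomorph_coe
  have hsymm : AnalyticAt 𝕜 e.symm (e 0) :=
    e.analyticAt_symm' hes (by rw [hecoe]; exact hΨa) (by rw [hecoe]; exact hΨ'.hasFDerivAt.fderiv)
  have hsymm0 : e.symm 0 = 0 := by
    have := e.left_inv hes
    rwa [hecoe, hΨ0] at this
  rw [hecoe, hΨ0] at hsymm
  have hin : AnalyticAt 𝕜 (fun x : E => (x, (0 : 𝕜))) 0 := analyticAt_id.prod analyticAt_const
  have hcomp : AnalyticAt 𝕜 (fun x : E => e.symm (x, (0 : 𝕜))) 0 :=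
    AnalyticAt.comp_of_eq (f := fun x : E => (x, (0 : 𝕜))) (y := (0 : E × 𝕜)) hsymm hin rfl
  refine ⟨fun x => (e.symm (x, 0)).2, ?_, ?_, ?_⟩
  · exact AnalyticAt.comp (g := Prod.snd) analyticAt_snd hcomp
  · change (e.symm 0).2 = 0
    rw [hsymm0]; rfl
  · have htgt : e.target ∈ 𝓝 (0 : E × 𝕜) := by
      have := e.open_target.mem_nhds (e.map_source hes)
      rwa [hecoe, hΨ0] at this
    have hint : Tendsto (fun x : E => (x, (0 : 𝕜))) (𝓝 0) (𝓝 0) := hin.continuousAt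
    filter_upwards [hint htgt] with x hx
    have h3 : e (e.symm (x, 0)) = (x, 0) := e.right_inv hx
    rw [hecoe] at h3
    have h4 : (e.symm (x, 0)).1 = x := congrArg Prod.fst h3
    have h5 : c (e.symm (x, 0)) = 0 := congrArg Prod.snd h3
    have h6 : (x, (e.symm (x, 0)).2) = e.symm (x, 0) := Prod.ext h4.symm rfl
    rw [h6, h5]

/-- The Tschirnhausen transformation: after an analytic shift of the last variable, the Taylor
coefficient preceding the leading one vanishes. -/
theorem AnalyticAt.exists_tschirnhausen [CharZero 𝕜] [CompleteSpace E] {F : E × 𝕜 → 𝕜}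
    (hF : AnalyticAt 𝕜 F 0) {e : ℕ} {h : 𝕜 → 𝕜} (hh : AnalyticAt 𝕜 h 0) (h0 : h 0 ≠ 0)
    (hFh : ∀ᶠ t in 𝓝 (0 : 𝕜), F (0, t) = t ^ (e + 1) * h t) :
    ∃ (φ : E → 𝕜) (c : ℕ → E → 𝕜) (R : E × 𝕜 → 𝕜), AnalyticAt 𝕜 φ 0 ∧ φ 0 = 0 ∧
      (∀ i, AnalyticAt 𝕜 (c i) 0) ∧ AnalyticAt 𝕜 R 0 ∧ R 0 ≠ 0 ∧
      ∀ᶠ q in 𝓝 (0 : E × 𝕜), F (q.1, q.2 + φ q.1) =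
        ∑ i ∈ Finset.range e, c i q.1 * q.2 ^ i + q.2 ^ (e + 1) * R q := by
  set W : (E × 𝕜) × 𝕜 → 𝕜 := fun q => F (q.1.1, q.2 + q.1.2) with hW
  have hWa : AnalyticAt 𝕜 W 0 := by
    refine AnalyticAt.comp_of_eq (f := fun q : (E × 𝕜) × 𝕜 => (q.1.1, q.2 + q.1.2))
      (y := (0 : E × 𝕜)) hF ?_ (by simp)
    have h1 : AnalyticAt 𝕜 (fun q : (E × 𝕜) × 𝕜 => q.1.1) 0 :=
      AnalyticAt.comp_of_eq (f := Prod.fst) (y := (0 : E × 𝕜)) analyticAt_fst analyticAt_fst rfl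
    have h2 : AnalyticAt 𝕜 (fun q : (E × 𝕜) × 𝕜 => q.1.2) 0 :=
      AnalyticAt.comp_of_eq (f := Prod.fst) (y := (0 : E × 𝕜)) analyticAt_snd analyticAt_fst rfl
    exact h1.prod (analyticAt_snd.add h2)
  obtain ⟨c, R, hc, hR, hWc⟩ := hWa.exists_taylor_snd (e + 1)
  have hin : Tendsto (fun t : 𝕜 => (((0 : E), (0 : 𝕜)), t)) (𝓝 0) (𝓝 0) := by
    have : Continuous (fun t : 𝕜 => (((0 : E), (0 : 𝕜)), t)) := by fun_prop
    exact this.tendsto 0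
  have hRt : Tendsto (fun t : 𝕜 => R ((0, 0), t)) (𝓝 0) (𝓝 (R 0)) :=
    hR.continuousAt.tendsto.comp hin
  have hht : Tendsto h (𝓝 0) (𝓝 (h 0)) := hh.continuousAt
  have hne : 𝓝[≠] (0 : 𝕜) ≤ 𝓝 0 := nhdsWithin_le_nhds
  have hexp : ∀ᶠ t in 𝓝 (0 : 𝕜), t ^ (e + 1) * h t =
      ∑ i ∈ Finset.range (e + 1), c i (0, 0) * t ^ i + t ^ (e + 1) * R ((0, 0), t) := by
    filter_upwards [hFh, hin.eventually hWc] with t h1 h2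
    rw [← h1, ← h2]
    simp [hW]
  have hc0 : ∀ i < e + 1, c i (0, 0) = 0 := by
    refine eq_zero_of_sum_mul_pow_eq_pow_mul (A := fun t => h t - R ((0, 0), t))
      ((hht.sub hRt).mono_left hne) ?_
    filter_upwards [hne hexp] with t ht
    rw [mul_sub, ht]; ring
  have hR0 : R 0 = h 0 := by
    refine tendsto_nhds_unique (hRt.mono_left hne) ((hht.mono_left hne).congr' ?_)
    filter_upwards [hne hexp, self_mem_nhdsWithin] with t ht ht0
    rw [Finset.sum_eq_zero fun i hi => by rw [hc0 i (Finset.mem_range.1 hi), zero_mul],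
      zero_add] at ht
    exact mul_left_cancel₀ (pow_ne_zero _ ht0) ht
  -- the derivative in the shift variable
  have hder : fderiv 𝕜 (c e) 0 (0, 1) = (e + 1) * h 0 := by
    obtain ⟨h1, hh1, hhh1⟩ := hh.exists_eq_add_mul 0 (ContinuousLinearMap.id 𝕜 𝕜) 1 (by simp)
    set Ru : 𝕜 → 𝕜 := fun t => fderiv 𝕜 R ((0, 0), t) ((0, 1), 0) with hRu
    have hRut : Tendsto Ru (𝓝 0) (𝓝 (Ru 0)) := by
      have h2 : ContinuousAt (fun t : 𝕜 => fderiv 𝕜 R ((0, 0), t)) 0 :=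
        (hR.fderiv.continuousAt).comp_of_eq hin rfl
      exact (h2.clm_apply continuousAt_const)
    have key : ∀ᶠ t in 𝓝 (0 : 𝕜), ∑ i ∈ Finset.range (e + 1),
        (fderiv 𝕜 (c i) 0 (0, 1) - if i = e then (e + 1) * h 0 else 0) * t ^ i =
        t ^ (e + 1) * ((e + 1) * h1 t + deriv h t - Ru t) := by
      filter_upwards [hhh1, hh.eventually_analyticAt, hin.eventually hR.eventually_analyticAt,
        hin.eventually hWc.eventually_nhds, hFh.eventually_nhds] with t ht hht hRt hWt hFt
      have hu : HasDerivAt (fun u : 𝕜 => (((0 : E), u), t)) ((0, 1), 0) 0 :=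
        ((hasDerivAt_const _ _).prodMk (hasDerivAt_id _)).prodMk (hasDerivAt_const _ _)
      have hu' : HasDerivAt (fun u : 𝕜 => ((0 : E), u)) (0, 1) 0 :=
        ((hasDerivAt_const _ _).prodMk (hasDerivAt_id _))
      have d1 : HasDerivAt (fun u : 𝕜 => ∑ i ∈ Finset.range (e + 1), c i (0, u) * t ^ i +
          t ^ (e + 1) * R ((0, u), t)) (∑ i ∈ Finset.range (e + 1),
          fderiv 𝕜 (c i) 0 (0, 1) * t ^ i + t ^ (e + 1) * Ru t) 0 := by
        refine HasDerivAt.add ?_ ?_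
        · refine HasDerivAt.fun_sum fun i _ => HasDerivAt.mul_const ?_ _
          exact HasFDerivAt.comp_hasDerivAt (0 : 𝕜) (f := fun u : 𝕜 => ((0 : E), u))
            ((hc i).differentiableAt.hasFDerivAt) hu'
        · refine HasDerivAt.const_mul _ ?_
          exact HasFDerivAt.comp_hasDerivAt (0 : 𝕜) (f := fun u : 𝕜 => (((0 : E), u), t))
            (hRt.differentiableAt.hasFDerivAt) hu
      have d2 : HasDerivAt (fun u : 𝕜 => (t + u) ^ (e + 1) * h (t + u))
          ((e + 1) * t ^ e * h t + t ^ (e + 1) * deriv h t) 0 := by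
        have a1 : HasDerivAt (fun u : 𝕜 => t + u) 1 0 := (hasDerivAt_id _).const_add t
        have a2 : HasDerivAt (fun u : 𝕜 => h (t + u)) (deriv h t) 0 := by
          have := hht.differentiableAt.hasDerivAt
          have := HasDerivAt.comp_const_add t 0 (f := h) (f' := deriv h t) (by simpa using this)
          simpa using this
        have := (a1.fun_pow (e + 1)).fun_mul a2
        simpa using this
      have d3 : (fun u : 𝕜 => (t + u) ^ (e + 1) * h (t + u)) =ᶠ[𝓝 0]
          fun u : 𝕜 => ∑ i ∈ Finset.range (e + 1), c i (0, u) * t ^ i +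
          t ^ (e + 1) * R ((0, u), t) := by
        have b1 : Tendsto (fun u : 𝕜 => t + u) (𝓝 0) (𝓝 t) := by
          have : Continuous fun u : 𝕜 => t + u := by fun_prop
          simpa using this.tendsto 0
        have b2 : Tendsto (fun u : 𝕜 => (((0 : E), u), t)) (𝓝 0) (𝓝 ((0, 0), t)) :=
          hu.continuousAt
        filter_upwards [b1.eventually hFt, b2.eventually hWt] with u hu1 hu2
        rw [← hu1, ← hu2]
      have d4 := (d1.congr_of_eventuallyEq d3).unique d2
      simp only [sub_mul, Finset.sum_sub_distrib, ite_mul, zero_mul, Finset.sum_ite_eq',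
        Finset.mem_range, lt_add_iff_pos_right, zero_lt_one, if_true]
      rw [eq_sub_of_add_eq d4, ht]
      simp
      ring
    have h3 := eq_zero_of_sum_mul_pow_eq_pow_mul
      (((((hh1.continuousAt.tendsto.const_mul (e + 1 : 𝕜)).add
        hh.deriv.continuousAt.tendsto).sub hRut)).mono_left hne) (hne key) e (by omega)
    simpa [sub_eq_zero] using h3
  obtain ⟨φ, hφ, hφ0, hcφ⟩ := (hc e).exists_implicit (hc0 e (by omega)) (by
    rw [hder]
    exact mul_ne_zero (by exact_mod_cast (Nat.succ_ne_zero e)) h0)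
  have hxφ : AnalyticAt 𝕜 (fun x : E => (x, φ x)) 0 := analyticAt_id.prod hφ
  have hqφ : AnalyticAt 𝕜 (fun q : E × 𝕜 => ((q.1, φ q.1), q.2)) 0 := by
    refine AnalyticAt.prod ?_ analyticAt_snd
    exact AnalyticAt.comp_of_eq (f := Prod.fst) (y := (0 : E)) hxφ analyticAt_fst rfl
  have hqφ0 : (((0 : E × 𝕜).1, φ (0 : E × 𝕜).1), (0 : E × 𝕜).2) = (0 : (E × 𝕜) × 𝕜) := by
    simp [hφ0]
  refine ⟨φ, fun i x => c i (x, φ x), fun q => R ((q.1, φ q.1), q.2), hφ, hφ0, fun i => ?_, ?_,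
    ?_, ?_⟩
  · exact AnalyticAt.comp_of_eq (f := fun x : E => (x, φ x)) (y := (0 : E × 𝕜)) (hc i) hxφ
      (by simp [hφ0])
  · exact AnalyticAt.comp_of_eq (f := fun q : E × 𝕜 => ((q.1, φ q.1), q.2)) hR hqφ hqφ0
  · change R (((0 : E × 𝕜).1, φ (0 : E × 𝕜).1), (0 : E × 𝕜).2) ≠ 0
    rw [hqφ0, hR0]; exact h0
  · have t1 : Tendsto (fun q : E × 𝕜 => ((q.1, φ q.1), q.2)) (𝓝 0) (𝓝 0) := by
      have := hqφ.continuousAt.tendsto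
      rwa [hqφ0] at this
    have t2 : Tendsto (Prod.fst : E × 𝕜 → E) (𝓝 0) (𝓝 0) := continuous_fst.tendsto _
    filter_upwards [t1.eventually hWc, t2.eventually hcφ] with q h1 h2
    rw [Finset.sum_range_succ, h2, zero_mul, add_zero] at h1
    exact h1

end Tschirnhausen

section Monomials

variable {𝕜 : Type*} [NontriviallyNormedField 𝕜] {N : ℕ}

/-- The monomial with exponent vector `m`. -/
def monom (m : Fin N → ℕ) (z : Fin N → 𝕜) : 𝕜 := ∏ i, z i ^ m i

@[simp]
theorem monom_zero (z : Fin N → 𝕜) : monom 0 z = 1 := by simp [monom]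

theorem monom_add (m k : Fin N → ℕ) (z : Fin N → 𝕜) :
    monom (m + k) z = monom m z * monom k z := by
  simp [monom, pow_add, Finset.prod_mul_distrib]

theorem monom_nsmul (k : ℕ) (m : Fin N → ℕ) (z : Fin N → 𝕜) :
    monom (k • m) z = monom m z ^ k := by
  simp [monom, mul_comm k, pow_mul, Finset.prod_pow]

theorem monom_single (j : Fin N) (k : ℕ) (z : Fin N → 𝕜) :
    monom (Pi.single j k) z = z j ^ k := by
  rw [monom, Finset.prod_eq_single j]
  · simp
  · intro i _ hi; simp [hi]
  · simp

theorem monom_mul (m : Fin N → ℕ) (z w : Fin N → 𝕜) :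
    monom m (fun i => z i * w i) = monom m z * monom m w := by
  simp [monom, mul_pow, Finset.prod_mul_distrib]

theorem monom_pow (m : Fin N → ℕ) (z : Fin N → 𝕜) (D : ℕ) :
    monom m (fun i => z i ^ D) = monom m z ^ D := by
  simp [monom, ← pow_mul, ← Finset.prod_pow, mul_comm D]

theorem monom_ne_zero {m : Fin N → ℕ} {z : Fin N → 𝕜} (hz : ∀ i, z i ≠ 0) : monom m z ≠ 0 :=
  Finset.prod_ne_zero_iff.2 fun i _ => pow_ne_zero _ (hz i)

theorem monom_eq_zero {m : Fin N → ℕ} {z : Fin N → 𝕜} {j : Fin N} (hm : m j ≠ 0) (hz : z j = 0) :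
    monom m z = 0 :=
  Finset.prod_eq_zero (Finset.mem_univ j) (by rw [hz, zero_pow hm])

theorem sub_single_add_single {m : Fin N → ℕ} {j : Fin N} (hm : m j ≠ 0) :
    m - Pi.single j 1 + Pi.single j 1 = m := by
  ext i
  by_cases h : i = j
  · subst h; simp; omega
  · simp [h]

theorem monom_eq_mul_sub_single {m : Fin N → ℕ} {j : Fin N} (hm : m j ≠ 0) (z : Fin N → 𝕜) :
    monom m z = z j * monom (m - Pi.single j 1) z := by
  conv_lhs => rw [← sub_single_add_single hm, monom_add, monom_single, pow_one, mul_comm]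

theorem sum_sub_single_lt {m : Fin N → ℕ} {j : Fin N} (hm : m j ≠ 0) :
    ∑ i, (m - Pi.single j 1 : Fin N → ℕ) i < ∑ i, m i := by
  conv_rhs => rw [← sub_single_add_single hm]
  simp [Finset.sum_add_distrib]

theorem analyticAt_monom (m : Fin N → ℕ) (z : Fin N → 𝕜) : AnalyticAt 𝕜 (monom m) z := by
  refine Finset.analyticAt_fun_prod _ fun i _ => AnalyticAt.pow ?_ _
  exact (ContinuousLinearMap.proj (R := 𝕜) (φ := fun _ : Fin N => 𝕜) i).analyticAt z

/-- A germ at the origin that is the product of a monomial and a nonvanishing analytic germ. -/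
def IsMonomialGerm (f : (Fin N → 𝕜) → 𝕜) : Prop :=
  ∃ (m : Fin N → ℕ) (u : (Fin N → 𝕜) → 𝕜), AnalyticAt 𝕜 u 0 ∧ u 0 ≠ 0 ∧
    f =ᶠ[𝓝 0] fun z => u z * monom m z

theorem IsMonomialGerm.congr {f g : (Fin N → 𝕜) → 𝕜} (hf : IsMonomialGerm f)
    (h : f =ᶠ[𝓝 0] g) : IsMonomialGerm g := by
  obtain ⟨m, u, hu, hu0, hfu⟩ := hf
  exact ⟨m, u, hu, hu0, h.symm.trans hfu⟩

theorem IsMonomialGerm.of_ne_zero {f : (Fin N → 𝕜) → 𝕜} (hf : AnalyticAt 𝕜 f 0)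
    (h : f 0 ≠ 0) : IsMonomialGerm f :=
  ⟨0, f, hf, h, by simp⟩

theorem isMonomialGerm_monom (m : Fin N → ℕ) :
    IsMonomialGerm (monom m : (Fin N → 𝕜) → 𝕜) :=
  ⟨m, fun _ => 1, analyticAt_const, one_ne_zero, by simp⟩

theorem IsMonomialGerm.mul {f g : (Fin N → 𝕜) → 𝕜} (hf : IsMonomialGerm f)
    (hg : IsMonomialGerm g) : IsMonomialGerm (fun z => f z * g z) := by
  obtain ⟨m, u, hu, hu0, hfu⟩ := hf
  obtain ⟨k, v, hv, hv0, hgv⟩ := hg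
  refine ⟨m + k, fun z => u z * v z, hu.mul hv, mul_ne_zero hu0 hv0, ?_⟩
  filter_upwards [hfu, hgv] with z h1 h2
  rw [h1, h2, monom_add]; ring

theorem IsMonomialGerm.analyticAt {f : (Fin N → 𝕜) → 𝕜} (hf : IsMonomialGerm f) :
    AnalyticAt 𝕜 f 0 := by
  obtain ⟨m, u, hu, -, hfu⟩ := hf
  exact (hu.mul (analyticAt_monom m 0)).congr hfu.symm

/-- The monomial curve with weights `w`, sampled at powers of `τ`. -/
def monomCurve (τ : 𝕜) (w : Fin N → ℕ) (t : ℕ) : Fin N → 𝕜 := fun i => τ ^ (w i * t)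

theorem monomCurve_ne_zero {τ : 𝕜} (hτ : τ ≠ 0) (w : Fin N → ℕ) (t : ℕ) (i : Fin N) :
    monomCurve τ w t i ≠ 0 := pow_ne_zero _ hτ

theorem tendsto_pow_mul_zero {τ : 𝕜} (hτ : ‖τ‖ < 1) {k : ℕ} (hk : k ≠ 0) :
    Tendsto (fun t : ℕ => τ ^ (k * t)) atTop (𝓝 0) := by
  simp_rw [pow_mul]
  refine tendsto_pow_atTop_nhds_zero_of_norm_lt_one ?_
  rw [norm_pow]
  exact pow_lt_one₀ (norm_nonneg _) hτ hk

theorem tendsto_monomCurve {τ : 𝕜} (hτ : ‖τ‖ < 1) {w : Fin N → ℕ} (hw : ∀ i, w i ≠ 0) :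
    Tendsto (monomCurve τ w) atTop (𝓝 0) :=
  tendsto_pi_nhds.2 fun i => tendsto_pow_mul_zero hτ (hw i)

theorem monom_monomCurve (τ : 𝕜) (w m : Fin N → ℕ) (t : ℕ) :
    monom m (monomCurve τ w t) = τ ^ ((w ⬝ᵥ m) * t) := by
  simp only [monom, monomCurve, ← pow_mul, Finset.prod_pow_eq_pow_sum, dotProduct, Finset.sum_mul]
  congr 1
  exact Finset.sum_congr rfl fun i _ => by ring

theorem IsMonomialGerm.not_eventuallyEq_zero {f : (Fin N → 𝕜) → 𝕜} (hf : IsMonomialGerm f) :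
    ¬ f =ᶠ[𝓝 0] 0 := by
  intro h
  obtain ⟨m, u, hu, hu0, hfu⟩ := hf
  obtain ⟨τ, hτ0, hτ1⟩ := NormedField.exists_norm_lt_one 𝕜
  have hτ : τ ≠ 0 := norm_pos_iff.1 hτ0
  have hc := tendsto_monomCurve hτ1 (w := fun _ : Fin N => 1) (by simp)
  obtain ⟨t, h1, h2, h3⟩ := ((hc.eventually h).and ((hc.eventually hfu).and
    (hc.eventually (hu.continuousAt.eventually_ne hu0)))).exists
  rw [h2] at h1
  exact mul_ne_zero h3 (monom_ne_zero (monomCurve_ne_zero hτ _ t)) h1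

/-- An analytic factor of a monomial germ is a monomial germ. -/
theorem IsMonomialGerm.left_of_mul [CompleteSpace 𝕜] {f g : (Fin N → 𝕜) → 𝕜}
    (hf : AnalyticAt 𝕜 f 0) (hg : AnalyticAt 𝕜 g 0)
    (h : IsMonomialGerm (fun z => f z * g z)) : IsMonomialGerm f := by
  obtain ⟨m, u, hu, hu0, hfu⟩ := h
  induction hs : ∑ i, m i using Nat.strong_induction_on generalizing m f g with
  | _ s ih =>
    by_cases hm : m = 0
    · subst hm
      refine .of_ne_zero hf fun h0 => hu0 ?_
      have := hfu.self_of_nhds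
      simpa [h0] using this.symm
    obtain ⟨j, hj⟩ := Function.ne_iff.1 hm
    simp only [Pi.zero_apply] at hj
    let ℓ : (Fin N → 𝕜) →L[𝕜] 𝕜 := ContinuousLinearMap.proj j
    let P : (Fin N → 𝕜) →L[𝕜] (Fin N → 𝕜) :=
      ContinuousLinearMap.id 𝕜 _ - ℓ.smulRight (Pi.single j 1)
    have hP : ∀ x, x = P x + ℓ x • (Pi.single j 1 : Fin N → 𝕜) := by
      intro x; simp [P]
    have hPj : ∀ x, (P x) j = 0 := by intro x; simp [P, ℓ]
    have hPt : Tendsto P (𝓝 0) (𝓝 0) := by simpa using P.continuous.tendsto 0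
    have hPa : AnalyticAt 𝕜 P 0 := P.analyticAt 0
    have hfP : AnalyticAt 𝕜 (fun x => f (P x)) 0 := AnalyticAt.comp_of_eq hf hPa (by simp)
    have hgP : AnalyticAt 𝕜 (fun x => g (P x)) 0 := AnalyticAt.comp_of_eq hg hPa (by simp)
    have hmul : ∀ᶠ x in 𝓝 0, f (P x) * g (P x) = 0 := by
      filter_upwards [hPt.eventually hfu] with x hx
      rw [hx, monom_eq_zero hj (hPj x), mul_zero]
    have hℓa : AnalyticAt 𝕜 ℓ 0 := ℓ.analyticAt 0
    have hℓm : IsMonomialGerm (ℓ : (Fin N → 𝕜) → 𝕜) := by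
      refine (isMonomialGerm_monom (Pi.single j 1)).congr (Eventually.of_forall fun z => ?_)
      rw [monom_single, pow_one]; rfl
    -- cancel the coordinate `ℓ`
    have cancel : ∀ A : (Fin N → 𝕜) → 𝕜, AnalyticAt 𝕜 A 0 →
        (∀ᶠ x in 𝓝 0, f x * g x = ℓ x * A x) →
        A =ᶠ[𝓝 0] fun z => u z * monom (m - Pi.single j 1) z := by
      intro A hA hAe
      have hB : AnalyticAt 𝕜 (fun z => A z - u z * monom (m - Pi.single j 1) z) 0 :=
        hA.sub (hu.mul (analyticAt_monom _ 0))
      rcases hℓa.eventuallyEq_zero_or_of_mul hB (by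
        filter_upwards [hAe, hfu] with x h1 h2
        have h3 : ℓ x = x j := rfl
        rw [mul_sub, ← h1, h2, monom_eq_mul_sub_single hj, h3]; ring) with h0 | h0
      · exact absurd h0 hℓm.not_eventuallyEq_zero
      · filter_upwards [h0] with x hx
        exact sub_eq_zero.1 hx
    have hlt := (sum_sub_single_lt hj).trans_eq hs
    rcases hfP.eventuallyEq_zero_or_of_mul hgP hmul with h0 | h0
    · obtain ⟨f1, hf1, hff1⟩ := hf.exists_eq_add_mul P ℓ (Pi.single j 1) hP
      have hff : f =ᶠ[𝓝 0] fun z => ℓ z * f1 z := by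
        filter_upwards [h0, hff1] with x h1 h2
        rw [h2, show f (P x) = 0 from h1, zero_add]
      have := ih _ hlt hf1 hg _ (cancel (fun z => f1 z * g z) (hf1.mul hg) (by
        filter_upwards [hff] with x hx
        rw [hx]; ring)) rfl
      exact (hℓm.mul this).congr hff.symm
    · obtain ⟨g1, hg1, hgg1⟩ := hg.exists_eq_add_mul P ℓ (Pi.single j 1) hP
      have hgg : g =ᶠ[𝓝 0] fun z => ℓ z * g1 z := by
        filter_upwards [h0, hgg1] with x h1 h2
        rw [h2, show g (P x) = 0 from h1, zero_add]
      exact ih _ hlt hf hg1 _ (cancel (fun z => f z * g1 z) (hf.mul hg1) (by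
        filter_upwards [hgg] with x hx
        rw [hx]; ring)) rfl

theorem exists_weight_dotProduct_lt {a b : Fin N → ℕ} {i : Fin N} (h : a i < b i) :
    ∃ w : Fin N → ℕ, (∀ i, w i ≠ 0) ∧ w ⬝ᵥ a < w ⬝ᵥ b := by
  refine ⟨1 + Pi.single i (1 ⬝ᵥ a + 1), fun j => by simp, ?_⟩
  simp only [add_dotProduct, single_dotProduct]
  have h2 : (1 ⬝ᵥ a + 1) * (a i + 1) ≤ (1 ⬝ᵥ a + 1) * b i := Nat.mul_le_mul_left _ h
  linarith [Nat.zero_le ((1 : Fin N → ℕ) ⬝ᵥ b)]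

/-- If the difference of two monomial germs vanishes or is a monomial germ, then the exponents
are comparable. -/
theorem le_or_le_of_isMonomialGerm_sub {a b : Fin N → ℕ} {u v : (Fin N → 𝕜) → 𝕜}
    (hu : ContinuousAt u 0) (hv : ContinuousAt v 0) (hu0 : u 0 ≠ 0) (hv0 : v 0 ≠ 0)
    (h : (fun z => u z * monom a z - v z * monom b z) =ᶠ[𝓝 0] 0 ∨
      IsMonomialGerm (fun z => u z * monom a z - v z * monom b z)) : a ≤ b ∨ b ≤ a := by
  by_contra! hc
  obtain ⟨hab, hba⟩ := hc
  obtain ⟨i, hi⟩ := not_forall.1 hab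
  obtain ⟨j, hj⟩ := not_forall.1 hba
  obtain ⟨w₁, hw₁, hlt₁⟩ := exists_weight_dotProduct_lt (not_le.1 hj)
  obtain ⟨w₂, hw₂, hlt₂⟩ := exists_weight_dotProduct_lt (not_le.1 hi)
  obtain ⟨τ, hτ0, hτ1⟩ := NormedField.exists_norm_lt_one 𝕜
  have hτ : τ ≠ 0 := norm_pos_iff.1 hτ0
  -- the germ along a monomial curve after division by a power of the parameter
  have lim : ∀ (w : Fin N → ℕ), (∀ i, w i ≠ 0) → ∀ (f : (Fin N → 𝕜) → 𝕜), ContinuousAt f 0 →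
      ∀ (m : Fin N → ℕ) (k : ℕ), k < w ⬝ᵥ m →
      Tendsto (fun t => f (monomCurve τ w t) * monom m (monomCurve τ w t) / τ ^ (k * t)) atTop
        (𝓝 0) := by
    intro w hw f hf m k hk
    have h1 : Tendsto (fun t => f (monomCurve τ w t)) atTop (𝓝 (f 0)) :=
      hf.tendsto.comp (tendsto_monomCurve hτ1 hw)
    have h2 := tendsto_pow_mul_zero hτ1 (Nat.sub_ne_zero_of_lt hk)
    have h3 := h1.mul h2
    rw [mul_zero] at h3
    refine h3.congr fun t => ?_
    rw [monom_monomCurve, mul_div_assoc]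
    congr 1
    rw [eq_div_iff (pow_ne_zero _ hτ), ← pow_add, ← add_mul, Nat.sub_add_cancel hk.le]
  have lim' : ∀ (w : Fin N → ℕ), (∀ i, w i ≠ 0) → ∀ (f : (Fin N → 𝕜) → 𝕜), ContinuousAt f 0 →
      ∀ (m : Fin N → ℕ),
      Tendsto (fun t => f (monomCurve τ w t) * monom m (monomCurve τ w t) / τ ^ ((w ⬝ᵥ m) * t))
        atTop (𝓝 (f 0)) := by
    intro w hw f hf m
    have h1 : Tendsto (fun t => f (monomCurve τ w t)) atTop (𝓝 (f 0)) :=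
      hf.tendsto.comp (tendsto_monomCurve hτ1 hw)
    refine h1.congr fun t => ?_
    rw [monom_monomCurve, mul_div_cancel_right₀ _ (pow_ne_zero _ hτ)]
  rcases h with h | ⟨c, s, hs, hs0, h⟩
  · have h1 := ((lim' w₁ hw₁ u hu a).sub (lim w₁ hw₁ v hv b _ hlt₁))
    rw [sub_zero] at h1
    refine hu0 (tendsto_nhds_unique h1 (tendsto_const_nhds.congr' ?_))
    filter_upwards [(tendsto_monomCurve hτ1 hw₁).eventually h] with t ht
    rw [← sub_div, show _ - _ = (0 : 𝕜) from ht, zero_div]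
  · have hsc := hs.continuousAt
    have eqn : ∀ (w : Fin N → ℕ), (∀ i, w i ≠ 0) → ∀ k : ℕ,
        (fun t => u (monomCurve τ w t) * monom a (monomCurve τ w t) / τ ^ (k * t) -
          v (monomCurve τ w t) * monom b (monomCurve τ w t) / τ ^ (k * t)) =ᶠ[atTop]
        fun t => s (monomCurve τ w t) * monom c (monomCurve τ w t) / τ ^ (k * t) := by
      intro w hw k
      filter_upwards [(tendsto_monomCurve hτ1 hw).eventually h] with t ht
      rw [← sub_div, ht]
    have low : ∀ (w : Fin N → ℕ), (∀ i, w i ≠ 0) → w ⬝ᵥ c < w ⬝ᵥ a → w ⬝ᵥ c < w ⬝ᵥ b → False := by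
      intro w hw h1 h2
      have l1 := ((lim w hw u hu a _ h1).sub (lim w hw v hv b _ h2))
      rw [sub_zero] at l1
      exact hs0 (tendsto_nhds_unique ((l1.congr' (eqn w hw _))) (lim' w hw s hsc c)).symm
    have up₁ : w₁ ⬝ᵥ c ≤ w₁ ⬝ᵥ a := by
      by_contra! h1
      have l1 := ((lim' w₁ hw₁ u hu a).sub (lim w₁ hw₁ v hv b _ hlt₁))
      rw [sub_zero] at l1
      exact hu0 (tendsto_nhds_unique (l1.congr' (eqn w₁ hw₁ _)) (lim w₁ hw₁ s hsc c _ h1))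
    have up₂ : w₂ ⬝ᵥ c ≤ w₂ ⬝ᵥ b := by
      by_contra! h1
      have l1 := ((lim w₂ hw₂ u hu a _ hlt₂).sub (lim' w₂ hw₂ v hv b))
      rw [zero_sub] at l1
      exact hv0 (neg_eq_zero.1
        (tendsto_nhds_unique (l1.congr' (eqn w₂ hw₂ _)) (lim w₂ hw₂ s hsc c _ h1)))
    refine low (w₁ + w₂) (fun i => by simp [hw₁ i]) ?_ ?_ <;>
    · simp only [add_dotProduct]
      omega

end Monomials

section Uniformization

variable {𝕜 : Type*} [NontriviallyNormedField 𝕜] {E E' : Type*} [NormedAddCommGroup E]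
  [NormedSpace 𝕜 E] [NormedAddCommGroup E'] [NormedSpace 𝕜 E'] {ι : Type*} {N : ℕ}

/-- The germ `F` at the origin becomes monomial on an analytic chart to which the family `x`
lifts along `l`. -/
def Uniformizes (N : ℕ) (l : Filter ι) (x : ι → E) (F : E → 𝕜) : Prop :=
  ∃ (π : (Fin N → 𝕜) → E) (z : ι → Fin N → 𝕜), AnalyticAt 𝕜 π 0 ∧ π 0 = 0 ∧
    Tendsto z l (𝓝 0) ∧ (∀ᶠ k in l, π (z k) = x k) ∧ IsMonomialGerm (fun y => F (π y))

theorem AnalyticAt.tendsto_zero {π : E' → E} (hπ : AnalyticAt 𝕜 π 0) (h0 : π 0 = 0) :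
    Tendsto π (𝓝 0) (𝓝 0) := by
  simpa [h0] using hπ.continuousAt.tendsto

theorem Uniformizes.congr {l : Filter ι} {x : ι → E} {F G : E → 𝕜} (h : Uniformizes N l x F)
    (hFG : F =ᶠ[𝓝 0] G) : Uniformizes N l x G := by
  obtain ⟨π, z, hπ, hπ0, hz, hzx, hm⟩ := h
  exact ⟨π, z, hπ, hπ0, hz, hzx, hm.congr ((hπ.tendsto_zero hπ0).eventually hFG)⟩

theorem Uniformizes.of_comp {l : Filter ι} {x : ι → E} {F : E → 𝕜} {ψ : E' → E} {y : ι → E'}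
    (hψ : AnalyticAt 𝕜 ψ 0) (hψ0 : ψ 0 = 0) (hy : ∀ᶠ k in l, ψ (y k) = x k)
    (h : Uniformizes N l y (fun q => F (ψ q))) : Uniformizes N l x F := by
  obtain ⟨π, z, hπ, hπ0, hz, hzx, hm⟩ := h
  refine ⟨fun w => ψ (π w), z, AnalyticAt.comp_of_eq hψ hπ hπ0, by simp [hπ0, hψ0], hz, ?_, hm⟩
  filter_upwards [hzx, hy] with k h1 h2
  rw [h1, h2]

theorem Uniformizes.of_monomial {l : Filter ι} {x : ι → (Fin N → 𝕜) × 𝕜}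
    {F u : (Fin N → 𝕜) × 𝕜 → 𝕜} {H : (Fin N → 𝕜) → 𝕜} {k : ℕ} (hu : AnalyticAt 𝕜 u 0)
    (hu0 : u 0 ≠ 0) (hH : IsMonomialGerm H)
    (hF : F =ᶠ[𝓝 0] fun q => u q * (H q.1 * q.2 ^ k)) (hx : Tendsto x l (𝓝 0)) :
    Uniformizes (N + 1) l x F := by
  let π : (Fin (N + 1) → 𝕜) →L[𝕜] (Fin N → 𝕜) × 𝕜 :=
    (ContinuousLinearMap.pi fun i : Fin N => ContinuousLinearMap.proj i.succ).prod
      (ContinuousLinearMap.proj 0)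
  have hπ : ∀ z, π z = (fun i => z i.succ, z 0) := fun z => rfl
  have hπt : Tendsto π (𝓝 0) (𝓝 0) := by simpa using π.continuous.tendsto 0
  have hπ1 : Tendsto (fun z => (π z).1) (𝓝 0) (𝓝 0) := hπt.fst_nhds
  have hπ1a : AnalyticAt 𝕜 (fun z => (π z).1) 0 :=
    ((ContinuousLinearMap.fst 𝕜 _ _).comp π).analyticAt 0
  refine ⟨π, fun k => Fin.cons (x k).2 (x k).1, π.analyticAt 0, map_zero π, ?_, ?_, ?_⟩
  · rw [tendsto_pi_nhds]
    intro i
    refine Fin.cases ?_ (fun i => ?_) i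
    · simpa using hx.snd_nhds
    · simpa using (tendsto_pi_nhds.1 hx.fst_nhds) i
  · exact Eventually.of_forall fun k => by simp [hπ]
  · obtain ⟨m, v, hv, hv0, hHv⟩ := hH
    refine ⟨Fin.cons k m, fun z => u (π z) * v (π z).1,
      (AnalyticAt.comp_of_eq hu (π.analyticAt 0) (by simp)).mul
        (AnalyticAt.comp_of_eq hv hπ1a (by simp)), by simpa using ⟨hu0, hv0⟩, ?_⟩
    filter_upwards [hπt.eventually hF, hπ1.eventually hHv] with z h1 h2
    rw [h1, h2]
    simp only [monom, Fin.prod_univ_succ, Fin.cons_zero, Fin.cons_succ, hπ]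
    ring

/-- Every nonzero analytic germ in `N` variables can be uniformized along `l`. -/
def LocallyUniformizable (𝕜 : Type*) [NontriviallyNormedField 𝕜] (N : ℕ) (l : Filter ι) : Prop :=
  ∀ F : (Fin N → 𝕜) → 𝕜, AnalyticAt 𝕜 F 0 → ¬ F =ᶠ[𝓝 0] 0 →
    ∀ x : ι → Fin N → 𝕜, Tendsto x l (𝓝 0) → Uniformizes N l x F

theorem AnalyticAt.not_prod_eventuallyEq_zero [CompleteSpace 𝕜] {κ : Type*} (s : Finset κ)
    {F : κ → E → 𝕜} {a : E} (hF : ∀ j ∈ s, AnalyticAt 𝕜 (F j) a)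
    (h0 : ∀ j ∈ s, ¬ F j =ᶠ[𝓝 a] 0) : ¬ (fun y => ∏ j ∈ s, F j y) =ᶠ[𝓝 a] 0 := by
  classical
  induction s using Finset.induction_on with
  | empty =>
    intro h
    simpa using h.self_of_nhds
  | insert j s hj ih =>
    intro h
    simp only [Finset.mem_insert, forall_eq_or_imp] at hF h0
    refine (hF.1.eventuallyEq_zero_or_of_mul
      (Finset.analyticAt_fun_prod s fun i hi => hF.2 i hi) ?_).elim h0.1 (ih hF.2 h0.2)
    filter_upwards [h] with y hy
    simpa [Finset.prod_insert hj] using hy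

/-- Simultaneous uniformization of finitely many germs. -/
theorem LocallyUniformizable.finset [CompleteSpace 𝕜] {l : Filter ι}
    (hl : LocallyUniformizable 𝕜 N l) {κ : Type*} (s : Finset κ) {F : κ → (Fin N → 𝕜) → 𝕜}
    (hF : ∀ j ∈ s, AnalyticAt 𝕜 (F j) 0) {x : ι → Fin N → 𝕜} (hx : Tendsto x l (𝓝 0)) :
    ∃ (π : (Fin N → 𝕜) → Fin N → 𝕜) (z : ι → Fin N → 𝕜), AnalyticAt 𝕜 π 0 ∧ π 0 = 0 ∧
      Tendsto z l (𝓝 0) ∧ (∀ᶠ k in l, π (z k) = x k) ∧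
      ∀ j ∈ s, F j =ᶠ[𝓝 0] 0 ∨ IsMonomialGerm (fun y => F j (π y)) := by
  classical
  set s' := s.filter fun j => ¬ F j =ᶠ[𝓝 0] 0 with hs'
  have hF' : ∀ j ∈ s', AnalyticAt 𝕜 (F j) 0 := fun j hj => hF j (Finset.mem_filter.1 hj).1
  obtain ⟨π, z, hπ, hπ0, hz, hzx, hm⟩ := hl (fun y => ∏ j ∈ s', F j y)
    (Finset.analyticAt_fun_prod s' fun j hj => hF' j hj)
    (AnalyticAt.not_prod_eventuallyEq_zero s' hF' fun j hj => (Finset.mem_filter.1 hj).2) x hx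
  refine ⟨π, z, hπ, hπ0, hz, hzx, fun j hj => or_iff_not_imp_left.2 fun hj0 => ?_⟩
  have hjs' : j ∈ s' := Finset.mem_filter.2 ⟨hj, hj0⟩
  refine IsMonomialGerm.left_of_mul (g := fun y => ∏ i ∈ s'.erase j, F i (π y))
    (AnalyticAt.comp_of_eq (hF j hj) hπ hπ0)
    (Finset.analyticAt_fun_prod _ fun i hi =>
      AnalyticAt.comp_of_eq (hF' i (Finset.mem_of_mem_erase hi)) hπ hπ0) ?_
  refine hm.congr (Eventually.of_forall fun y => ?_)
  exact (Finset.mul_prod_erase s' (fun i => F i (π y)) hjs').symm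

theorem AnalyticAt.exists_eq_pow_mul_of_coeff_ne_zero {f : 𝕜 → 𝕜} (hf : AnalyticAt 𝕜 f 0) {d : ℕ}
    {a : ℕ → 𝕜} {A : 𝕜 → 𝕜} (hA : ContinuousAt A 0)
    (h : ∀ᶠ t in 𝓝 0, f t = ∑ i ∈ Finset.range d, a i * t ^ i + t ^ d * A t) {i : ℕ}
    (hi : i < d) (hai : a i ≠ 0) :
    ∃ e < d, ∃ g : 𝕜 → 𝕜, AnalyticAt 𝕜 g 0 ∧ g 0 ≠ 0 ∧ ∀ᶠ t in 𝓝 0, f t = t ^ e * g t := by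
  have hA' : Tendsto A (𝓝[≠] 0) (𝓝 (A 0)) := hA.tendsto.mono_left nhdsWithin_le_nhds
  have hne : ¬ ∀ᶠ t in 𝓝 0, f t = 0 := by
    intro h0
    refine hai (eq_zero_of_sum_mul_pow_eq_pow_mul hA'.neg (d := d) (a := a) ?_ i hi)
    filter_upwards [nhdsWithin_le_nhds h, nhdsWithin_le_nhds h0] with t h1 h2
    rw [h1] at h2
    linear_combination h2
  obtain ⟨e, g, hg, hg0, hfg⟩ := hf.exists_eventuallyEq_pow_smul_nonzero_iff.2 hne
  simp only [sub_zero, smul_eq_mul] at hfg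
  refine ⟨e, ?_, g, hg, hg0, hfg⟩
  by_contra! hed
  refine hai (eq_zero_of_sum_mul_pow_eq_pow_mul (d := d) (a := a)
    (A := fun t => t ^ (e - d) * g t - A t) (L := 0 ^ (e - d) * g 0 - A 0) ?_ ?_ i hi)
  · exact ((((continuousAt_id.pow (e - d)).mul hg.continuousAt).sub hA).tendsto).mono_left
      nhdsWithin_le_nhds
  · filter_upwards [nhdsWithin_le_nhds h, nhdsWithin_le_nhds hfg] with t h1 h2
    have h3 : t ^ e = t ^ d * t ^ (e - d) := by rw [← pow_add, Nat.add_sub_cancel' hed]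
    rw [h1, h3] at h2
    linear_combination h2

theorem Ultrafilter.exists_tendsto_of_bounded [ProperSpace 𝕜] (l : Ultrafilter ι) {s : ι → 𝕜}
    {C : ℝ} (h : ∀ᶠ k in (l : Filter ι), ‖s k‖ ≤ C) : ∃ s₀, Tendsto s l (𝓝 s₀) := by
  obtain ⟨s₀, -, hs⟩ := (isCompact_closedBall (0 : 𝕜) C).ultrafilter_le_nhds (l.map s)
    (le_principal_iff.2 (h.mono fun k hk => by simpa using hk))
  exact ⟨s₀, hs⟩

theorem Ultrafilter.exists_tendsto_quotient [ProperSpace 𝕜] (l : Ultrafilter ι) (y t : ι → 𝕜) :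
    (∃ (s : ι → 𝕜) (s₀ : 𝕜), Tendsto s l (𝓝 s₀) ∧ ∀ᶠ k in (l : Filter ι), t k = y k * s k) ∨
    ∃ s : ι → 𝕜, Tendsto s l (𝓝 0) ∧ ∀ᶠ k in (l : Filter ι), y k = t k * s k := by
  rcases l.eventually_or.1 (Eventually.of_forall fun k => le_or_gt ‖t k‖ ‖y k‖) with h | h
  · have hb : ∀ᶠ k in (l : Filter ι), ‖t k / y k‖ ≤ 1 := by
      filter_upwards [h] with k hk
      rw [norm_div]
      exact div_le_one_of_le₀ hk (norm_nonneg _)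
    obtain ⟨s₀, hs⟩ := l.exists_tendsto_of_bounded hb
    refine Or.inl ⟨_, s₀, hs, ?_⟩
    filter_upwards [h] with k hk
    by_cases hy : y k = 0
    · rw [hy, norm_zero, norm_le_zero_iff] at hk
      simp [hk, hy]
    · rw [mul_div_cancel₀ _ hy]
  · have hb : ∀ᶠ k in (l : Filter ι), ‖y k / t k‖ ≤ 1 := by
      filter_upwards [h] with k hk
      rw [norm_div]
      exact div_le_one_of_le₀ hk.le (norm_nonneg _)
    have ht : ∀ᶠ k in (l : Filter ι), t k ≠ 0 := by
      filter_upwards [h] with k hk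
      exact norm_pos_iff.1 ((norm_nonneg _).trans_lt hk)
    obtain ⟨s₀, hs⟩ := l.exists_tendsto_of_bounded hb
    by_cases hs0 : s₀ = 0
    · subst hs0
      refine Or.inr ⟨_, hs, ?_⟩
      filter_upwards [ht] with k hk
      rw [mul_div_cancel₀ _ hk]
    · refine Or.inl ⟨_, _, hs.inv₀ hs0, ?_⟩
      filter_upwards [ht, hs.eventually_ne hs0] with k hk hk2
      have : y k ≠ 0 := fun h => hk2 (by simp [h])
      field_simp

theorem Ultrafilter.exists_eq_mul_pow [CharZero 𝕜] [CompleteSpace 𝕜] [ProperSpace 𝕜]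
    (l : Ultrafilter ι) {D : ℕ} (hD : D ≠ 0) {y : ι → 𝕜} (hy : Tendsto y l (𝓝 0)) :
    ∃ (ε : 𝕜) (w : ι → 𝕜), ε ≠ 0 ∧ Tendsto w l (𝓝 0) ∧
      ∀ᶠ k in (l : Filter ι), y k = ε * w k ^ D := by
  rcases l.eventually_or.1 (Eventually.of_forall fun k => eq_or_ne (y k) 0) with h | h
  · refine ⟨1, fun _ => 0, one_ne_zero, tendsto_const_nhds, ?_⟩
    filter_upwards [h] with k hk
    simp [hk, hD]
  obtain ⟨c, hc⟩ := NormedField.exists_one_lt_norm 𝕜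
  have hc0 : c ≠ 0 := norm_pos_iff.1 (zero_lt_one.trans hc)
  have hcD : 1 < ‖c ^ D‖ := by rw [norm_pow]; exact one_lt_pow₀ hc hD
  have key : ∀ k, ∃ n : ℤ, y k ≠ 0 → 1 ≤ ‖y k / (c ^ n) ^ D‖ ∧ ‖y k / (c ^ n) ^ D‖ ≤ ‖c ^ D‖ := by
    intro k
    by_cases hk : y k = 0
    · exact ⟨0, fun h => absurd hk h⟩
    obtain ⟨n, h1, h2⟩ := exists_mem_Ico_zpow (norm_pos_iff.2 hk) hcD
    refine ⟨n, fun _ => ?_⟩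
    have h3 : ‖(c ^ n) ^ D‖ = ‖c ^ D‖ ^ n := by
      rw [norm_pow, norm_zpow, norm_pow, ← zpow_natCast, ← zpow_natCast, ← zpow_mul, ← zpow_mul,
        mul_comm]
    have h4 : 0 < ‖c ^ D‖ ^ n := zpow_pos (zero_lt_one.trans hcD) n
    rw [norm_div, h3, le_div_iff₀ h4, div_le_iff₀ h4, one_mul]
    refine ⟨h1, h2.le.trans_eq ?_⟩
    rw [zpow_add_one₀ (zero_lt_one.trans hcD).ne', mul_comm]
  choose n hn using key
  obtain ⟨ε, hε⟩ := l.exists_tendsto_of_bounded (s := fun k => y k / (c ^ n k) ^ D)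
    (C := ‖c ^ D‖) (by filter_upwards [h] with k hk using (hn k hk).2)
  have hε1 : 1 ≤ ‖ε‖ := ge_of_tendsto hε.norm (by filter_upwards [h] with k hk using (hn k hk).1)
  have hε0 : ε ≠ 0 := norm_pos_iff.1 (zero_lt_one.trans_le hε1)
  have hmap : Filter.map (fun z : 𝕜 => z ^ D) (𝓝 1) = 𝓝 1 := by
    have := (hasStrictDerivAt_pow D (1 : 𝕜)).map_nhds_eq (by simp [hD])
    simpa using this
  have hq : Tendsto (fun k => y k / (c ^ n k) ^ D / ε) l (𝓝 1) := by
    simpa [hε0] using hε.div_const ε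
  have hroot : ∀ᶠ v in 𝓝 (1 : 𝕜), ∃ ρ : 𝕜, ρ ^ D = v := by
    rw [← hmap]
    exact Eventually.of_forall (p := fun z : 𝕜 => ∃ ρ : 𝕜, ρ ^ D = z ^ D) fun z => ⟨z, rfl⟩
  have hr := hq.eventually hroot
  have : ∀ k, ∃ ρ : 𝕜, (∃ ρ : 𝕜, ρ ^ D = y k / (c ^ n k) ^ D / ε) →
      ρ ^ D = y k / (c ^ n k) ^ D / ε := by
    intro k
    by_cases hk : ∃ ρ : 𝕜, ρ ^ D = y k / (c ^ n k) ^ D / ε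
    · obtain ⟨ρ, hρ⟩ := hk
      exact ⟨ρ, fun _ => hρ⟩
    · exact ⟨0, fun h => absurd h hk⟩
  choose ρ hρ using this
  have hyw : ∀ᶠ k in (l : Filter ι), y k = ε * (c ^ n k * ρ k) ^ D := by
    filter_upwards [hr] with k hk
    rw [mul_pow, hρ k hk]
    have := zpow_ne_zero (n k) hc0
    field_simp
  refine ⟨ε, fun k => c ^ n k * ρ k, hε0, ?_, hyw⟩
  have hwD : Tendsto (fun k => (c ^ n k * ρ k) ^ D) l (𝓝 0) := by
    have h1 := hy.div_const ε
    rw [zero_div] at h1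
    refine h1.congr' ?_
    filter_upwards [hyw] with k hk
    rw [hk, mul_div_cancel_left₀ _ hε0]
  rw [tendsto_zero_iff_norm_tendsto_zero] at hwD ⊢
  simp only [norm_pow] at hwD
  rw [Metric.tendsto_nhds] at hwD ⊢
  intro δ hδ
  filter_upwards [hwD (δ ^ D) (by positivity)] with k hk
  simp only [dist_zero_right, norm_pow, norm_norm] at hk ⊢
  exact lt_of_pow_lt_pow_left₀ D hδ.le hk

end Uniformization

section Reduction

open Polynomial in
theorem Polynomial.exists_eval_add_eq_sum {R : Type*} [CommRing R] [IsDomain R] [CharZero R] (e : ℕ)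
    (b : ℕ → R) {r s₀ : R} (hr : r ≠ 0) (hs₀ : s₀ ≠ 0) :
    ∃ a : ℕ → R, a e ≠ 0 ∧ ∀ s, ∑ i ∈ Finset.range e, b i * (s₀ + s) ^ i + r * (s₀ + s) ^ (e + 1) =
      ∑ i ∈ Finset.range (e + 1), a i * s ^ i + s ^ (e + 1) * a (e + 1) := by
  let P : R[X] := ∑ i ∈ Finset.range e, monomial i (b i) + monomial (e + 1) r
  have hP : P.natDegree < e + 2 := by
    refine lt_of_le_of_lt (natDegree_add_le_of_le (n := e + 1) (m := e + 1) ?_ ?_) (by simp)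
    · refine natDegree_sum_le_of_forall_le _ _ fun i hi => (natDegree_monomial_le _).trans ?_
      have := Finset.mem_range.1 hi
      omega
    · exact natDegree_monomial_le _
  refine ⟨fun i => (taylor s₀ P).coeff i, ?_, fun s => ?_⟩
  · simp only [P, map_add, map_sum, taylor_monomial, coeff_add, finsetSum_coeff, coeff_C_mul,
      coeff_X_add_C_pow]
    rw [Finset.sum_eq_zero, zero_add]
    · simp only [Nat.choose_succ_self_right, Nat.add_sub_cancel_left, pow_one]
      exact mul_ne_zero hr (mul_ne_zero hs₀ (Nat.cast_ne_zero.2 (by omega)))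
    · intro i hi
      rw [Nat.choose_eq_zero_of_lt (Finset.mem_range.1 hi)]
      simp
  · have h1 := taylor_eval s₀ P s
    rw [eval_eq_sum_range' (n := e + 2) (by rwa [natDegree_taylor]), Finset.sum_range_succ] at h1
    rw [mul_comm (s ^ (e + 1)), h1]
    simp [P, eval_finsetSum, add_comm s s₀]

variable {𝕜 : Type*} [NontriviallyNormedField 𝕜] {ι : Type*} {N : ℕ}

/-- Germs that have order `d` in the last variable, times germs in the other variables, can be
uniformized along `l`. -/
def UniformizableOfOrder (𝕜 : Type*) [NontriviallyNormedField 𝕜] (N d : ℕ) (l : Filter ι) : Prop :=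
  ∀ (F : (Fin N → 𝕜) × 𝕜 → 𝕜) (h : 𝕜 → 𝕜), AnalyticAt 𝕜 F 0 → AnalyticAt 𝕜 h 0 → h 0 ≠ 0 →
    (∀ᶠ t in 𝓝 0, F (0, t) = t ^ d * h t) → ∀ H : (Fin N → 𝕜) → 𝕜, AnalyticAt 𝕜 H 0 →
    ¬ H =ᶠ[𝓝 0] 0 → ∀ x : ι → (Fin N → 𝕜) × 𝕜, Tendsto x l (𝓝 0) →
    Uniformizes (N + 1) l x (fun q => F q * H q.1)

/-- Multiplication of the `j`-th coordinate by `t`. -/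
def scaleCoord (j : Fin N) (t : 𝕜) (y : Fin N → 𝕜) : Fin N → 𝕜 :=
  fun i => (if i = j then t else 1) * y i

theorem monom_scaleCoord (m : Fin N → ℕ) (j : Fin N) (t : 𝕜) (y : Fin N → 𝕜) :
    monom m (scaleCoord j t y) = t ^ m j * monom m y := by
  unfold scaleCoord
  rw [monom_mul]
  congr 1
  rw [monom, Finset.prod_eq_single j]
  · simp
  · intro i _ hi; simp [hi]
  · simp

theorem analyticAt_scaleCoord (j : Fin N) (q : (Fin N → 𝕜) × 𝕜) :
    AnalyticAt 𝕜 (fun q : (Fin N → 𝕜) × 𝕜 => scaleCoord j q.2 q.1) q := by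
  refine AnalyticAt.pi fun i => ?_
  have h1 : AnalyticAt 𝕜 (fun q : (Fin N → 𝕜) × 𝕜 => q.1 i) q :=
    ((ContinuousLinearMap.proj (R := 𝕜) (φ := fun _ : Fin N => 𝕜) i).comp
      (ContinuousLinearMap.fst 𝕜 _ 𝕜)).analyticAt q
  by_cases h : i = j
  · simp only [scaleCoord, if_pos h]
    exact analyticAt_snd.mul h1
  · simpa [scaleCoord, h] using h1

/-- Division of the last variable into the `j`-th one: the chart in which the `j`-th coordinate is
a multiple of the last one. -/
theorem uniformizes_of_coord_eq_mul {l : Filter ι} {e : ℕ} {β : Fin N → ℕ} {j : Fin N}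
    (hβ : β j ≠ 0) {c : ℕ → (Fin N → 𝕜) → 𝕜} (hc : ∀ i, AnalyticAt 𝕜 (c i) 0)
    {R : (Fin N → 𝕜) × 𝕜 → 𝕜} (hR : AnalyticAt 𝕜 R 0) (hR0 : R 0 ≠ 0) {H : (Fin N → 𝕜) → 𝕜}
    (hH : IsMonomialGerm H) {x : ι → (Fin N → 𝕜) × 𝕜} (hx : Tendsto x l (𝓝 0)) {s : ι → 𝕜}
    (hs : Tendsto s l (𝓝 0)) (hxs : ∀ᶠ k in l, (x k).1 j = (x k).2 * s k) :
    Uniformizes (N + 1) l x (fun q => (∑ i ∈ Finset.range e,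
      monom β q.1 ^ (e + 1 - i) * c i q.1 * q.2 ^ i + q.2 ^ (e + 1) * R q) * H q.1) := by
  obtain ⟨m, v, hv, hv0, hHv⟩ := hH
  set ψ : (Fin N → 𝕜) × 𝕜 → (Fin N → 𝕜) × 𝕜 := fun q => (scaleCoord j q.2 q.1, q.2) with hψ
  have hψ1 := analyticAt_scaleCoord (𝕜 := 𝕜) j 0
  have hψa : AnalyticAt 𝕜 ψ 0 := hψ1.prod analyticAt_snd
  have hψ10 : scaleCoord j (0 : (Fin N → 𝕜) × 𝕜).2 (0 : (Fin N → 𝕜) × 𝕜).1 = 0 := by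
    ext i; simp [scaleCoord]
  have hψ0 : ψ 0 = 0 := by simp only [hψ, hψ10]; rfl
  have hfst : AnalyticAt 𝕜 (fun q : (Fin N → 𝕜) × 𝕜 => q.1) 0 := analyticAt_fst
  refine Uniformizes.of_comp (y := fun k => (Function.update (x k).1 j (s k), (x k).2)) hψa hψ0 ?_
    (Uniformizes.of_monomial (H := monom m) (k := e + 1 + m j)
      (u := fun q => (∑ i ∈ Finset.range e, monom β q.1 ^ (e + 1 - i) * c i (ψ q).1 *
        q.2 ^ ((β j - 1) * (e + 1 - i)) + R (ψ q)) * v (ψ q).1) ?_ ?_ (isMonomialGerm_monom m)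
        ?_ ?_)
  · filter_upwards [hxs] with k hk
    refine Prod.ext (funext fun i => ?_) rfl
    by_cases h : i = j
    · subst h; simp [hψ, scaleCoord, hk]
    · simp [hψ, scaleCoord, h]
  · refine ((Finset.analyticAt_fun_sum _ fun i _ => ?_).add
      (AnalyticAt.comp_of_eq hR hψa hψ0)).mul (AnalyticAt.comp_of_eq hv hψ1 hψ10)
    exact (((AnalyticAt.comp_of_eq (analyticAt_monom β 0) hfst rfl).pow _).mul
      (AnalyticAt.comp_of_eq (hc i) hψ1 hψ10)).mul (analyticAt_snd.pow _)
  · rw [Finset.sum_eq_zero, hψ0, zero_add]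
    · exact mul_ne_zero hR0 hv0
    · intro i hi
      have := Finset.mem_range.1 hi
      rw [monom_eq_zero hβ (by simp), zero_pow (by omega)]
      simp
  · filter_upwards [(hψ1.tendsto_zero hψ10).eventually hHv] with q hq
    simp only [hψ] at hq ⊢
    rw [hq, monom_scaleCoord, monom_scaleCoord]
    have h1 : ∀ i ∈ Finset.range e, (q.2 ^ β j * monom β q.1) ^ (e + 1 - i) *
        c i (scaleCoord j q.2 q.1) * q.2 ^ i = q.2 ^ (e + 1) *
        (monom β q.1 ^ (e + 1 - i) * c i (scaleCoord j q.2 q.1) *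
        q.2 ^ ((β j - 1) * (e + 1 - i))) := by
      intro i hi
      have h2 := Finset.mem_range.1 hi
      have h3 : (q.2 ^ β j) ^ (e + 1 - i) * q.2 ^ i =
          q.2 ^ (e + 1) * q.2 ^ ((β j - 1) * (e + 1 - i)) := by
        rw [← pow_mul, ← pow_add, ← pow_add]
        congr 1
        obtain ⟨b, hb⟩ := Nat.exists_eq_succ_of_ne_zero hβ
        rw [hb, Nat.succ_sub_one, Nat.succ_mul]
        omega
      rw [mul_pow]
      linear_combination monom β q.1 ^ (e + 1 - i) * c i (scaleCoord j q.2 q.1) * h3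
    rw [Finset.sum_congr rfl h1, ← Finset.mul_sum]
    ring
  · refine Tendsto.prodMk_nhds ?_ hx.snd_nhds
    rw [tendsto_pi_nhds]
    intro i
    by_cases h : i = j
    · subst h; simpa using hs
    · simpa [h] using (tendsto_pi_nhds.1 hx.fst_nhds) i

theorem uniformizes_of_reduced [CompleteSpace 𝕜] [CharZero 𝕜] [ProperSpace 𝕜] {l : Ultrafilter ι}
    {e : ℕ} (ih : ∀ d < e + 1, UniformizableOfOrder 𝕜 N d (l : Filter ι)) (β : Fin N → ℕ)
    {c : ℕ → (Fin N → 𝕜) → 𝕜} (hc : ∀ i, AnalyticAt 𝕜 (c i) 0) {i₀ : ℕ} (hi₀ : i₀ < e)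
    (hci₀ : c i₀ 0 ≠ 0)
    {R : (Fin N → 𝕜) × 𝕜 → 𝕜} (hR : AnalyticAt 𝕜 R 0) (hR0 : R 0 ≠ 0) {H : (Fin N → 𝕜) → 𝕜}
    (hH : IsMonomialGerm H) {x : ι → (Fin N → 𝕜) × 𝕜} (hx : Tendsto x l (𝓝 0)) :
    Uniformizes (N + 1) l x (fun q => (∑ i ∈ Finset.range e,
      monom β q.1 ^ (e + 1 - i) * c i q.1 * q.2 ^ i + q.2 ^ (e + 1) * R q) * H q.1) := by
  induction hn : ∑ i, β i using Nat.strong_induction_on generalizing β R H x with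
  | _ n ihn =>
  have hfst : AnalyticAt 𝕜 (fun q : (Fin N → 𝕜) × 𝕜 => q.1) 0 := analyticAt_fst
  have hmon : ∀ m : Fin N → ℕ, AnalyticAt 𝕜 (fun q : (Fin N → 𝕜) × 𝕜 => monom m q.1) 0 := fun m =>
    AnalyticAt.comp_of_eq (g := monom m) (analyticAt_monom m 0) hfst rfl
  have hcfst : ∀ i, AnalyticAt 𝕜 (fun q : (Fin N → 𝕜) × 𝕜 => c i q.1) 0 := fun i =>
    AnalyticAt.comp_of_eq (hc i) hfst rfl
  have hax : AnalyticAt 𝕜 (fun t : 𝕜 => ((0 : Fin N → 𝕜), t)) 0 :=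
    analyticAt_const.prod analyticAt_id
  by_cases hβ : β = 0
  · subst hβ
    have hF : AnalyticAt 𝕜 (fun q : (Fin N → 𝕜) × 𝕜 => ∑ i ∈ Finset.range e,
        monom 0 q.1 ^ (e + 1 - i) * c i q.1 * q.2 ^ i + q.2 ^ (e + 1) * R q) 0 :=
      (Finset.analyticAt_fun_sum _ fun i _ => (((hmon _).pow _).mul (hcfst i)).mul
        (analyticAt_snd.pow _)).add ((analyticAt_snd.pow _).mul hR)
    obtain ⟨d, hd, h, hh, hh0, hFh⟩ :=
      (AnalyticAt.comp_of_eq hF hax rfl).exists_eq_pow_mul_of_coeff_ne_zero (d := e)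
        (a := fun i => c i 0) (A := fun t => t * R (0, t))
      (continuousAt_id.mul (AnalyticAt.comp_of_eq hR hax rfl).continuousAt)
      (Eventually.of_forall fun t => by simp; ring) hi₀ hci₀
    exact ih d (by omega) _ h hF hh hh0 hFh H hH.analyticAt hH.not_eventuallyEq_zero x hx
  obtain ⟨j, hj⟩ := Function.ne_iff.1 hβ
  simp only [Pi.zero_apply] at hj
  rcases l.exists_tendsto_quotient (fun k => (x k).1 j) (fun k => (x k).2) with
    ⟨s, s₀, hs, hxs⟩ | ⟨s, hs, hxs⟩
  swap
  · exact uniformizes_of_coord_eq_mul hj hc hR hR0 hH hx hs hxs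
  set ψ : (Fin N → 𝕜) × 𝕜 → (Fin N → 𝕜) × 𝕜 := fun q => (q.1, q.1 j * (s₀ + q.2)) with hψ
  have hcoord : AnalyticAt 𝕜 (fun q : (Fin N → 𝕜) × 𝕜 => q.1 j) 0 :=
    ((ContinuousLinearMap.proj (R := 𝕜) (φ := fun _ : Fin N => 𝕜) j).comp
      (ContinuousLinearMap.fst 𝕜 _ 𝕜)).analyticAt 0
  have hsh : AnalyticAt 𝕜 (fun q : (Fin N → 𝕜) × 𝕜 => s₀ + q.2) 0 :=
    analyticAt_const.add analyticAt_snd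
  have hψa : AnalyticAt 𝕜 ψ 0 := hfst.prod (hcoord.mul hsh)
  have hψ0 : ψ 0 = 0 := by ext <;> simp [hψ]
  have hRψ : AnalyticAt 𝕜 (fun q => R (ψ q)) 0 := AnalyticAt.comp_of_eq hR hψa hψ0
  have hH' : IsMonomialGerm (fun y : Fin N → 𝕜 => y j ^ (e + 1) * H y) := by
    refine IsMonomialGerm.mul ((isMonomialGerm_monom (Pi.single j (e + 1))).congr
      (Eventually.of_forall fun y => ?_)) hH
    rw [monom_single]
  refine Uniformizes.of_comp (y := fun k => ((x k).1, s k - s₀)) hψa hψ0 ?_ ?_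
  · filter_upwards [hxs] with k hk
    simp only [hψ, add_sub_cancel]
    exact Prod.ext rfl hk.symm
  have hy : Tendsto (fun k => ((x k).1, s k - s₀)) l (𝓝 0) := by
    refine Tendsto.prodMk_nhds hx.fst_nhds ?_
    simpa using hs.sub_const s₀
  set F : (Fin N → 𝕜) × 𝕜 → 𝕜 := fun q => ∑ i ∈ Finset.range e,
    monom (β - Pi.single j 1) q.1 ^ (e + 1 - i) * c i q.1 * (s₀ + q.2) ^ i +
      (s₀ + q.2) ^ (e + 1) * R (ψ q) with hF
  suffices Uniformizes (N + 1) l (fun k => ((x k).1, s k - s₀))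
      (fun q => F q * (q.1 j ^ (e + 1) * H q.1)) by
    refine this.congr (Eventually.of_forall fun q => ?_)
    simp only [hF]
    have h1 : ∀ i ∈ Finset.range e, monom β (ψ q).1 ^ (e + 1 - i) * c i (ψ q).1 * (ψ q).2 ^ i =
        q.1 j ^ (e + 1) * (monom (β - Pi.single j 1) q.1 ^ (e + 1 - i) * c i q.1 *
          (s₀ + q.2) ^ i) := by
      intro i hi
      have h2 := Finset.mem_range.1 hi
      have h3 : q.1 j ^ (e + 1) = q.1 j ^ (e + 1 - i) * q.1 j ^ i := by
        rw [← pow_add]; congr 1; omega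
      simp only [hψ]
      rw [monom_eq_mul_sub_single hj, h3, mul_pow, mul_pow]
      ring
    rw [Finset.sum_congr rfl h1, ← Finset.mul_sum]
    simp only [hψ, mul_pow]
    ring
  by_cases hs0 : s₀ = 0
  · subst hs0
    have := ihn _ ((sum_sub_single_lt hj).trans_eq hn) (β - Pi.single j 1) hRψ (by rwa [hψ0])
      hH' hy rfl
    simpa only [hF, zero_add] using this
  · have hFa : AnalyticAt 𝕜 F 0 :=
      (Finset.analyticAt_fun_sum _ fun i _ => (((hmon _).pow _).mul (hcfst i)).mul
        (hsh.pow _)).add ((hsh.pow _).mul hRψ)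
    obtain ⟨a, ha, hab⟩ := Polynomial.exists_eval_add_eq_sum e
      (fun i => monom (β - Pi.single j 1) (0 : Fin N → 𝕜) ^ (e + 1 - i) * c i 0) hR0 hs0
    obtain ⟨d, hd, h, hh, hh0, hFh⟩ :=
      (AnalyticAt.comp_of_eq hFa hax rfl).exists_eq_pow_mul_of_coeff_ne_zero (d := e + 1)
        (a := a) (A := fun _ => a (e + 1)) continuousAt_const
      (Eventually.of_forall fun t => by
        rw [← hab t]
        have : ψ (0, t) = 0 := by ext <;> simp [hψ]
        simp only [Function.comp_def, hF, this]
        ring) (Nat.lt_succ_self e) ha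
    exact ih d hd F h hFa hh hh0 hFh _ hH'.analyticAt hH'.not_eventuallyEq_zero _ hy

end Reduction

section Order

variable {𝕜 : Type*} [NontriviallyNormedField 𝕜] {ι : Type*} {N M : ℕ}

theorem Uniformizes.of_comp_fst {l : Filter ι} {x : ι → (Fin N → 𝕜) × 𝕜}
    {F : (Fin N → 𝕜) × 𝕜 → 𝕜} {π : (Fin N → 𝕜) → Fin N → 𝕜} {z : ι → Fin N → 𝕜}
    (hπ : AnalyticAt 𝕜 π 0) (hπ0 : π 0 = 0) (hz : ∀ᶠ k in l, π (z k) = (x k).1)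
    (h : Uniformizes M l (fun k => (z k, (x k).2)) (fun q => F (π q.1, q.2))) :
    Uniformizes M l x F := by
  refine Uniformizes.of_comp (ψ := fun q : (Fin N → 𝕜) × 𝕜 => (π q.1, q.2))
    ((AnalyticAt.comp_of_eq hπ analyticAt_fst rfl).prod analyticAt_snd) (by simp [hπ0]) ?_ h
  filter_upwards [hz] with k hk
  exact Prod.ext hk rfl

theorem exists_least_exponent {e : ℕ} {c : ℕ → (Fin N → 𝕜) → 𝕜} {k : ℕ → ℕ}
    (hc : ∀ i < e, c i =ᶠ[𝓝 0] 0 ∨ IsMonomialGerm (c i))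
    (hsub : ∀ i < e, ∀ j < e, (fun y => c i y ^ k i - c j y ^ k j) =ᶠ[𝓝 0] 0 ∨
      IsMonomialGerm (fun y => c i y ^ k i - c j y ^ k j))
    (hne : ∃ i < e, ¬ c i =ᶠ[𝓝 0] 0) :
    ∃ (γ : ℕ → Fin N → ℕ) (u : ℕ → (Fin N → 𝕜) → 𝕜), (∀ i, AnalyticAt 𝕜 (u i) 0) ∧
      (∀ i < e, c i =ᶠ[𝓝 0] fun y => u i y * monom (γ i) y) ∧
      ∃ i₀ < e, u i₀ 0 ≠ 0 ∧ ∀ i < e, u i = 0 ∨ k i₀ • γ i₀ ≤ k i • γ i := by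
  classical
  have h1 : ∀ i, ∃ (γ : Fin N → ℕ) (u : (Fin N → 𝕜) → 𝕜), AnalyticAt 𝕜 u 0 ∧
      (i < e → c i =ᶠ[𝓝 0] fun y => u y * monom γ y) ∧ (u = 0 ∨ u 0 ≠ 0) := by
    intro i
    by_cases hi : i < e
    · rcases hc i hi with h | ⟨m, u, hu, hu0, h⟩
      · exact ⟨0, 0, analyticAt_const,
          fun _ => h.trans (Eventually.of_forall fun y => by simp), Or.inl rfl⟩
      · exact ⟨m, u, hu, fun _ => h, Or.inr hu0⟩
    · exact ⟨0, 0, analyticAt_const, fun h => absurd h hi, Or.inl rfl⟩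
  choose γ u hu hcu hu0 using h1
  refine ⟨γ, u, hu, hcu, ?_⟩
  have htot : ∀ i < e, ∀ j < e, u i 0 ≠ 0 → u j 0 ≠ 0 →
      k i • γ i ≤ k j • γ j ∨ k j • γ j ≤ k i • γ i := by
    intro i hi j hj hi0 hj0
    refine le_or_le_of_isMonomialGerm_sub (u := fun y => u i y ^ k i) (v := fun y => u j y ^ k j)
      ((hu i).continuousAt.pow _) ((hu j).continuousAt.pow _) (pow_ne_zero _ hi0)
      (pow_ne_zero _ hj0) ?_
    have heq : (fun y => c i y ^ k i - c j y ^ k j) =ᶠ[𝓝 0] fun y =>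
        u i y ^ k i * monom (k i • γ i) y - u j y ^ k j * monom (k j • γ j) y := by
      filter_upwards [hcu i hi, hcu j hj] with y h1 h2
      rw [h1, h2, monom_nsmul, monom_nsmul, mul_pow, mul_pow]
    exact (hsub i hi j hj).imp (fun h => heq.symm.trans h) fun h => h.congr heq
  obtain ⟨i₁, hi₁, hci₁⟩ := hne
  have hui₁ : u i₁ 0 ≠ 0 := by
    refine (hu0 i₁).resolve_left fun h => hci₁ ?_
    filter_upwards [hcu i₁ hi₁] with y hy
    rw [hy, h]
    simp
  obtain ⟨i₀, hi₀, hmin⟩ := Finset.exists_min_image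
    {i ∈ Finset.range e | u i 0 ≠ 0} (fun i => ∑ j, (k i • γ i) j) ⟨i₁, by simp [hi₁, hui₁]⟩
  simp only [Finset.mem_filter, Finset.mem_range] at hi₀ hmin
  refine ⟨i₀, hi₀.1, hi₀.2, fun i hi => (hu0 i).imp_right fun hi0 => ?_⟩
  refine (htot i₀ hi₀.1 i hi hi₀.2 hi0).elim id fun h => ?_
  refine le_of_eq (funext fun j => ?_)
  exact ((Finset.sum_eq_sum_iff_of_le fun j _ => h j).1
    (le_antisymm (Finset.sum_le_sum fun j _ => h j) (hmin i ⟨hi, hi0⟩)) j (Finset.mem_univ j)).symm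

variable [CompleteSpace 𝕜] [CharZero 𝕜] [ProperSpace 𝕜] {l : Ultrafilter ι}

theorem uniformizes_of_monomial_coeffs {e D : ℕ} (hD : D ≠ 0)
    (ih : ∀ d < e + 1, UniformizableOfOrder 𝕜 N d (l : Filter ι))
    {c u : ℕ → (Fin N → 𝕜) → 𝕜} {γ : ℕ → Fin N → ℕ} {k : ℕ → ℕ}
    (hk : ∀ i < e, (e + 1 - i) * k i = D) (hu : ∀ i, AnalyticAt 𝕜 (u i) 0)
    (hcu : ∀ i < e, c i =ᶠ[𝓝 0] fun y => u i y * monom (γ i) y) {i₀ : ℕ} (hi₀ : i₀ < e)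
    (hui₀ : u i₀ 0 ≠ 0) (hle : ∀ i < e, u i = 0 ∨ k i₀ • γ i₀ ≤ k i • γ i)
    {R : (Fin N → 𝕜) × 𝕜 → 𝕜} (hR : AnalyticAt 𝕜 R 0) (hR0 : R 0 ≠ 0) {H : (Fin N → 𝕜) → 𝕜}
    (hH : IsMonomialGerm H) {x : ι → (Fin N → 𝕜) × 𝕜} (hx : Tendsto x l (𝓝 0)) :
    Uniformizes (N + 1) l x (fun q => (∑ i ∈ Finset.range e,
      c i q.1 * q.2 ^ i + q.2 ^ (e + 1) * R q) * H q.1) := by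
  choose ε w hε hw hwx using fun i : Fin N =>
    l.exists_eq_mul_pow hD (y := fun k => (x k).1 i) ((tendsto_pi_nhds.1 hx.fst_nhds) i)
  set σ : (Fin N → 𝕜) → Fin N → 𝕜 := fun z i => ε i * z i ^ D with hσ
  have hσa : AnalyticAt 𝕜 σ 0 := by
    refine AnalyticAt.pi fun i => analyticAt_const.mul (AnalyticAt.pow ?_ D)
    exact (ContinuousLinearMap.proj (R := 𝕜) (φ := fun _ : Fin N => 𝕜) i).analyticAt 0
  have hσ0 : σ 0 = 0 := by ext i; simp [hσ, hD]
  have hσt := hσa.tendsto_zero hσ0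
  have hfst : Tendsto (fun q : (Fin N → 𝕜) × 𝕜 => q.1) (𝓝 0) (𝓝 0) := continuous_fst.tendsto 0
  have hmon : ∀ (m : Fin N → ℕ) z, monom m (σ z) = monom m ε * monom (D • m) z := by
    intro m z
    rw [hσ, monom_mul, monom_pow, monom_nsmul]
  refine Uniformizes.of_comp_fst (z := fun k i => w i k) hσa hσ0 ?_ ?_
  · filter_upwards [eventually_all.2 hwx] with k hk
    exact funext fun i => (hk i).symm
  have hHσ : IsMonomialGerm (fun z => H (σ z)) := by
    obtain ⟨m, v, hv, hv0, hHv⟩ := hH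
    refine ⟨D • m, fun z => v (σ z) * monom m ε, (AnalyticAt.comp_of_eq hv hσa hσ0).mul
      analyticAt_const, ?_, ?_⟩
    · simp only [hσ0]
      exact mul_ne_zero hv0 (monom_ne_zero hε)
    · filter_upwards [hσt.eventually hHv] with z hz
      rw [hz, hmon, mul_assoc]
  have hψa : AnalyticAt 𝕜 (fun q : (Fin N → 𝕜) × 𝕜 => (σ q.1, q.2)) 0 :=
    (AnalyticAt.comp_of_eq hσa analyticAt_fst rfl).prod analyticAt_snd
  have hψ0 : (fun q : (Fin N → 𝕜) × 𝕜 => (σ q.1, q.2)) 0 = 0 := by simp [hσ0]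
  refine Uniformizes.congr (uniformizes_of_reduced ih (k i₀ • γ i₀)
    (c := fun i z => u i (σ z) * monom (γ i) ε * monom (k i • γ i - k i₀ • γ i₀) z ^ (e + 1 - i))
    (fun i => ((AnalyticAt.comp_of_eq (hu i) hσa hσ0).mul analyticAt_const).mul
      ((analyticAt_monom _ 0).pow _)) hi₀ ?_ (AnalyticAt.comp_of_eq hR hψa hψ0)
    (R := fun q => R (σ q.1, q.2)) (by simp only [Prod.fst_zero, Prod.snd_zero, hσ0]; exact hR0)
    hHσ ?_) ?_
  · simp only [hσ0, tsub_self, monom_zero, one_pow, mul_one]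
    exact mul_ne_zero hui₀ (monom_ne_zero hε)
  · exact Tendsto.prodMk_nhds (tendsto_pi_nhds.2 hw) hx.snd_nhds
  · have hcoef : ∀ i ∈ Finset.range e, ∀ᶠ q : (Fin N → 𝕜) × 𝕜 in 𝓝 0,
        monom (k i₀ • γ i₀) q.1 ^ (e + 1 - i) * (u i (σ q.1) * monom (γ i) ε *
          monom (k i • γ i - k i₀ • γ i₀) q.1 ^ (e + 1 - i)) = c i (σ q.1) := by
      intro i hi
      rw [Finset.mem_range] at hi
      filter_upwards [hfst.eventually (hσt.eventually (hcu i hi))] with q hq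
      rw [hq, hmon]
      rcases hle i hi with h | h
      · simp [h]
      · rw [← hk i hi, mul_smul, monom_nsmul (e + 1 - i)]
        conv_rhs => rw [← tsub_add_cancel_of_le h, monom_add, mul_pow]
        ring
    filter_upwards [(Finset.eventually_all _).2 hcoef] with q hq
    congr 2
    exact Finset.sum_congr rfl fun i hi => by rw [hq i hi]

theorem LocallyUniformizable.uniformizableOfOrder
    (hl : LocallyUniformizable 𝕜 N (l : Filter ι)) (d : ℕ) :
    UniformizableOfOrder 𝕜 N d (l : Filter ι) := by
  induction d using Nat.strong_induction_on with
  | _ d ih =>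
  intro F h hF hh hh0 hFh H hH hH0 x hx
  rcases d with - | e
  · obtain ⟨π, z, hπ, hπ0, hz, hzx, hm⟩ := hl H hH hH0 (fun k => (x k).1) hx.fst_nhds
    refine Uniformizes.of_comp_fst hπ hπ0 hzx (Uniformizes.of_monomial
      (u := fun q => F (π q.1, q.2)) (k := 0) (AnalyticAt.comp_of_eq hF
      ((AnalyticAt.comp_of_eq hπ analyticAt_fst rfl).prod analyticAt_snd) (by simp [hπ0])) ?_ hm
      (Eventually.of_forall fun q => by simp) (hz.prodMk_nhds hx.snd_nhds))
    have := hFh.self_of_nhds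
    rw [pow_zero, one_mul] at this
    rw [Prod.fst_zero, Prod.snd_zero, hπ0, this]
    exact hh0
  obtain ⟨φ, c, R, hφ, hφ0, hc, hR, hR0, hFc⟩ := hF.exists_tschirnhausen hh hh0 hFh
  have hφfst : AnalyticAt 𝕜 (fun q : (Fin N → 𝕜) × 𝕜 => φ q.1) 0 :=
    AnalyticAt.comp_of_eq hφ analyticAt_fst rfl
  refine Uniformizes.of_comp (ψ := fun q : (Fin N → 𝕜) × 𝕜 => (q.1, q.2 + φ q.1))
    (y := fun k => ((x k).1, (x k).2 - φ (x k).1))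
    (analyticAt_fst.prod (analyticAt_snd.add hφfst)) (by simp [hφ0])
    (Eventually.of_forall fun k => by simp) ?_
  have hx' : Tendsto (fun k => ((x k).1, (x k).2 - φ (x k).1)) l (𝓝 0) := by
    refine hx.fst_nhds.prodMk_nhds ?_
    simpa using hx.snd_nhds.sub ((hφ.tendsto_zero hφ0).comp hx.fst_nhds)
  refine Uniformizes.congr (F := fun q => (∑ i ∈ Finset.range e, c i q.1 * q.2 ^ i +
    q.2 ^ (e + 1) * R q) * H q.1) ?_ (by filter_upwards [hFc] with q hq; rw [hq])
  generalize (fun k => ((x k).1, (x k).2 - φ (x k).1)) = y at hx'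
  set k : ℕ → ℕ := fun i => (e + 1).factorial / (e + 1 - i) with hkdef
  have hk : ∀ i < e, (e + 1 - i) * k i = (e + 1).factorial := fun i hi =>
    Nat.mul_div_cancel' (Nat.dvd_factorial (by omega) (by omega))
  -- the germs to be made monomial
  let T : Option (ℕ ⊕ ℕ × ℕ) → (Fin N → 𝕜) → 𝕜 := fun o => o.elim H
    (Sum.elim c fun ij z => c ij.1 z ^ k ij.1 - c ij.2 z ^ k ij.2)
  obtain ⟨π, z, hπ, hπ0, hz, hzx, hm⟩ := hl.finset (F := T) (Finset.insertNone
    ((Finset.range e).disjSum (Finset.range e ×ˢ Finset.range e))) (by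
      rintro (- | i | ij) -
      · exact hH
      · exact hc i
      · exact ((hc ij.1).pow _).sub ((hc ij.2).pow _)) hx'.fst_nhds
  have hπt := hπ.tendsto_zero hπ0
  have hHπ : IsMonomialGerm (fun z => H (π z)) := (hm none (by simp)).resolve_left hH0
  have hcπ : ∀ i < e, (fun z => c i (π z)) =ᶠ[𝓝 0] 0 ∨ IsMonomialGerm (fun z => c i (π z)) :=
    fun i hi => (hm (some (Sum.inl i)) (by simpa using hi)).imp_left
      fun h => h.comp_tendsto hπt
  have hsub : ∀ i < e, ∀ j < e, (fun z => c i (π z) ^ k i - c j (π z) ^ k j) =ᶠ[𝓝 0] 0 ∨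
      IsMonomialGerm (fun z => c i (π z) ^ k i - c j (π z) ^ k j) :=
    fun i hi j hj => (hm (some (Sum.inr (i, j))) (by simp [hi, hj])).imp_left
      fun h => h.comp_tendsto hπt
  have hψa : AnalyticAt 𝕜 (fun q : (Fin N → 𝕜) × 𝕜 => (π q.1, q.2)) 0 :=
    (AnalyticAt.comp_of_eq hπ analyticAt_fst rfl).prod analyticAt_snd
  have hRπ : AnalyticAt 𝕜 (fun q : (Fin N → 𝕜) × 𝕜 => R (π q.1, q.2)) 0 :=
    AnalyticAt.comp_of_eq hR hψa (by simp [hπ0])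
  have hRπ0 : (fun q : (Fin N → 𝕜) × 𝕜 => R (π q.1, q.2)) 0 ≠ 0 := by
    simp only [Prod.fst_zero, Prod.snd_zero, hπ0]; exact hR0
  have hzy : Tendsto (fun k => (z k, (y k).2)) l (𝓝 0) := hz.prodMk_nhds hx'.snd_nhds
  refine Uniformizes.of_comp_fst hπ hπ0 hzx ?_
  by_cases hne : ∃ i < e, ¬ (fun z => c i (π z)) =ᶠ[𝓝 0] 0
  · obtain ⟨γ, u, hu, hcu, i₀, hi₀, hui₀, hle⟩ := exists_least_exponent hcπ hsub hne
    exact uniformizes_of_monomial_coeffs (Nat.factorial_ne_zero _) ih hk hu hcu hi₀ hui₀ hle hRπ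
      hRπ0 hHπ hzy
  · push Not at hne
    refine Uniformizes.of_monomial (k := e + 1) hRπ hRπ0 hHπ ?_ hzy
    have hfst : Tendsto (fun q : (Fin N → 𝕜) × 𝕜 => q.1) (𝓝 0) (𝓝 0) := continuous_fst.tendsto 0
    have hall : ∀ i ∈ Finset.range e, ∀ᶠ q : (Fin N → 𝕜) × 𝕜 in 𝓝 0, c i (π q.1) = 0 :=
      fun i hi => hfst.eventually (hne i (Finset.mem_range.1 hi))
    filter_upwards [(Finset.eventually_all _).2 hall] with q hq
    rw [Finset.sum_eq_zero fun i hi => by rw [hq i hi, zero_mul]]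
    ring

end Order

section LocalUniformization

variable {𝕜 : Type*} [NontriviallyNormedField 𝕜] {E : Type*} [NormedAddCommGroup E]
  [NormedSpace 𝕜 E] {ι : Type*} {N : ℕ}

theorem AnalyticAt.eventuallyEq_zero_of_forall_line {F : E → 𝕜} (hF : AnalyticAt 𝕜 F 0)
    (h : ∀ v : E, ∀ᶠ t : 𝕜 in 𝓝 0, F (t • v) = 0) : F =ᶠ[𝓝 0] 0 := by
  obtain ⟨p, hp⟩ := hF
  have key : ∀ n (v : E), p n (fun _ => v) = 0 := by
    intro n v
    let L : 𝕜 →L[𝕜] E := (ContinuousLinearMap.id 𝕜 𝕜).smulRight v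
    have hL : HasFPowerSeriesAt F p (L 0) := by simpa using hp
    have h1 : HasFPowerSeriesAt (F ∘ L) (p.compContinuousLinearMap L) 0 :=
      hL.compContinuousLinearMap
    have h2 : F ∘ L =ᶠ[𝓝 0] 0 := h v
    have h3 := (h1.congr h2).eq_zero
    have h4 := congrArg (fun q : FormalMultilinearSeries 𝕜 𝕜 𝕜 => q n fun _ => 1) h3
    simpa [L, FormalMultilinearSeries.compContinuousLinearMap, Function.comp_def] using h4
  obtain ⟨r, hr⟩ := hp
  filter_upwards [Metric.eball_mem_nhds (0 : E) hr.r_pos] with v hv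
  have h1 := hr.hasSum hv
  simp only [key, zero_add] at h1
  exact h1.unique hasSum_zero

theorem Uniformizes.of_ne_zero {l : Filter ι} {F : (Fin N → 𝕜) → 𝕜} (hF : AnalyticAt 𝕜 F 0)
    (h0 : F 0 ≠ 0) {x : ι → Fin N → 𝕜} (hx : Tendsto x l (𝓝 0)) : Uniformizes N l x F :=
  ⟨id, x, analyticAt_id, rfl, hx, Eventually.of_forall fun _ => rfl, .of_ne_zero hF h0⟩

/-- Local uniformization of analytic germs along an ultrafilter. -/
theorem locallyUniformizable [CompleteSpace 𝕜] [CharZero 𝕜] [ProperSpace 𝕜] (N : ℕ)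
    (l : Ultrafilter ι) : LocallyUniformizable 𝕜 N (l : Filter ι) := by
  induction N with
  | zero =>
    intro F hF hF0 x hx
    refine Uniformizes.of_ne_zero hF (fun h0 => hF0 (Eventually.of_forall fun y => ?_)) hx
    rw [Subsingleton.elim y 0, h0]
    rfl
  | succ N ih =>
    intro F hF hF0 x hx
    by_cases h0 : F 0 = 0
    swap
    · exact Uniformizes.of_ne_zero hF h0 hx
    obtain ⟨v, hv⟩ := not_forall.1 fun h => hF0 (hF.eventuallyEq_zero_of_forall_line h)
    have hv0 : v ≠ 0 := by
      rintro rfl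
      exact hv (by simp [h0])
    obtain ⟨j, hj⟩ := Function.ne_iff.1 hv0
    rw [Pi.zero_apply] at hj
    set ψ : (Fin N → 𝕜) × 𝕜 → Fin (N + 1) → 𝕜 := fun q => j.insertNth 0 q.1 + q.2 • v with hψ
    have hψa : AnalyticAt 𝕜 ψ 0 := by
      refine AnalyticAt.add (AnalyticAt.pi fun i => ?_) (analyticAt_snd.smul analyticAt_const)
      rcases Fin.eq_self_or_eq_succAbove j i with rfl | ⟨i, rfl⟩
      · simpa using analyticAt_const
      · simp only [Fin.insertNth_apply_succAbove]
        exact ((ContinuousLinearMap.proj (R := 𝕜) (φ := fun _ : Fin N => 𝕜) i).comp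
          (ContinuousLinearMap.fst 𝕜 _ 𝕜)).analyticAt 0
    have hins : (j.insertNth 0 (0 : Fin N → 𝕜) : Fin (N + 1) → 𝕜) = 0 := by
      ext i
      rcases Fin.eq_self_or_eq_succAbove j i with rfl | ⟨i, rfl⟩ <;> simp
    have hψ0 : ψ 0 = 0 := by simp [hψ, hins]
    have hline : AnalyticAt 𝕜 (fun t : 𝕜 => F (t • v)) 0 :=
      AnalyticAt.comp_of_eq hF (analyticAt_id.smul analyticAt_const) (by simp)
    obtain ⟨d, h, hh, hh0, hFh⟩ := hline.exists_eventuallyEq_pow_smul_nonzero_iff.2 hv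
    simp only [sub_zero, smul_eq_mul] at hFh
    have hxj := tendsto_pi_nhds.1 hx
    have ht : Tendsto (fun k => x k j / v j) l (𝓝 0) := by simpa using (hxj j).div_const (v j)
    refine Uniformizes.of_comp
      (y := fun k => (j.removeNth (x k - (x k j / v j) • v), x k j / v j)) hψa hψ0 ?_ ?_
    · refine Eventually.of_forall fun k => ?_
      simp only [hψ, Fin.insertNth_removeNth]
      ext i
      by_cases hi : i = j
      · subst hi; simp [hj]
      · simp [hi]
    have := ih.uniformizableOfOrder d (fun q => F (ψ q)) h (AnalyticAt.comp_of_eq hF hψa hψ0) hh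
      hh0 (by simpa [hψ, hins] using hFh) (fun _ => 1) analyticAt_const
      (fun h => one_ne_zero h.self_of_nhds)
      (fun k => (j.removeNth (x k - (x k j / v j) • v), x k j / v j)) (by
        refine Tendsto.prodMk_nhds (tendsto_pi_nhds.2 fun i => ?_) ht
        have := (hxj (j.succAbove i)).sub (ht.mul_const (v (j.succAbove i)))
        simpa [Fin.removeNth] using this)
    simpa only [mul_one] using this

end LocalUniformization

section TestCurve

variable {𝕜 : Type*} [NontriviallyNormedField 𝕜] {ι : Type*} {N : ℕ}

theorem exists_lt_of_tendsto_norm_div_atTop {l : Filter ι} [l.NeBot]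
    {u v : (Fin N → 𝕜) → 𝕜} (hu : ContinuousAt u 0) (hv : ContinuousAt v 0) (hv0 : v 0 ≠ 0)
    {a b : Fin N → ℕ} {z : ι → Fin N → 𝕜} (hz : Tendsto z l (𝓝 0))
    (h : Tendsto (fun k => ‖u (z k) * monom a (z k) / (v (z k) * monom b (z k))‖) l atTop) :
    ∃ i, a i < b i := by
  by_contra! hba
  have hab : b + (a - b) = a := by
    ext i; simp [Nat.add_sub_cancel' (hba i)]
  have hcont : Tendsto (fun k => ‖u (z k) * monom (a - b) (z k) / v (z k)‖) l
      (𝓝 ‖u 0 * monom (a - b) 0 / v 0‖) :=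
    (((hu.mul (analyticAt_monom (a - b) 0).continuousAt).div hv hv0).norm.tendsto).comp hz
  refine not_tendsto_nhds_of_tendsto_atTop (tendsto_atTop_mono (fun k => ?_) h) _ hcont
  rw [← hab, monom_add]
  by_cases hb : monom b (z k) = 0
  · simp only [hb, mul_zero, div_zero, norm_zero, norm_nonneg]
  · simp only [hab]
    rw [mul_left_comm, mul_comm (v _), mul_div_mul_left _ _ hb]

/-- Curve selection: if `F / G` is unbounded along a family converging to the origin, then it has a
pole of positive order along a sequence on which `F` and `G` have exact exponential size. -/
theorem exists_seq_norm_bounds [CompleteSpace 𝕜] [CharZero 𝕜] [ProperSpace 𝕜]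
    {l : Ultrafilter ι} {F G : (Fin N → 𝕜) → 𝕜} (hF : AnalyticAt 𝕜 F 0) (hG : AnalyticAt 𝕜 G 0)
    {x : ι → Fin N → 𝕜} (hx : Tendsto x l (𝓝 0))
    (h : Tendsto (fun k => ‖F (x k) / G (x k)‖) l atTop)
    {τ : 𝕜} (hτ : ‖τ‖ < 1) :
    ∃ (y : ℕ → Fin N → 𝕜) (a b : ℕ) (c C : ℝ), a < b ∧ 0 < c ∧ 0 < C ∧
      Tendsto y atTop (𝓝 0) ∧ ∀ᶠ t in atTop, c * ‖τ‖ ^ (a * t) ≤ ‖F (y t)‖ ∧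
        c * ‖τ‖ ^ (b * t) ≤ ‖G (y t)‖ ∧ ‖G (y t)‖ ≤ C * ‖τ‖ ^ (b * t) := by
  have hpos : ∀ᶠ k in (l : Filter ι), F (x k) / G (x k) ≠ 0 := by
    filter_upwards [h.eventually_gt_atTop 0] with k hk using norm_pos_iff.1 hk
  have hF0 : ¬ F =ᶠ[𝓝 0] 0 := fun h0 => by
    obtain ⟨k, h1, h2⟩ := (hpos.and (hx.eventually h0)).exists
    simp [h2] at h1
  have hG0 : ¬ G =ᶠ[𝓝 0] 0 := fun h0 => by
    obtain ⟨k, h1, h2⟩ := (hpos.and (hx.eventually h0)).exists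
    simp [h2] at h1
  obtain ⟨π, z, hπ, hπ0, hz, hzx, hm⟩ := (locallyUniformizable N l).finset
    (Finset.univ : Finset Bool) (F := fun j => if j then F else G)
    (fun j _ => by cases j <;> simpa) hx
  obtain ⟨a, u, hu, hu0, hua⟩ := (hm true (Finset.mem_univ _)).resolve_left (by simpa using hF0)
  obtain ⟨b, v, hv, hv0, hvb⟩ := (hm false (Finset.mem_univ _)).resolve_left (by simpa using hG0)
  simp only [if_true, Bool.false_eq_true, if_false] at hua hvb
  obtain ⟨i, hi⟩ : ∃ i, a i < b i := by
    refine exists_lt_of_tendsto_norm_div_atTop hu.continuousAt hv.continuousAt hv0 hz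
      (h.congr' ?_)
    filter_upwards [hzx, hz.eventually hua, hz.eventually hvb] with k h1 h2 h3
    rw [← h1, h2, h3]
  obtain ⟨w, hw0, hw⟩ := exists_weight_dotProduct_lt hi
  have hcurve := tendsto_monomCurve hτ hw0
  have hu0' : 0 < ‖u 0‖ := norm_pos_iff.2 hu0
  have hv0' : 0 < ‖v 0‖ := norm_pos_iff.2 hv0
  refine ⟨fun t => π (monomCurve τ w t), w ⬝ᵥ a, w ⬝ᵥ b, min (‖u 0‖ / 2) (‖v 0‖ / 2), 2 * ‖v 0‖, hw,
    by positivity, by positivity, (hπ.tendsto_zero hπ0).comp hcurve, ?_⟩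
  have e1 : ∀ᶠ y in 𝓝 0, ‖u 0‖ / 2 < ‖u y‖ :=
    hu.continuousAt.norm.eventually (lt_mem_nhds (by linarith))
  have e2 : ∀ᶠ y in 𝓝 0, ‖v 0‖ / 2 < ‖v y‖ :=
    hv.continuousAt.norm.eventually (lt_mem_nhds (by linarith))
  have e3 : ∀ᶠ y in 𝓝 0, ‖v y‖ < 2 * ‖v 0‖ :=
    hv.continuousAt.norm.eventually (gt_mem_nhds (by linarith))
  filter_upwards [hcurve.eventually (hua.and (hvb.and (e1.and (e2.and e3))))] with t ht
  obtain ⟨h1, h2, h3, h4, h5⟩ := ht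
  rw [h1, h2, monom_monomCurve, monom_monomCurve, norm_mul, norm_mul, norm_pow, norm_pow]
  refine ⟨?_, ?_, ?_⟩
  · gcongr; exact (min_le_left _ _).trans h3.le
  · gcongr; exact (min_le_right _ _).trans h4.le
  · gcongr

end TestCurve

section Integrability

open MeasureTheory Metric
open scoped Pointwise

theorem exists_measureReal_ball_pow {𝕜 E : Type*} [NontriviallyNormedField 𝕜]
    [NormedAddCommGroup E] [NormedSpace 𝕜 E] [ProperSpace E] [MeasurableSpace E] [BorelSpace E]
    (μ : Measure E) [μ.IsAddHaarMeasure] {τ : 𝕜} (hτ : τ ≠ 0) :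
    ∃ χ : ℝ, 0 < χ ∧ ∀ (x : E) (k : ℕ) (r : ℝ),
      μ.real (ball x (‖τ‖ ^ k * r)) = χ ^ k * μ.real (ball 0 r) := by
  refine ⟨distribHaarChar E (Units.mk0 τ hτ), distribHaarChar_pos, fun x k r => ?_⟩
  have h1 : ball x (‖τ‖ ^ k * r) = x +ᵥ (Units.mk0 τ hτ ^ k • ball (0 : E) r) := by
    have : Units.mk0 τ hτ ^ k • ball (0 : E) r = τ ^ k • ball (0 : E) r := by
      ext y
      simp [Set.mem_smul_set, Units.smul_def]
    rw [this, _root_.smul_ball (pow_ne_zero k hτ), smul_zero, norm_pow, vadd_ball, vadd_eq_add,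
      add_zero]
  rw [h1, Measure.real, measure_vadd, ← distribHaarChar_mul, Measure.real, ENNReal.toReal_mul]
  simp

theorem exists_exponent_bound {q χ : ℝ} (hq : 1 < q) (hχ : 0 < χ) (b : ℕ) :
    ∃ M : ℝ, ∀ σ C m I : ℝ, 0 < C → 0 < m →
      (∀ᶠ t : ℕ in atTop, (C * q ^ t) ^ σ * (χ ^ (b * t) * m) ≤ I) → σ ≤ M := by
  obtain ⟨M, hM⟩ := pow_unbounded_of_one_lt (χ ^ b)⁻¹ hq
  refine ⟨M, fun σ C m I hC hm h => ?_⟩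
  by_contra! hσ
  have hq0 : 0 < q := by linarith
  have h1 : 1 < q ^ σ * χ ^ b := by
    have : q ^ M ≤ q ^ σ := by
      rw [← Real.rpow_natCast]; exact Real.rpow_le_rpow_of_exponent_le hq.le hσ.le
    have h2 := hM.trans_le this
    rwa [inv_lt_iff_one_lt_mul₀ (by positivity)] at h2
  have h2 : Tendsto (fun t : ℕ => (C ^ σ * m) * (q ^ σ * χ ^ b) ^ t) atTop atTop :=
    (tendsto_pow_atTop_atTop_of_one_lt h1).const_mul_atTop (by positivity)
  obtain ⟨t, h3, h4⟩ := (h.and (h2.eventually_gt_atTop I)).exists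
  refine absurd h3 (not_le.2 (h4.trans_eq ?_))
  rw [Real.mul_rpow hC.le (by positivity), ← Real.rpow_natCast q t, ← Real.rpow_mul hq0.le,
    mul_comm (t : ℝ), Real.rpow_mul hq0.le, Real.rpow_natCast, mul_pow, pow_mul]
  ring

theorem integrableOn_norm_div_rpow {X 𝕜 : Type*} [TopologicalSpace X] [MeasurableSpace X]
    [OpensMeasurableSpace X] [NontriviallyNormedField 𝕜] {μ : Measure X} {S : Set X}
    {f g : X → 𝕜} (hS : MeasurableSet S) (hμ : μ S < ⊤)
    (hf : ContinuousOn f S) (hg : ContinuousOn g S) (hg0 : ∀ x ∈ S, g x ≠ 0) {C : ℝ}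
    (hC : ∀ x ∈ S, ‖f x / g x‖ ≤ C) {σ : ℝ} (hσ : 0 ≤ σ) :
    IntegrableOn (fun x => ‖f x / g x‖ ^ σ) S μ := by
  refine ⟨(((hf.div hg hg0).norm.rpow_const fun x _ => Or.inr hσ)).aestronglyMeasurable hS,
    HasFiniteIntegral.restrict_of_bounded (C ^ σ) hμ ?_⟩
  refine (ae_restrict_iff' hS).2 (Eventually.of_forall fun x hx => ?_)
  rw [Real.norm_of_nonneg (by positivity)]
  exact Real.rpow_le_rpow (norm_nonneg _) (hC x hx) hσ

variable {p : ℕ} [Fact p.Prime] {n : ℕ}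

/-- Near the limit of a family along which `f / g` is unbounded there is a ball on which only a
bounded set of powers of `f / g` is integrable. -/
theorem exists_closedBall_bounded_exponents [MeasurableSpace (Fin n → ℚ_[p])]
    [BorelSpace (Fin n → ℚ_[p])] (μ : Measure (Fin n → ℚ_[p])) [μ.IsAddHaarMeasure]
    {f g : (Fin n → ℚ_[p]) → ℚ_[p]} {a : Fin n → ℚ_[p]} (hf : AnalyticAt ℚ_[p] f a)
    (hg : AnalyticAt ℚ_[p] g a) {ι : Type*} {l : Ultrafilter ι} {x : ι → Fin n → ℚ_[p]}
    (hx : Tendsto x l (𝓝 a)) (h : Tendsto (fun k => ‖f (x k) / g (x k)‖) l atTop)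
    {U : Set (Fin n → ℚ_[p])} (hU : U ∈ 𝓝 a) :
    ∃ ε > 0, closedBall a ε ⊆ U ∧ ∃ M : ℝ, ∀ σ : ℝ, 0 ≤ σ →
      IntegrableOn (fun x => ‖f x / g x‖ ^ σ) (closedBall a ε \ {x | f x * g x = 0}) μ →
      σ ≤ M := by
  have hp1 : (1 : ℝ) < p := by exact_mod_cast (Fact.out : p.Prime).one_lt
  have hτ : ‖(p : ℚ_[p])‖ < 1 := by rw [Padic.norm_p]; exact inv_lt_one_of_one_lt₀ hp1
  have hτ0 : (p : ℚ_[p]) ≠ 0 := by exact_mod_cast (Fact.out : p.Prime).ne_zero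
  have hτ0' := norm_pos_iff.2 hτ0
  have hshift : AnalyticAt ℚ_[p] (fun y => a + y) 0 := analyticAt_const.add analyticAt_id
  have hx0 : Tendsto (fun k => x k - a) l (𝓝 0) := by simpa using hx.sub_const a
  obtain ⟨y, α, b, c, C, hαb, hc, hC, hy, hbd⟩ := exists_seq_norm_bounds
    (F := fun y => f (a + y)) (G := fun y => g (a + y)) (AnalyticAt.comp_of_eq hf hshift (by simp))
    (AnalyticAt.comp_of_eq hg hshift (by simp)) hx0 (by simpa using h) hτ
  obtain ⟨χ, hχ, hball⟩ := exists_measureReal_ball_pow μ hτ0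
  obtain ⟨K₁, s₁, hs₁, hK₁⟩ := hf.hasStrictFDerivAt.exists_lipschitzOnWith
  obtain ⟨K₂, s₂, hs₂, hK₂⟩ := hg.hasStrictFDerivAt.exists_lipschitzOnWith
  obtain ⟨ε, hε, hεs⟩ := nhds_basis_closedBall.mem_iff.1 (inter_mem (inter_mem hs₁ hs₂) hU)
  obtain ⟨M, hM⟩ := exists_exponent_bound hp1 hχ b
  refine ⟨ε, hε, fun z hz => (hεs hz).2, M, fun σ hσ hint => ?_⟩
  set K : ℝ := K₁ + K₂ + 1 with hKdef
  have hK : 0 < K := by positivity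
  set δ : ℝ := c / K
  have hδ : 0 < δ := by positivity
  refine hM σ (c / C) (μ.real (ball 0 δ)) (∫ x in closedBall a ε \ {x | f x * g x = 0},
    ‖f x / g x‖ ^ σ ∂μ) (by positivity)
    (ENNReal.toReal_pos (measure_ball_pos μ 0 hδ).ne' measure_ball_lt_top.ne) ?_
  have e1 : ∀ᶠ t in atTop, ‖y t‖ < ε / 2 := by
    filter_upwards [hy (ball_mem_nhds 0 (half_pos hε))] with t ht using by simpa using ht
  have e2 : ∀ᶠ t : ℕ in atTop, ‖(p : ℚ_[p])‖ ^ (b * t) * δ < ε / 2 := by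
    have : Tendsto (fun t : ℕ => ‖(p : ℚ_[p])‖ ^ (b * t) * δ) atTop (𝓝 (0 * δ)) := by
      simp_rw [pow_mul]
      exact (tendsto_pow_atTop_nhds_zero_of_lt_one (by positivity)
        (pow_lt_one₀ (norm_nonneg _) hτ (by omega))).mul_const δ
    exact this.eventually (gt_mem_nhds (by simpa using half_pos hε))
  filter_upwards [hbd, e1, e2] with t ⟨h1, h2, h3⟩ h4 h5
  rw [← hball (a + y t)]
  set r : ℝ := ‖(p : ℚ_[p])‖ ^ (b * t) * δ with hr
  have hr0 : 0 < r := by positivity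
  have hyt : a + y t ∈ closedBall a ε := by
    simp only [mem_closedBall, dist_self_add_left]; linarith
  have hsub : ball (a + y t) r ⊆ closedBall a ε := fun z hz => by
    have : dist z a ≤ dist z (a + y t) + dist (a + y t) a := dist_triangle _ _ _
    rw [dist_self_add_left] at this
    rw [mem_ball] at hz
    rw [mem_closedBall]; linarith
  have hKr : K * r = c * ‖(p : ℚ_[p])‖ ^ (b * t) := by
    simp only [hr, δ]; field_simp
  have hle : ‖(p : ℚ_[p])‖ ^ (b * t) ≤ ‖(p : ℚ_[p])‖ ^ (α * t) :=
    pow_le_pow_of_le_one hτ0'.le hτ.le (Nat.mul_le_mul_right t hαb.le)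
  have hfz : ∀ z ∈ ball (a + y t) r, ‖f z‖ = ‖f (a + y t)‖ := fun z hz => by
    refine Padic.norm_eq_of_norm_sub_lt_right ?_
    have := hK₁.dist_le_mul z (hεs (hsub hz)).1.1 _ (hεs hyt).1.1
    rw [dist_eq_norm] at this
    rw [mem_ball] at hz
    calc ‖f z - f (a + y t)‖ ≤ K₁ * dist z (a + y t) := this
      _ ≤ K * dist z (a + y t) := by gcongr; linarith [K₂.coe_nonneg]
      _ < K * r := by gcongr
      _ ≤ c * ‖(p : ℚ_[p])‖ ^ (α * t) := by rw [hKr]; gcongr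
      _ ≤ _ := h1
  have hgz : ∀ z ∈ ball (a + y t) r, ‖g z‖ = ‖g (a + y t)‖ := fun z hz => by
    refine Padic.norm_eq_of_norm_sub_lt_right ?_
    have := hK₂.dist_le_mul z (hεs (hsub hz)).1.2 _ (hεs hyt).1.2
    rw [dist_eq_norm] at this
    rw [mem_ball] at hz
    calc ‖g z - g (a + y t)‖ ≤ K₂ * dist z (a + y t) := this
      _ ≤ K * dist z (a + y t) := by gcongr; linarith [K₁.coe_nonneg]
      _ < K * r := by gcongr
      _ ≤ _ := hKr.trans_le h2
  have hf0 : 0 < ‖f (a + y t)‖ := lt_of_lt_of_le (by positivity) h1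
  have hg0 : 0 < ‖g (a + y t)‖ := lt_of_lt_of_le (by positivity) h2
  have hsub' : ball (a + y t) r ⊆ closedBall a ε \ {x | f x * g x = 0} := fun z hz => by
    refine ⟨hsub hz, mul_ne_zero ?_ ?_⟩
    · rw [← norm_pos_iff, hfz z hz]; exact hf0
    · rw [← norm_pos_iff, hgz z hz]; exact hg0
  refine (setIntegral_ge_of_const_le_real measurableSet_ball measure_ball_lt_top.ne
    (fun z hz => ?_) (hint.mono_set hsub')).trans
    (setIntegral_mono_set hint (Eventually.of_forall fun z => by positivity) hsub'.eventuallyLE)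
  refine Real.rpow_le_rpow (by positivity) ?_ hσ
  rw [norm_div, hfz z hz, hgz z hz, le_div_iff₀ hg0]
  have hpt : (p : ℝ) ^ t * ‖(p : ℚ_[p])‖ ^ t = 1 := by
    rw [Padic.norm_p, ← mul_pow, mul_inv_cancel₀ (by positivity), one_pow]
  calc c / C * (p : ℝ) ^ t * ‖g (a + y t)‖
      ≤ c / C * (p : ℝ) ^ t * (C * ‖(p : ℚ_[p])‖ ^ (α * t + t)) := by
        gcongr
        refine h3.trans (mul_le_mul_of_nonneg_left
          (pow_le_pow_of_le_one hτ0'.le hτ.le ?_) hC.le)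
        nlinarith
    _ = c * ‖(p : ℚ_[p])‖ ^ (α * t) * ((p : ℝ) ^ t * ‖(p : ℚ_[p])‖ ^ t) := by
        rw [pow_add]; field_simp
    _ ≤ _ := by rw [hpt, mul_one]; exact h1

end Integrability

end Preliminaries

open MeasureTheory

/-- Criterion for the existence of a positive pole of the local zeta function of `f/g`:
the convergence set of exponents `σ ≥ 0` is bounded above for some compact open `W`
iff `|f/g|_p` tends to `+∞` along some bounded sequence. -/
theorem padic_zeta_positive_pole_criterion
    (p : ℕ) [Fact p.Prime] (n : ℕ)
    [MeasurableSpace (Fin n → ℚ_[p])] [BorelSpace (Fin n → ℚ_[p])]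
    (μ : Measure (Fin n → ℚ_[p])) [μ.IsAddHaarMeasure]
    (hμ : μ (Set.univ.pi fun _ : Fin n => {x : ℚ_[p] | ‖x‖ ≤ 1}) = 1)
    (U : Set (Fin n → ℚ_[p])) (hUopen : IsOpen U) (hUne : U.Nonempty)
    (f g : (Fin n → ℚ_[p]) → ℚ_[p])
    (hf : AnalyticOnNhd ℚ_[p] f U) (hg : AnalyticOnNhd ℚ_[p] g U)
    (hf0 : ∃ x ∈ U, f x ≠ 0) (hg0 : ∃ x ∈ U, g x ≠ 0)
    (hfg : ∀ c : ℚ_[p], ∃ x ∈ U, f x ≠ c * g x)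
    (D : Set (Fin n → ℚ_[p])) (hD : D = {x ∈ U | f x * g x = 0}) :
    (∃ W : Set (Fin n → ℚ_[p]), W.Nonempty ∧ IsCompact W ∧ IsOpen W ∧ W ⊆ U ∧
        BddAbove {σ : ℝ | 0 ≤ σ ∧
          IntegrableOn (fun x => ‖f x / g x‖ ^ σ) (W \ D) μ}) ↔
    (∃ (A : Set (Fin n → ℚ_[p])) (a : ℕ → (Fin n → ℚ_[p])),
        IsCompact A ∧ A ⊆ U ∧ (∀ k, a k ∈ A \ D) ∧
        Filter.Tendsto (fun k => ‖f (a k) / g (a k)‖) Filter.atTop Filter.atTop) := by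
  have hdiff : ∀ W ⊆ U, W \ D = W \ {x | f x * g x = 0} := fun W hWU => by
    ext x
    simp only [hD, Set.mem_sdiff, Set.mem_ofPred_eq, not_and]
    exact ⟨fun h => ⟨h.1, h.2 (hWU h.1)⟩, fun h => ⟨h.1, fun _ => h.2⟩⟩
  constructor
  · rintro ⟨W, -, hWc, hWo, hWU, M, hM⟩
    by_cases hbd : ∃ C : ℝ, ∀ x ∈ W \ D, ‖f x / g x‖ ≤ C
    · obtain ⟨C, hC⟩ := hbd
      have hfW : ContinuousOn f W := hf.continuousOn.mono hWU
      have hgW : ContinuousOn g W := hg.continuousOn.mono hWU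
      have hmeas : MeasurableSet (W \ D) := by
        rw [hdiff W hWU]
        exact ((hfW.mul hgW).isOpen_inter_preimage hWo isOpen_compl_singleton).measurableSet
      have hint : IntegrableOn (fun x => ‖f x / g x‖ ^ (max M 0 + 1)) (W \ D) μ :=
        integrableOn_norm_div_rpow hmeas
          ((measure_mono Set.sdiff_subset).trans_lt hWc.measure_lt_top)
          (hfW.mono Set.sdiff_subset) (hgW.mono Set.sdiff_subset)
          (fun x hx => by
            rw [hdiff W hWU] at hx
            exact right_ne_zero_of_mul hx.2) hC (by positivity)
      have := hM ⟨by positivity, hint⟩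
      linarith [le_max_left M 0]
    · push Not at hbd
      choose a ha hlt using fun k : ℕ => hbd k
      exact ⟨W, a, hWc, hWU, ha,
        Filter.tendsto_atTop_mono (fun k => (hlt k).le) tendsto_natCast_atTop_atTop⟩
  · rintro ⟨A, a, hA, hAU, ha, hlim⟩
    let l : Ultrafilter ℕ := Filter.hyperfilter ℕ
    have hl : (l : Filter ℕ) ≤ Filter.atTop := Nat.hyperfilter_le_atTop
    obtain ⟨x, hxA, hx⟩ := hA.ultrafilter_le_nhds (l.map a)
      (Filter.le_principal_iff.2
        (Filter.Eventually.of_forall (f := (l : Filter ℕ)) fun k => (ha k).1))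
    have hxU := hAU hxA
    obtain ⟨ε, hε, hεU, M, hM⟩ := exists_closedBall_bounded_exponents μ (hf x hxU) (hg x hxU)
      (l := l) hx (hlim.mono_left hl) (hUopen.mem_nhds hxU)
    refine ⟨Metric.closedBall x ε, ⟨x, Metric.mem_closedBall_self hε.le⟩,
      isCompact_closedBall x ε, IsUltrametricDist.isOpen_closedBall x hε.ne', hεU, M, ?_⟩
    rintro σ ⟨hσ, hint⟩
    rw [hdiff _ hεU] at hint
    exact hM σ hσ hint
end

section
/- Let V ⊆ ℝ^n be a nonempty open set, let h : V → ℝ be a non-constant real-analytic function, and let D ⊆ V be a compact set. Then there exists an open set W with D ⊆ W ⊆ V such that the set of critical values of h on W, namely {h(x) : x ∈ W and the derivative of h vanishes at x}, is finite. -/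
/-- In a Noetherian local domain, if `h` lies in every nonzero prime, then every nonzero prime
is maximal; in particular `h` generates an ideal primary to the maximal ideal. -/
theorem maximalIdeal_le_radical_span_singleton {B : Type*} [CommRing B] [IsDomain B]
    [IsNoetherianRing B] [IsLocalRing B] {h : B}
    (hp : ∀ Q : Ideal B, Q.IsPrime → Q ≠ ⊥ → h ∈ Q) (h0 : h ≠ 0) :
    IsLocalRing.maximalIdeal B ≤ (Ideal.span {h}).radical := by
  set m := IsLocalRing.maximalIdeal B with hm
  have hne : ∀ q ∈ (Ideal.span {h}).minimalPrimes, q ≠ ⊥ := by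
    rintro q hq rfl
    exact h0 (by simpa using hq.1.2 (Ideal.mem_span_singleton_self h))
  rw [Ideal.radical_eq_sInf]
  refine le_sInf fun P ⟨hhP, hP⟩ => ?_
  by_contra hmP
  have hmin : ∀ q ∈ (Ideal.span {h}).minimalPrimes, ¬ m ≤ q := by
    intro q hq hmq
    have := hq.1.1
    obtain ⟨q', hq', hq'P⟩ := Ideal.exists_minimalPrimes_le hhP
    have h1 : P ≤ q := (IsLocalRing.le_maximalIdeal hP.ne_top).trans hmq
    exact hmP (hmq.trans ((hq.2 ⟨hP, hhP⟩ h1)))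
  have hfin := Ideal.finite_minimalPrimes_of_isNoetherianRing B (Ideal.span {h})
  have hav : ¬ ((m : Set B) ⊆ ⋃ q ∈ (hfin.toFinset : Set (Ideal B)), (q : Set B)) := by
    intro hsub
    have := (Ideal.subset_union_prime (s := hfin.toFinset) (f := fun q : Ideal B => q) ⊥ ⊥
      (fun q hq _ _ => (hfin.mem_toFinset.1 hq).1.1)).1 hsub
    obtain ⟨q, hq, hmq⟩ := this
    exact hmin q (hfin.mem_toFinset.1 hq) hmq
  obtain ⟨a, ham, ha⟩ := Set.not_subset.1 hav
  simp only [Set.mem_iUnion, not_exists, Set.Finite.coe_toFinset] at ha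
  have hma : Ideal.span {a} ≤ m := by simpa [Ideal.span_le] using ham
  obtain ⟨q, hq, -⟩ := Ideal.exists_minimalPrimes_le hma
  have hqp := hq.1.1
  have hql := Ideal.height_le_one_of_isPrincipal_of_mem_minimalPrimes _ q hq
  have haq : a ∈ q := hq.1.2 (Ideal.mem_span_singleton_self a)
  obtain ⟨q₀, hq₀, -⟩ := Ideal.exists_minimalPrimes_le hhP
  have ha0 : a ≠ 0 := by
    rintro rfl
    exact ha q₀ hq₀ (q₀.zero_mem)
  have hq0 : q ≠ ⊥ := by
    rintro rfl
    exact ha0 (by simpa using haq)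
  have hhq : Ideal.span {h} ≤ q := by
    simpa [Ideal.span_le] using hp q hqp hq0
  obtain ⟨q', hq', hq'q⟩ := Ideal.exists_minimalPrimes_le hhq
  have hq'p := hq'.1.1
  rcases hq'q.eq_or_lt with rfl | hlt
  · exact ha _ hq' haq
  · have h1 := Ideal.height_add_one_le_of_lt_of_isPrime hlt
    have h2 := Ideal.height_add_one_le_of_lt_of_isPrime (bot_lt_iff_ne_bot.2 (hne q' hq'))
    rw [Ideal.height_bot, zero_add] at h2
    have : (1 + 1 : ℕ∞) ≤ 1 := (add_le_add_left h2 1).trans (h1.trans hql)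
    exact absurd this (by decide)

/-- If `B` is `X`-adically separated over `k⟦X⟧` and `B` is spanned over `k` by a finite
family modulo `X • B`, then this family spans `B` over `k⟦X⟧`. -/
theorem PowerSeries.exists_eq_sum_smul_of_iInf_eq_bot {k B ι : Type*} [Field k] [CommRing B]
    [Algebra (PowerSeries k) B] [Fintype ι] (e : ι → B)
    (hsep : ∀ b : B, (∀ N : ℕ, ∃ c, b = (PowerSeries.X : PowerSeries k) ^ N • c) → b = 0)
    (hspan : ∀ b : B, ∃ c : ι → k, ∃ g : B,
      b = ∑ j, (PowerSeries.C (c j)) • e j + (PowerSeries.X : PowerSeries k) • g) (b : B) :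
    ∃ P : ι → PowerSeries k, b = ∑ j, P j • e j := by
  choose c g hcg using hspan
  let f : ℕ → B := fun i => g^[i] b
  let P : ℕ → ι → PowerSeries k := fun m j => PowerSeries.mk fun i => c (f (i + m)) j
  have hP : ∀ m j, P m j = PowerSeries.C (c (f m) j) + PowerSeries.X * P (m + 1) j := by
    intro m j
    ext i
    cases i with
    | zero => simp [P]
    | succ i =>
      simp only [P, PowerSeries.coeff_mk, map_add, PowerSeries.coeff_succ_X_mul,
        PowerSeries.coeff_C]
      simp [add_assoc, add_comm 1 m]
  have hd : ∀ m, f m - ∑ j, P m j • e j =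
      (PowerSeries.X : PowerSeries k) • (f (m + 1) - ∑ j, P (m + 1) j • e j) := by
    intro m
    have h1 : f m = _ := hcg (f m)
    have h2 : g (f m) = f (m + 1) := by
      simp only [f, Function.iterate_succ_apply']
    rw [h2] at h1
    conv_lhs => rw [h1]
    simp only [hP m, add_smul, Finset.sum_add_distrib, smul_sub, Finset.smul_sum, mul_smul]
    abel
  have hdpow : ∀ N, f 0 - ∑ j, P 0 j • e j =
      (PowerSeries.X : PowerSeries k) ^ N • (f N - ∑ j, P N j • e j) := by
    intro N
    induction N with
    | zero => simp
    | succ N ih => rw [ih, hd N, pow_succ, mul_smul]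
  exact ⟨P 0, sub_eq_zero.1 (hsep _ fun N => ⟨_, hdpow N⟩)⟩

/-- If `B = k + m` with `m` finitely generated, then `B / m ^ N` is finite-dimensional. -/
theorem Ideal.exists_fg_sup_pow_eq_top {k B : Type*} [Field k] [CommRing B] [Algebra k B]
    {m : Ideal B} (hm : m.FG) (hk : ∀ b : B, ∃ c : k, b - algebraMap k B c ∈ m) (N : ℕ) :
    ∃ E : Submodule k B, E.FG ∧ ∀ b : B, ∃ x ∈ E, b - x ∈ m ^ N := by
  obtain ⟨Y, hY⟩ := hm
  induction N with
  | zero => exact ⟨⊥, Submodule.fg_bot, fun b => ⟨0, by simp, by simp⟩⟩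
  | succ N ih =>
    obtain ⟨E, hE, hEb⟩ := ih
    refine ⟨1 ⊔ Submodule.span k (Y : Set B) * E,
      Submodule.FG.sup ⟨{1}, by simp [Submodule.one_eq_span]⟩
        (Submodule.FG.mul ⟨Y, rfl⟩ hE), fun b => ?_⟩
    obtain ⟨c, hc⟩ := hk b
    have key : ∀ z ∈ m, ∃ x ∈ Submodule.span k (Y : Set B) * E, z - x ∈ m ^ (N + 1) := by
      intro z hz
      rw [← hY, Submodule.mem_span_finset'] at hz
      obtain ⟨f, rfl⟩ := hz
      choose u hu hub using hEb
      refine ⟨∑ y : Y, y * u (f y), Submodule.sum_mem _ fun y _ =>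
        Submodule.mul_mem_mul (Submodule.subset_span y.2) (hu _), ?_⟩
      rw [← Finset.sum_sub_distrib]
      refine Submodule.sum_mem _ fun y _ => ?_
      rw [pow_succ', smul_eq_mul, mul_comm (f y), ← mul_sub]
      exact Ideal.mul_mem_mul (hY ▸ Ideal.subset_span y.2) (hub _)
    obtain ⟨x, hx, hxb⟩ := key _ hc
    refine ⟨algebraMap k B c + x, Submodule.add_mem_sup ?_ hx, by rwa [← sub_sub]⟩
    exact Submodule.mem_one.2 ⟨c, rfl⟩

/-- A power series in finitely many variables without constant term is a combination of the
variables. -/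
theorem MvPowerSeries.exists_eq_sum_X_mul {σ R : Type*} [Fintype σ] [CommRing R]
    (f : MvPowerSeries σ R) :
    ∃ g : σ → MvPowerSeries σ R,
      f = MvPowerSeries.C (MvPowerSeries.constantCoeff f) + ∑ i, MvPowerSeries.X i * g i := by
  classical
  have hch : ∀ α : σ →₀ ℕ, ∃ o : Option σ, α ≠ 0 → ∃ i, o = some i ∧ α i ≠ 0 := by
    intro α
    by_cases h : α = 0
    · exact ⟨none, fun h' => absurd h h'⟩
    · obtain ⟨i, hi⟩ := Finsupp.ne_iff.1 h
      exact ⟨some i, fun _ => ⟨i, rfl, hi⟩⟩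
  choose ch hch using hch
  obtain ⟨G, hG⟩ : ∃ G : σ → MvPowerSeries σ R, ∀ i β, MvPowerSeries.coeff β (G i) =
      if ch (β + Finsupp.single i 1) = some i then
        MvPowerSeries.coeff (β + Finsupp.single i 1) f else 0 :=
    ⟨fun i β => if ch (β + Finsupp.single i 1) = some i then
      MvPowerSeries.coeff (β + Finsupp.single i 1) f else 0, fun _ _ => rfl⟩
  refine ⟨G, ?_⟩
  ext α
  have hX : ∀ (i : σ) (g : MvPowerSeries σ R), MvPowerSeries.coeff α (MvPowerSeries.X i * g) =
      if Finsupp.single i 1 ≤ α then MvPowerSeries.coeff (α - Finsupp.single i 1) g else 0 := by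
    intro i g
    rw [MvPowerSeries.X, MvPowerSeries.coeff_monomial_mul]
    simp
  rw [map_add, map_sum, MvPowerSeries.coeff_C]
  simp only [hX, hG]
  by_cases hα : α = 0
  · subst hα
    simp
  obtain ⟨i, hi, hi'⟩ := hch α hα
  rw [if_neg hα, zero_add, Finset.sum_eq_single i]
  · have hle : Finsupp.single i 1 ≤ α := by
      simpa [Finsupp.single_le_iff] using Nat.one_le_iff_ne_zero.2 hi'
    rw [if_pos hle, tsub_add_cancel_of_le hle, if_pos hi]
  · intro j _ hji
    have hne : ch α ≠ some j := by
      rw [hi]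
      simpa using hji.symm
    split_ifs with hle h2
    · rw [tsub_add_cancel_of_le hle] at h2
      exact absurd h2 hne
    · rfl
    · rfl
  · simp

/-- A `k`-derivation of a domain extends to the fraction field of an algebraic extension. -/
theorem Derivation.exists_extension {k A L : Type*} [Field k] [CommRing A] [IsDomain A]
    [Algebra k A] [Field L] [CharZero L] [Algebra A L] [Algebra k L] [IsScalarTower k A L]
    [Algebra.IsAlgebraic A L] (hinj : Function.Injective (algebraMap A L))
    (d : Derivation k A A) :
    ∃ D : Derivation k L L, ∀ a, D (algebraMap A L a) = algebraMap A L (d a) := by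
  let K := FractionRing A
  let _ : Algebra K L := RingHom.toAlgebra (IsFractionRing.lift hinj)
  have : IsScalarTower A K L := IsScalarTower.of_algebraMap_eq fun a => by
    rw [RingHom.algebraMap_toAlgebra, IsFractionRing.lift_algebraMap]
  have : CharZero K := (algebraMap K L).charZero_iff (algebraMap K L).injective |>.2 inferInstance
  have : Algebra.IsAlgebraic K L :=
    (IsFractionRing.comap_isAlgebraic_iff (A := A) (K := K) (C := L)).1 inferInstance
  have : Algebra.FormallyEtale K L := Algebra.FormallyEtale.of_isSeparable K L
  have : Algebra.FormallyEtale A K := Algebra.FormallyEtale.of_isLocalization (nonZeroDivisors A)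
  have : Algebra.FormallyEtale A L := Algebra.FormallyEtale.comp A K L
  let dL : Derivation k A L := (Algebra.linearMap A L).compDer d
  let e := KaehlerDifferential.tensorKaehlerEquivOfFormallyEtale k A L
  let φ : TensorProduct A L (Ω[A⁄k]) →ₗ[L] L :=
    LinearMap.liftBaseChange L dL.liftKaehlerDifferential
  refine ⟨(φ ∘ₗ e.symm.toLinearMap).compDer (KaehlerDifferential.D k L), fun a => ?_⟩
  have he : e (1 ⊗ₜ[A] KaehlerDifferential.D k A a) =
      KaehlerDifferential.D k L (algebraMap A L a) := by
    simp [e, KaehlerDifferential.tensorKaehlerEquivOfFormallyEtale_apply]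
  have : e.symm (KaehlerDifferential.D k L (algebraMap A L a)) =
      1 ⊗ₜ[A] KaehlerDifferential.D k A a := by
    rw [← he, LinearEquiv.symm_apply_apply]
  simp [this, φ, dL]

/-- Over a field of characteristic zero, a power series without constant term lies in the
radical of the ideal generated by its partial derivatives. -/
theorem MvPowerSeries.mem_radical_span_pderiv {σ k : Type*} [Fintype σ] [Field k] [CharZero k]
    (h : MvPowerSeries σ k) (hc : MvPowerSeries.constantCoeff h = 0) :
    h ∈ (Ideal.span (Set.range fun i => MvPowerSeries.pderiv k i h)).radical := by
  set J := Ideal.span (Set.range fun i => MvPowerSeries.pderiv k i h) with hJ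
  by_contra hnot
  obtain ⟨p, ⟨hJp, hp, hhp⟩, hmax⟩ := WellFounded.has_min
    (wellFounded_gt (α := Ideal (MvPowerSeries σ k)))
    {p | J ≤ p ∧ p.IsPrime ∧ h ∉ p} (by
      rw [Ideal.radical_eq_sInf, Ideal.mem_sInf] at hnot
      push Not at hnot
      obtain ⟨p, ⟨h1, h2⟩, h3⟩ := hnot
      exact ⟨p, h1, h2, h3⟩)
  let R := MvPowerSeries σ k
  let B := R ⧸ p
  let π : R →ₐ[k] B := Ideal.Quotient.mkₐ k p
  have hπ : Function.Surjective π := Ideal.Quotient.mkₐ_surjective k p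
  have hπ0 : ∀ r : R, π r = 0 ↔ r ∈ p := fun r => Ideal.Quotient.eq_zero_iff_mem
  have : IsLocalRing B := IsLocalRing.of_surjective' π.toRingHom hπ
  have h0 : π h ≠ 0 := fun h' => hhp ((hπ0 h).1 h')
  have hprime : ∀ Q : Ideal B, Q.IsPrime → Q ≠ ⊥ → π h ∈ Q := by
    intro Q hQ hQ0
    by_contra hhQ
    have hle : p ≤ Q.comap π := fun x hx => by
      rw [Ideal.mem_comap, (hπ0 x).2 hx]
      exact Q.zero_mem
    refine hmax (Q.comap π) ⟨hJp.trans hle, Ideal.comap_isPrime _ _, hhQ⟩ (lt_of_le_of_ne hle ?_)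
    intro heq
    apply hQ0
    rw [eq_bot_iff]
    intro x hx
    obtain ⟨r, rfl⟩ := hπ x
    have : r ∈ p := heq ▸ hx
    exact (hπ0 r).2 this
  -- every nonzero element divides a power of `h`
  have hdvd : ∀ b : B, b ≠ 0 → ∃ N, b ∣ π h ^ N := by
    intro b hb
    have : π h ∈ (Ideal.span {b}).radical := by
      rw [Ideal.radical_eq_sInf, Ideal.mem_sInf]
      rintro Q ⟨hbQ, hQ⟩
      refine hprime Q hQ ?_
      rintro rfl
      exact hb (by simpa using hbQ (Ideal.mem_span_singleton_self b))
    obtain ⟨N, hN⟩ := this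
    exact ⟨N, Ideal.mem_span_singleton.1 hN⟩
  set m := IsLocalRing.maximalIdeal B with hm
  have hmem : ∀ r : R, MvPowerSeries.constantCoeff r = 0 → π r ∈ m := by
    intro r hr
    rw [hm, IsLocalRing.mem_maximalIdeal, mem_nonunits_iff]
    intro hu
    obtain ⟨b, hb⟩ := hu.exists_right_inv
    obtain ⟨s, rfl⟩ := hπ b
    have hrs : r * s - 1 ∈ p := by
      rw [← hπ0, map_sub, map_mul, hb, map_one, sub_self]
    refine hp.ne_top (Ideal.eq_top_of_isUnit_mem p hrs ?_)
    rw [MvPowerSeries.isUnit_iff_constantCoeff, map_sub, map_mul, hr]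
    simp
  have hres : ∀ b : B, ∃ c : k, b - algebraMap k B c ∈ m := by
    intro b
    obtain ⟨r, rfl⟩ := hπ b
    refine ⟨MvPowerSeries.constantCoeff r, ?_⟩
    rw [← AlgHom.commutes π, ← map_sub]
    refine hmem _ ?_
    rw [show algebraMap k R _ = MvPowerSeries.C _ from rfl, map_sub,
      MvPowerSeries.constantCoeff_C, sub_self]
  obtain ⟨N, hN⟩ := Ideal.exists_pow_le_of_le_radical_of_fg
    (maximalIdeal_le_radical_span_singleton hprime h0) (IsNoetherian.noetherian m)
  obtain ⟨E, ⟨S, hS⟩, hE⟩ := Ideal.exists_fg_sup_pow_eq_top (IsNoetherian.noetherian m) hres N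
  let A := PowerSeries k
  have hsub : PowerSeries.HasSubst h := PowerSeries.HasSubst.of_constantCoeff_zero hc
  let ψ : A →ₐ[k] B := π.comp (PowerSeries.substAlgHom hsub)
  let _ : Algebra A B := ψ.toRingHom.toAlgebra
  have hAB : ∀ a : A, algebraMap A B a = ψ a := fun a => rfl
  have : IsScalarTower k A B := IsScalarTower.of_algebraMap_eq fun c => by
    rw [hAB, AlgHom.commutes]
  have hψX : ψ PowerSeries.X = π h := congrArg π (PowerSeries.substAlgHom_X hsub)
  have hgen : ∀ b : B, ∃ P : S → A, b = ∑ j, P j • (j : B) := by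
    refine PowerSeries.exists_eq_sum_smul_of_iInf_eq_bot _ ?_ ?_
    · intro b hb
      have : b ∈ (⨅ i, (Ideal.span {π h}) ^ i : Ideal B) := by
        rw [Ideal.mem_iInf]
        intro i
        obtain ⟨c, rfl⟩ := hb i
        rw [Algebra.smul_def, map_pow, hAB, hψX]
        exact Ideal.mul_mem_right _ _ (Ideal.pow_mem_pow (Ideal.mem_span_singleton_self _) _)
      rw [Ideal.iInf_pow_eq_bot_of_isDomain] at this
      · simpa using this
      · intro htop
        have h1 : m ≠ ⊤ := Ideal.IsPrime.ne_top'
        exact h1 (top_le_iff.1 (htop ▸ (Ideal.span_singleton_le_iff_mem _).2 (hmem h hc)))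
    · intro b
      obtain ⟨x, hx, hbx⟩ := hE b
      rw [← hS, Submodule.mem_span_finset'] at hx
      obtain ⟨c, rfl⟩ := hx
      obtain ⟨g, hg⟩ := Ideal.mem_span_singleton.1 (hN hbx)
      refine ⟨c, g, ?_⟩
      rw [Algebra.smul_def PowerSeries.X, hAB, hψX, ← hg]
      have : ∀ j : S, (PowerSeries.C (c j) : A) • (j : B) = c j • (j : B) := by
        intro j
        rw [← algebraMap_smul A (c j) (j : B)]
        rfl
      simp [this]
  have hfin : Module.Finite A B := ⟨⟨S, by
    rw [eq_top_iff]
    intro b _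
    obtain ⟨P, rfl⟩ := hgen b
    exact Submodule.sum_mem _ fun j _ => Submodule.smul_mem _ _ (Submodule.subset_span j.2)⟩⟩
  have hinj : Function.Injective (algebraMap A B) := by
    rw [injective_iff_map_eq_zero]
    intro a ha
    by_contra ha0
    have h1 := PowerSeries.X_pow_order_mul_divXPowOrder (f := a)
    rw [hAB, ← h1, map_mul, map_pow, hψX] at ha
    rcases mul_eq_zero.1 ha with h2 | h2
    · exact h0 (eq_zero_of_pow_eq_zero h2)
    · exact ((PowerSeries.isUnit_divided_by_X_pow_order ha0).map ψ).ne_zero h2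
  let L := FractionRing B
  have hchar : CharZero L := algebraRat.charZero L
  have hAL : Function.Injective (algebraMap A L) := by
    rw [IsScalarTower.algebraMap_eq A B L]
    exact (IsFractionRing.injective B L).comp hinj
  have : Algebra.IsAlgebraic A B := inferInstance
  have : Algebra.IsAlgebraic A L := 
    have : Algebra.IsAlgebraic B L :=
      (IsFractionRing.comap_isAlgebraic_iff (A := B) (K := L) (C := L)).2 inferInstance
    Algebra.IsAlgebraic.trans A B L
  obtain ⟨D, hD⟩ := Derivation.exists_extension hAL (PowerSeries.derivative k)
  -- the derivation has bounded denominators on `B`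
  let ι : B →ₐ[k] L := IsScalarTower.toAlgHom k B L
  have hι : Function.Injective ι := IsFractionRing.injective B L
  have hden : ∀ z : L, ∃ M, ∃ b : B, ι (π h) ^ M * z = ι b := by
    intro z
    obtain ⟨b, c, hc0, rfl⟩ := IsFractionRing.div_surjective (A := B) z
    obtain ⟨M, b', hb'⟩ := hdvd c (nonZeroDivisors.ne_zero hc0)
    refine ⟨M, b' * b, ?_⟩
    have hc1 : algebraMap B L c ≠ 0 := by
      simpa using nonZeroDivisors.ne_zero hc0
    rw [← map_pow, hb', map_mul, map_mul]
    change algebraMap B L c * algebraMap B L b' * (algebraMap B L b / algebraMap B L c) =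
      algebraMap B L b' * algebraMap B L b
    rw [mul_comm (algebraMap B L c), mul_assoc, mul_div_cancel₀ _ hc1]
  obtain ⟨M, hM⟩ : ∃ M, ∀ b : B, ∃ b' : B, ι (π h) ^ M * D (ι b) = ι b' := by
    classical
    choose M b' hb' using fun j : S => hden (D (ι j))
    refine ⟨∑ j, M j, fun b => ?_⟩
    obtain ⟨P, rfl⟩ := hgen b
    have hιs : ∀ (a : A) (b : B), ι (a • b) = algebraMap A L a * ι b := by
      intro a b
      rw [Algebra.smul_def, map_mul]
      rfl
    have hj : ∀ j : S, ∃ b'' : B, ι (π h) ^ (∑ j, M j) * D (ι (P j • (j : B))) = ι b'' := by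
      intro j
      refine ⟨algebraMap A B (P j) * (π h ^ (∑ i ∈ Finset.univ.erase j, M i) * b' j) +
        π h ^ (∑ j, M j) * (j * algebraMap A B (PowerSeries.derivative k (P j))), ?_⟩
      have hpow : ι (π h) ^ (∑ j, M j) =
          ι (π h) ^ (∑ i ∈ Finset.univ.erase j, M i) * ι (π h) ^ M j := by
        rw [← pow_add, Finset.sum_erase_add _ _ (Finset.mem_univ j)]
      have hAι : ∀ a : A, ι (algebraMap A B a) = algebraMap A L a := fun a => rfl
      rw [hιs, Derivation.leibniz, hD]
      simp only [map_add, map_mul, map_pow, hAι, ← hb', smul_eq_mul, mul_add]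
      rw [hpow]
      ring
    choose b'' hb'' using hj
    refine ⟨∑ j, b'' j, ?_⟩
    rw [map_sum, map_sum, map_sum, Finset.mul_sum]
    exact Finset.sum_congr rfl fun j _ => hb'' j
  let δ : R → L := fun f =>
    D (ι (π f)) - ∑ i, D (ι (π (MvPowerSeries.X i))) * ι (π (MvPowerSeries.pderiv k i f))
  have hδadd : ∀ f g, δ (f + g) = δ f + δ g := by
    intro f g
    simp only [δ, map_add, mul_add, Finset.sum_add_distrib]
    ring
  have hδC : ∀ c : k, δ (MvPowerSeries.C c) = 0 := by
    intro c
    have h1 : ι (π (MvPowerSeries.C c)) = algebraMap k L c := by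
      rw [show (MvPowerSeries.C c : R) = algebraMap k R c from rfl, AlgHom.commutes,
        AlgHom.commutes]
    simp [δ, h1]
  have hδX : ∀ i g, δ (MvPowerSeries.X i * g) = ι (π (MvPowerSeries.X i)) * δ g := by
    classical
    intro i g
    simp only [δ, map_mul, Derivation.leibniz, smul_eq_mul, map_add, MvPowerSeries.pderiv_X,
      mul_sub, mul_add, Finset.sum_add_distrib, Finset.mul_sum]
    have : ∑ x, D (ι (π (MvPowerSeries.X x))) *
        (ι (π g) * ι (π (Pi.single (M := fun _ => R) x 1 i))) =
        ι (π g) * D (ι (π (MvPowerSeries.X i))) := by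
      rw [Finset.sum_eq_single i]
      · simp
        ring
      · intro j _ hj
        simp [Pi.single_eq_of_ne hj.symm]
      · simp
    rw [this]
    have hsum : ∀ x, D (ι (π (MvPowerSeries.X x))) *
        (ι (π (MvPowerSeries.X i)) * ι (π (MvPowerSeries.pderiv k x g))) =
        ι (π (MvPowerSeries.X i)) *
        (D (ι (π (MvPowerSeries.X x))) * ι (π (MvPowerSeries.pderiv k x g))) := fun x => by ring
    simp only [hsum]
    ring
  have hδsum : ∀ g : σ → R, δ (∑ i, g i) = ∑ i, δ (g i) := fun g =>
    map_sum (AddMonoidHom.mk' δ hδadd) g Finset.univ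
  have hδm : ∀ N, ∀ f, ∃ b ∈ m ^ N, ι (π h) ^ M * δ f = ι b := by
    intro N
    induction N with
    | zero =>
      intro f
      obtain ⟨b, hb⟩ := hM (π f)
      choose b' hb' using fun i => hM (π (MvPowerSeries.X i))
      refine ⟨b - ∑ i, b' i * π (MvPowerSeries.pderiv k i f), by simp, ?_⟩
      simp only [δ, map_sub, map_sum, map_mul, ← hb, ← hb', mul_sub, mul_assoc]
      rw [Finset.mul_sum]
    | succ N ih =>
      intro f
      obtain ⟨g, hg⟩ := MvPowerSeries.exists_eq_sum_X_mul f
      choose b hb hb' using ih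
      refine ⟨∑ i, π (MvPowerSeries.X i) * b (g i), Submodule.sum_mem _ fun i _ => ?_, ?_⟩
      · rw [pow_succ']
        exact Ideal.mul_mem_mul (hmem _ (by simp)) (hb _)
      · rw [hg, hδadd, hδC, zero_add, hδsum, Finset.mul_sum, map_sum]
        refine Finset.sum_congr rfl fun i _ => ?_
        rw [hδX, map_mul, ← hb']
        ring
  have hιh : ι (π h) ≠ 0 := by
    rw [Ne, map_eq_zero_iff ι hι]
    exact h0
  have hδh : δ h = 0 := by
    obtain ⟨b, -, hb⟩ := hδm 0 h
    have : b ∈ (⨅ i, m ^ i : Ideal B) := by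
      rw [Ideal.mem_iInf]
      intro i
      obtain ⟨b', hb', hb''⟩ := hδm i h
      rwa [hι (hb.symm.trans hb'')]
    rw [Ideal.iInf_pow_eq_bot_of_isDomain _ Ideal.IsPrime.ne_top'] at this
    rw [Ideal.mem_bot.1 this, map_zero] at hb
    exact (mul_eq_zero.1 hb).resolve_left (pow_ne_zero _ hιh)
  have hpd : ∀ i, π (MvPowerSeries.pderiv k i h) = 0 := fun i =>
    (hπ0 _).2 (hJp (Ideal.subset_span ⟨i, rfl⟩))
  have hDh : D (ι (π h)) = 1 := by
    rw [← hψX, ← hAB]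
    change D (algebraMap A L PowerSeries.X) = 1
    rw [hD, PowerSeries.derivative_X, map_one]
  simp [δ, hpd, hDh] at hδh

/-- The weight `∏ pᵢ ^ αᵢ` of an exponent, where `pᵢ` is the `i`-th prime. -/
noncomputable def primeWeight {n : ℕ} (α : Fin n →₀ ℕ) : ℕ :=
  α.prod fun i e => Nat.nth Nat.Prime i ^ e

/-- The value of the monomial with exponent `α`. -/
noncomputable def monomialValue {n : ℕ} (x : Fin n → ℝ) (α : Fin n →₀ ℕ) : ℝ :=
  α.prod fun i e => x i ^ e

theorem primeWeight_add {n : ℕ} (α β : Fin n →₀ ℕ) :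
    primeWeight (α + β) = primeWeight α * primeWeight β :=
  Finsupp.prod_add_index' (by simp) (fun _ => pow_add _)

theorem primeWeight_single {n : ℕ} (i : Fin n) (e : ℕ) :
    primeWeight (Finsupp.single i e) = Nat.nth Nat.Prime i ^ e := by
  simp [primeWeight]

theorem primeWeight_pos {n : ℕ} (α : Fin n →₀ ℕ) : 0 < primeWeight α :=
  Finset.prod_pos fun i _ => pow_pos (Nat.prime_nth_prime i).pos _

theorem primeWeight_injective {n : ℕ} :
    Function.Injective (primeWeight : (Fin n →₀ ℕ) → ℕ) := by
  have hi : Function.Injective fun i : Fin n => Nat.nth Nat.Prime i :=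
    (Nat.nth_injective Nat.infinite_setOfPred_prime).comp Fin.val_injective
  have key : ∀ α : Fin n →₀ ℕ, (primeWeight α).factorization =
      α.embDomain ⟨_, hi⟩ := by
    intro α
    rw [← Nat.prod_pow_factorization_eq_self (f := α.embDomain ⟨_, hi⟩), Finsupp.prod_embDomain]
    · rfl
    · intro p hp
      rw [Finsupp.support_embDomain, Finset.mem_map] at hp
      obtain ⟨i, -, rfl⟩ := hp
      exact Nat.prime_nth_prime i
  intro α β h
  have h' := key α
  rw [h, key β] at h'
  exact (Finsupp.embDomain_injective _ h').symm

theorem finite_setOf_primeWeight_le {n : ℕ} (M : ℕ) :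
    {α : Fin n →₀ ℕ | primeWeight α ≤ M}.Finite :=
  (Set.finite_Iic M).preimage primeWeight_injective.injOn

/-- The weight of an exponent at the polyradius `pᵢ ^ (-s)`. -/
noncomputable def radiusWeight {n : ℕ} (s : ℕ) (α : Fin n →₀ ℕ) : ENNReal :=
  ((primeWeight α : ENNReal)⁻¹) ^ s

theorem radiusWeight_add {n : ℕ} (s : ℕ) (α β : Fin n →₀ ℕ) :
    radiusWeight s (α + β) = radiusWeight s α * radiusWeight s β := by
  rw [radiusWeight, primeWeight_add, Nat.cast_mul,
    ENNReal.mul_inv (Or.inr (ENNReal.natCast_ne_top _)) (Or.inl (ENNReal.natCast_ne_top _)),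
    mul_pow]
  rfl

theorem primeWeight_cast_ne_zero {n : ℕ} (α : Fin n →₀ ℕ) : (primeWeight α : ENNReal) ≠ 0 :=
  Nat.cast_ne_zero.2 (primeWeight_pos α).ne'

theorem radiusWeight_ne_top {n : ℕ} (s : ℕ) (α : Fin n →₀ ℕ) : radiusWeight s α ≠ ⊤ :=
  ENNReal.pow_ne_top (ENNReal.inv_ne_top.2 (primeWeight_cast_ne_zero α))

theorem primeWeight_pow_mul_radiusWeight {n : ℕ} (s : ℕ) (α : Fin n →₀ ℕ) :
    (primeWeight α : ENNReal) ^ s * radiusWeight s α = 1 := by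
  rw [radiusWeight, ← mul_pow, ENNReal.mul_inv_cancel (primeWeight_cast_ne_zero α)
    (ENNReal.natCast_ne_top _), one_pow]

theorem primeWeight_inv_le_one {n : ℕ} (α : Fin n →₀ ℕ) : (primeWeight α : ENNReal)⁻¹ ≤ 1 := by
  rw [ENNReal.inv_le_one]
  exact_mod_cast primeWeight_pos α

theorem radiusWeight_anti {n : ℕ} {s t : ℕ} (h : s ≤ t) (α : Fin n →₀ ℕ) :
    radiusWeight t α ≤ radiusWeight s α :=
  pow_le_pow_right_of_le_one' (primeWeight_inv_le_one α) h

namespace MvPowerSeries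

/-- The weighted `ℓ¹`-norm of a power series at the polyradius `pᵢ ^ (-s)`. -/
noncomputable def wnorm {n : ℕ} (s : ℕ) (F : MvPowerSeries (Fin n) ℝ) : ENNReal :=
  ∑' α, ‖coeff α F‖ₑ * radiusWeight s α

/-- The value of a power series at a point (only meaningful where it converges absolutely). -/
noncomputable def value {n : ℕ} (x : Fin n → ℝ) (F : MvPowerSeries (Fin n) ℝ) : ℝ :=
  ∑' α, coeff α F * monomialValue x α

theorem wnorm_add_le {n : ℕ} (s : ℕ) (F G : MvPowerSeries (Fin n) ℝ) :
    wnorm s (F + G) ≤ wnorm s F + wnorm s G := by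
  rw [wnorm, wnorm, wnorm, ← ENNReal.tsum_add]
  refine ENNReal.tsum_le_tsum fun α => ?_
  rw [map_add, ← add_mul]
  gcongr
  exact enorm_add_le _ _

theorem wnorm_zero {n : ℕ} (s : ℕ) : wnorm s (0 : MvPowerSeries (Fin n) ℝ) = 0 := by
  simp [wnorm]

theorem wnorm_neg {n : ℕ} (s : ℕ) (F : MvPowerSeries (Fin n) ℝ) : wnorm s (-F) = wnorm s F := by
  simp [wnorm]

theorem wnorm_sub_le {n : ℕ} (s : ℕ) (F G : MvPowerSeries (Fin n) ℝ) :
    wnorm s (F - G) ≤ wnorm s F + wnorm s G := by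
  rw [sub_eq_add_neg, ← wnorm_neg s G]
  exact wnorm_add_le s F _

theorem wnorm_sum_le {n : ℕ} {ι : Type*} (s : ℕ) (T : Finset ι)
    (F : ι → MvPowerSeries (Fin n) ℝ) : wnorm s (∑ i ∈ T, F i) ≤ ∑ i ∈ T, wnorm s (F i) :=
  Finset.le_sum_of_subadditive _ (wnorm_zero s).le (wnorm_add_le s) T F

theorem wnorm_anti {n : ℕ} {s t : ℕ} (h : s ≤ t) (F : MvPowerSeries (Fin n) ℝ) :
    wnorm t F ≤ wnorm s F :=
  ENNReal.tsum_le_tsum fun α => by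
    gcongr
    exact radiusWeight_anti h α

theorem wnorm_mul_le {n : ℕ} (s : ℕ) (F G : MvPowerSeries (Fin n) ℝ) :
    wnorm s (F * G) ≤ wnorm s F * wnorm s G := by
  classical
  let f : (Fin n →₀ ℕ) → ENNReal := fun α => ‖coeff α F‖ₑ * radiusWeight s α
  let g : (Fin n →₀ ℕ) → ENNReal := fun α => ‖coeff α G‖ₑ * radiusWeight s α
  have h1 : wnorm s (F * G) ≤ ∑' γ, ∑ p ∈ Finset.HasAntidiagonal.antidiagonal γ, f p.1 * g p.2 := by
    refine ENNReal.tsum_le_tsum fun γ => ?_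
    rw [coeff_mul]
    refine (mul_le_mul_left (enorm_sum_le _ _) _).trans ?_
    rw [Finset.sum_mul]
    refine Finset.sum_le_sum fun p hp => ?_
    rw [← Finset.HasAntidiagonal.mem_antidiagonal.1 hp, radiusWeight_add, enorm_mul]
    exact (mul_mul_mul_comm _ _ _ _).le
  refine h1.trans_eq ?_
  have h2 : ∀ γ : Fin n →₀ ℕ, ∑ p ∈ Finset.HasAntidiagonal.antidiagonal γ, f p.1 * g p.2 =
      ∑' p : Finset.HasAntidiagonal.antidiagonal γ, f p.1.1 * g p.1.2 := fun γ => by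
    rw [tsum_fintype, ← Finset.sum_finset_coe]
    rfl
  rw [tsum_congr h2, ← ENNReal.tsum_sigma'
      (fun x : Σ γ : Fin n →₀ ℕ, Finset.HasAntidiagonal.antidiagonal γ => f x.2.1.1 * g x.2.1.2),
    ← Finset.HasAntidiagonal.sigmaAntidiagonalEquivProd.symm.tsum_eq]
  simp only [Finset.HasAntidiagonal.sigmaAntidiagonalEquivProd_symm_apply_snd_coe]
  rw [ENNReal.tsum_prod (f := fun a b => f a * g b)]
  simp only [ENNReal.tsum_mul_left, ENNReal.tsum_mul_right]
  rfl

theorem wnorm_ne_top_of_finite {n : ℕ} (s : ℕ) {F : MvPowerSeries (Fin n) ℝ}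
    (hF : {α | coeff α F ≠ 0}.Finite) : wnorm s F ≠ ⊤ := by
  rw [wnorm, tsum_eq_sum (s := hF.toFinset)]
  · exact ENNReal.sum_ne_top.2 fun α _ => ENNReal.mul_ne_top enorm_ne_top (radiusWeight_ne_top s α)
  · intro α hα
    have : coeff α F = 0 := by simpa using hα
    simp [this]

theorem enorm_monomialValue_le {n : ℕ} {s : ℕ} {x : Fin n → ℝ}
    (hx : ∀ i, |x i| ≤ ((Nat.nth Nat.Prime i : ℝ)⁻¹) ^ s) (α : Fin n →₀ ℕ) :
    ‖monomialValue x α‖ₑ ≤ radiusWeight s α := by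
  have h1 : |monomialValue x α| ≤ ((primeWeight α : ℝ)⁻¹) ^ s := by
    rw [monomialValue, primeWeight, Finsupp.prod, Finsupp.prod, Finset.abs_prod, Nat.cast_prod,
      ← Finset.prod_inv_distrib, ← Finset.prod_pow]
    refine Finset.prod_le_prod (fun _ _ => abs_nonneg _) fun i _ => ?_
    rw [abs_pow, Nat.cast_pow, ← inv_pow, ← pow_mul, mul_comm, pow_mul]
    exact pow_le_pow_left₀ (abs_nonneg _) (hx i) _
  have hpos : (0 : ℝ) < primeWeight α := by exact_mod_cast primeWeight_pos α
  rw [Real.enorm_eq_ofReal_abs, radiusWeight]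
  refine (ENNReal.ofReal_le_ofReal h1).trans_eq ?_
  rw [ENNReal.ofReal_pow (inv_nonneg.2 hpos.le), ENNReal.ofReal_inv_of_pos hpos,
    ENNReal.ofReal_natCast]

section value

variable {n s : ℕ} {x : Fin n → ℝ} {F G : MvPowerSeries (Fin n) ℝ}

theorem summable_norm_value (hx : ∀ i, |x i| ≤ ((Nat.nth Nat.Prime i : ℝ)⁻¹) ^ s)
    (hF : wnorm s F ≠ ⊤) : Summable fun α => ‖coeff α F * monomialValue x α‖ := by
  rw [← tsum_enorm_ne_top_iff_summable_norm]
  refine ne_top_of_le_ne_top hF (ENNReal.tsum_le_tsum fun α => ?_)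
  rw [enorm_mul]
  gcongr
  exact enorm_monomialValue_le hx α

theorem value_add (hx : ∀ i, |x i| ≤ ((Nat.nth Nat.Prime i : ℝ)⁻¹) ^ s)
    (hF : wnorm s F ≠ ⊤) (hG : wnorm s G ≠ ⊤) : value x (F + G) = value x F + value x G := by
  rw [value, value, value, ← (summable_norm_value hx hF).of_norm.tsum_add
    (summable_norm_value hx hG).of_norm]
  simp only [map_add, add_mul]

theorem monomialValue_add (x : Fin n → ℝ) (α β : Fin n →₀ ℕ) :
    monomialValue x (α + β) = monomialValue x α * monomialValue x β :=
  Finsupp.prod_add_index' (by simp) (fun _ => pow_add _)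

theorem value_mul (hx : ∀ i, |x i| ≤ ((Nat.nth Nat.Prime i : ℝ)⁻¹) ^ s)
    (hF : wnorm s F ≠ ⊤) (hG : wnorm s G ≠ ⊤) : value x (F * G) = value x F * value x G := by
  have hf := summable_norm_value hx hF
  have hg := summable_norm_value hx hG
  set f : (Fin n →₀ ℕ) → ℝ := fun α => coeff α F * monomialValue x α with hfdef
  set g : (Fin n →₀ ℕ) → ℝ := fun α => coeff α G * monomialValue x α with hgdef
  have h : (∑' α, f α) * ∑' α, g α =
      ∑' γ, ∑ p ∈ Finset.HasAntidiagonal.antidiagonal γ, f p.1 * g p.2 :=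
    Summable.tsum_mul_tsum_eq_tsum_sum_antidiagonal hf.of_norm hg.of_norm
      (summable_mul_of_summable_norm hf hg)
  have h' : ∀ γ, coeff γ (F * G) * monomialValue x γ =
      ∑ p ∈ Finset.HasAntidiagonal.antidiagonal γ, f p.1 * g p.2 := by
    intro γ
    rw [coeff_mul, Finset.sum_mul]
    refine Finset.sum_congr rfl fun p hp => ?_
    rw [← Finset.HasAntidiagonal.mem_antidiagonal.1 hp, monomialValue_add]
    exact mul_mul_mul_comm _ _ _ _
  exact (tsum_congr h').trans h.symm

theorem value_zero (x : Fin n → ℝ) : value x (0 : MvPowerSeries (Fin n) ℝ) = 0 := by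
  simp [value]

theorem value_sum_mul_eq_zero {ι : Type*} (hx : ∀ i, |x i| ≤ ((Nat.nth Nat.Prime i : ℝ)⁻¹) ^ s)
    (T : Finset ι) (F G : ι → MvPowerSeries (Fin n) ℝ) (hF : ∀ i ∈ T, wnorm s (F i) ≠ ⊤)
    (hG : ∀ i ∈ T, wnorm s (G i) ≠ ⊤) (h0 : ∀ i ∈ T, value x (G i) = 0) :
    value x (∑ i ∈ T, F i * G i) = 0 := by
  classical
  have hm : ∀ i ∈ T, wnorm s (F i * G i) ≠ ⊤ := fun i hi =>
    ne_top_of_le_ne_top (ENNReal.mul_ne_top (hF i hi) (hG i hi)) (wnorm_mul_le s _ _)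
  induction T using Finset.induction_on with
  | empty => simp [value_zero]
  | insert i T hi ih =>
    rw [Finset.sum_insert hi, value_add hx (hm i (by simp)), value_mul hx (hF i (by simp))
      (hG i (by simp)), h0 i (by simp), mul_zero, zero_add]
    · exact ih (fun j hj => hF j (by simp [hj])) (fun j hj => hG j (by simp [hj]))
        (fun j hj => h0 j (by simp [hj])) (fun j hj => hm j (by simp [hj]))
    · exact ne_top_of_le_ne_top
        (ENNReal.sum_ne_top.2 fun j hj => hm j (Finset.mem_insert_of_mem hj)) (wnorm_sum_le s T _)

end value

end MvPowerSeries

/-- Division of a convergent power series by power series whose tails are small compared with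
their leading monomials. -/
theorem MvPowerSeries.exists_division {n : ℕ} (T : Finset (Fin n →₀ ℕ))
    (tail : (Fin n →₀ ℕ) → MvPowerSeries (Fin n) ℝ)
    (htail : ∀ α ∈ T, ∀ γ, coeff γ (tail α) ≠ 0 → primeWeight α < primeWeight γ)
    (asg : (Fin n →₀ ℕ) → Option (Fin n →₀ ℕ))
    (hasg : ∀ γ α, asg γ = some α → α ∈ T ∧ α ≤ γ) (s : ℕ)
    (hs : ∀ α ∈ T, (primeWeight α : ENNReal) ^ s * wnorm s (tail α) ≤ 2⁻¹)
    (g : MvPowerSeries (Fin n) ℝ) (hg : wnorm s g ≠ ⊤) :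
    ∃ (q : (Fin n →₀ ℕ) → MvPowerSeries (Fin n) ℝ) (r : MvPowerSeries (Fin n) ℝ),
      (∀ α ∈ T, wnorm s (q α) ≠ ⊤) ∧ (∀ γ, asg γ ≠ none → coeff γ r = 0) ∧
      g = ∑ α ∈ T, q α * (monomial α 1 + tail α) + r := by
  classical
  obtain ⟨Q, hQ⟩ : ∃ Q : (Fin n →₀ ℕ) → MvPowerSeries (Fin n) ℝ → MvPowerSeries (Fin n) ℝ,
      ∀ α u β, coeff β (Q α u) = if asg (β + α) = some α then coeff (β + α) u else 0 :=
    ⟨fun α u β => if asg (β + α) = some α then coeff (β + α) u else 0, fun _ _ _ => rfl⟩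
  let P : (Fin n →₀ ℕ) → MvPowerSeries (Fin n) ℝ → ENNReal := fun α u =>
    ∑' γ, if asg γ = some α then ‖coeff γ u‖ₑ * radiusWeight s γ else 0
  have hQP : ∀ α u, wnorm s (Q α u) ≤ (primeWeight α : ENNReal) ^ s * P α u := by
    intro α u
    rw [← ENNReal.tsum_mul_left]
    refine le_trans (ENNReal.tsum_le_tsum fun β => ?_)
      (ENNReal.tsum_comp_le_tsum_of_injective (add_left_injective α) _)
    rw [hQ]
    split_ifs with h
    · rw [radiusWeight_add, mul_left_comm, mul_left_comm _ (radiusWeight s β),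
        primeWeight_pow_mul_radiusWeight, mul_one]
    · simp
  have hPle : ∀ u, ∑ α ∈ T, P α u ≤ wnorm s u := by
    intro u
    rw [← Summable.tsum_finsetSum fun _ _ => ENNReal.summable]
    refine ENNReal.tsum_le_tsum fun γ => ?_
    cases h : asg γ with
    | none => simp
    | some α₀ =>
      simp only [Option.some.injEq]
      rw [Finset.sum_ite_eq]
      split_ifs <;> simp
  let S : MvPowerSeries (Fin n) ℝ → MvPowerSeries (Fin n) ℝ := fun u => ∑ α ∈ T, Q α u * tail α
  have hSle : ∀ u, wnorm s (S u) ≤ 2⁻¹ * wnorm s u := by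
    intro u
    calc wnorm s (S u) ≤ ∑ α ∈ T, wnorm s (Q α u * tail α) := wnorm_sum_le s T _
      _ ≤ ∑ α ∈ T, 2⁻¹ * P α u := by
        refine Finset.sum_le_sum fun α hα => ?_
        calc wnorm s (Q α u * tail α) ≤ wnorm s (Q α u) * wnorm s (tail α) := wnorm_mul_le s _ _
          _ ≤ (primeWeight α : ENNReal) ^ s * P α u * wnorm s (tail α) := by
            gcongr
            exact hQP α u
          _ = (primeWeight α : ENNReal) ^ s * wnorm s (tail α) * P α u := by ring
          _ ≤ 2⁻¹ * P α u := by
            gcongr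
            exact hs α hα
      _ = 2⁻¹ * ∑ α ∈ T, P α u := by rw [Finset.mul_sum]
      _ ≤ 2⁻¹ * wnorm s u := by
        gcongr
        exact hPle u
  have hloc : ∀ (M : ℕ) u v, (∀ γ, primeWeight γ < M → coeff γ u = coeff γ v) →
      ∀ γ, primeWeight γ < M + 1 → coeff γ (S u) = coeff γ (S v) := by
    intro M u v huv γ hγ
    simp only [S, map_sum, coeff_mul]
    refine Finset.sum_congr rfl fun α hα => Finset.sum_congr rfl fun p hp => ?_
    by_cases h0 : coeff p.2 (tail α) = 0
    · rw [h0, mul_zero, mul_zero]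
    · have h1 := htail α hα _ h0
      rw [Finset.HasAntidiagonal.mem_antidiagonal] at hp
      rw [← hp, primeWeight_add] at hγ
      have h2 : primeWeight (p.1 + α) < M := by
        rw [primeWeight_add]
        exact lt_of_lt_of_le (Nat.mul_lt_mul_of_pos_left h1 (primeWeight_pos _))
          (Nat.lt_succ_iff.1 hγ)
      rw [hQ, hQ, huv _ h2]
  let u : ℕ → MvPowerSeries (Fin n) ℝ := fun k => (fun u => g - S u)^[k] 0
  have hu : ∀ k, u (k + 1) = g - S (u k) := fun k => Function.iterate_succ_apply' _ _ _
  have hub : ∀ k, wnorm s (u k) ≤ 2 * wnorm s g := by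
    intro k
    induction k with
    | zero => simp [u, wnorm_zero]
    | succ k ih =>
      rw [hu]
      calc wnorm s (g - S (u k)) ≤ wnorm s g + wnorm s (S (u k)) := wnorm_sub_le s _ _
        _ ≤ wnorm s g + 2⁻¹ * (2 * wnorm s g) := by
          gcongr
          exact (hSle _).trans (by gcongr)
        _ = 2 * wnorm s g := by
          rw [← mul_assoc, ENNReal.inv_mul_cancel (by simp) (by simp), one_mul, two_mul]
  have hstep : ∀ k γ, primeWeight γ < k + 1 → coeff γ (u k) = coeff γ (u (k + 1)) := by
    intro k
    induction k with
    | zero =>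
      intro γ hγ
      exact absurd (primeWeight_pos γ) (by omega)
    | succ k ih =>
      intro γ hγ
      rw [hu, hu, map_sub, map_sub, hloc (k + 1) _ _ ih γ hγ]
  have hstab : ∀ l k γ, primeWeight γ < k + 1 → coeff γ (u (k + l)) = coeff γ (u k) := by
    intro l k γ hγ
    induction l with
    | zero => rfl
    | succ l ih => rw [← ih, ← add_assoc, hstep (k + l) γ (by omega)]
  obtain ⟨v, hv⟩ : ∃ v : MvPowerSeries (Fin n) ℝ,
      ∀ γ, coeff γ v = coeff γ (u (primeWeight γ)) :=
    ⟨fun γ => coeff γ (u (primeWeight γ)), fun _ => rfl⟩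
  have hvu : ∀ k γ, primeWeight γ < k + 1 → coeff γ v = coeff γ (u k) := by
    intro k γ hγ
    obtain ⟨l, rfl⟩ := Nat.exists_eq_add_of_le (Nat.lt_succ_iff.1 hγ)
    rw [hv, hstab _ _ _ (Nat.lt_succ_self _)]
  have hvS : v = g - S v := by
    ext γ
    rw [map_sub, hloc (primeWeight γ + 1) v (u (primeWeight γ)) (hvu _) γ (by omega), ← map_sub,
      ← hu, hvu (primeWeight γ + 1) γ (by omega)]
  have hvb : wnorm s v ≤ 2 * wnorm s g := by
    rw [wnorm, ENNReal.tsum_eq_iSup_sum]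
    refine iSup_le fun A => ?_
    refine le_trans (le_of_eq ?_) ((ENNReal.sum_le_tsum A).trans (hub (A.sup primeWeight)))
    refine Finset.sum_congr rfl fun γ hγ => ?_
    rw [hvu (A.sup primeWeight) γ (Nat.lt_succ_iff.2 (Finset.le_sup hγ))]
  have hvt : wnorm s v ≠ ⊤ := ne_top_of_le_ne_top (ENNReal.mul_ne_top (by simp) hg) hvb
  refine ⟨fun α => Q α v, v - ∑ α ∈ T, Q α v * monomial α 1, fun α hα => ?_, fun γ hγ => ?_, ?_⟩
  · refine ne_top_of_le_ne_top (ENNReal.mul_ne_top ?_ ?_) (hQP α v)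
    · exact ENNReal.pow_ne_top (ENNReal.natCast_ne_top _)
    · exact ne_top_of_le_ne_top hvt ((Finset.single_le_sum (f := fun α => P α v)
        (fun _ _ => zero_le) hα).trans (hPle v))
  · obtain ⟨α₀, hα₀⟩ := Option.ne_none_iff_exists'.1 hγ
    obtain ⟨hT, hle⟩ := hasg γ α₀ hα₀
    have hc : ∀ α, coeff γ (Q α v * monomial α (1 : ℝ)) =
        if α = α₀ then coeff γ v else 0 := by
      intro α
      rw [coeff_mul_monomial, mul_one]
      by_cases h : α ≤ γ
      · rw [if_pos h, hQ, tsub_add_cancel_of_le h, hα₀]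
        simp [eq_comm]
      · rw [if_neg h, if_neg]
        rintro rfl
        exact h hle
    rw [map_sub, map_sum]
    simp only [hc]
    rw [Finset.sum_ite_eq', if_pos hT, sub_self]
  · simp only [mul_add, Finset.sum_add_distrib]
    have : v + S v = g := by
      nth_rewrite 1 [hvS]
      abel
    rw [← this]
    simp only [S]
    abel

/-- An exponent occurring in a power series with minimal weight among those occurring. -/
def MvPowerSeries.IsLeadingExponent {n : ℕ} (F : MvPowerSeries (Fin n) ℝ) (α : Fin n →₀ ℕ) :
    Prop :=
  coeff α F ≠ 0 ∧ ∀ γ, coeff γ F ≠ 0 → primeWeight α ≤ primeWeight γ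

theorem MvPowerSeries.exists_isLeadingExponent {n : ℕ} {F : MvPowerSeries (Fin n) ℝ}
    (hF : F ≠ 0) : ∃ α, F.IsLeadingExponent α := by
  obtain ⟨α, hα⟩ : ∃ α, coeff α F ≠ 0 := by
    by_contra! h
    exact hF (MvPowerSeries.ext fun α => by rw [h, map_zero])
  obtain ⟨β, hβ, hmin⟩ := (measure (primeWeight (n := n))).wf.has_min
    {α | coeff α F ≠ 0} ⟨α, hα⟩
  exact ⟨β, hβ, fun γ hγ => not_lt.1 (hmin γ hγ)⟩

/-- The leading monomial of an element of an ideal is also the leading monomial of a combination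
of the generators with polynomial coefficients. -/
theorem MvPowerSeries.IsLeadingExponent.exists_sum_mul {n : ℕ} {ι : Type*} [Fintype ι]
    {G : ι → MvPowerSeries (Fin n) ℝ} {F : MvPowerSeries (Fin n) ℝ} {α : Fin n →₀ ℕ}
    (hα : F.IsLeadingExponent α) (hF : F ∈ Ideal.span (Set.range G)) :
    ∃ tail : MvPowerSeries (Fin n) ℝ,
      (∀ γ, coeff γ tail ≠ 0 → primeWeight α < primeWeight γ) ∧
      ∃ a : ι → MvPowerSeries (Fin n) ℝ, (∀ i, {γ | coeff γ (a i) ≠ 0}.Finite) ∧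
        monomial α 1 + tail = ∑ i, a i * G i := by
  classical
  obtain ⟨a, ha⟩ := Ideal.mem_span_range_iff_exists_fun.1 hF
  obtain ⟨b, hb⟩ : ∃ b : ι → MvPowerSeries (Fin n) ℝ, ∀ i γ, coeff γ (b i) =
      if primeWeight γ ≤ primeWeight α then (coeff α F)⁻¹ * coeff γ (a i) else 0 :=
    ⟨fun i γ => if primeWeight γ ≤ primeWeight α then (coeff α F)⁻¹ * coeff γ (a i) else 0,
      fun _ _ => rfl⟩
  have hcoeff : ∀ γ, primeWeight γ ≤ primeWeight α →
      coeff γ (∑ i, b i * G i) = (coeff α F)⁻¹ * coeff γ F := by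
    intro γ hγ
    have hγF : coeff γ F = ∑ i, coeff γ (a i * G i) := by rw [← ha, map_sum]
    rw [hγF, map_sum, Finset.mul_sum]
    refine Finset.sum_congr rfl fun i _ => ?_
    rw [coeff_mul, coeff_mul, Finset.mul_sum]
    refine Finset.sum_congr rfl fun p hp => ?_
    rw [← Finset.HasAntidiagonal.mem_antidiagonal.1 hp, primeWeight_add] at hγ
    rw [hb, if_pos ((Nat.le_mul_of_pos_right _ (primeWeight_pos _)).trans hγ), mul_assoc]
  refine ⟨∑ i, b i * G i - monomial α 1, fun γ hγ => ?_, b, fun i => ?_, by abel⟩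
  · by_contra! hle
    apply hγ
    rw [map_sub, hcoeff γ hle, coeff_monomial]
    split_ifs with h
    · rw [h, inv_mul_cancel₀ hα.1, sub_self]
    · have : coeff γ F = 0 := by
        by_contra h0
        exact h (primeWeight_injective (hle.antisymm (hα.2 γ h0)))
      rw [this, mul_zero, sub_zero]
  · refine (finite_setOf_primeWeight_le (primeWeight α)).subset fun γ hγ => ?_
    by_contra hle
    apply hγ
    rw [hb]
    exact if_neg hle

/-- The tails become small compared with the leading monomials on small polydiscs. -/
theorem MvPowerSeries.eventually_primeWeight_pow_mul_wnorm_le {n : ℕ} {s₀ : ℕ} {α : Fin n →₀ ℕ}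
    {tail : MvPowerSeries (Fin n) ℝ}
    (htail : ∀ γ, coeff γ tail ≠ 0 → primeWeight α < primeWeight γ) (hs₀ : wnorm s₀ tail ≠ ⊤) :
    ∀ᶠ t in Filter.atTop,
      (primeWeight α : ENNReal) ^ (s₀ + t) * wnorm (s₀ + t) tail ≤ 2⁻¹ := by
  set a : ENNReal := primeWeight α * ((primeWeight α + 1 : ℕ) : ENNReal)⁻¹ with ha
  have ha1 : a < 1 := by
    rw [ha, ← div_eq_mul_inv]
    refine ENNReal.div_lt_of_lt_mul ?_
    rw [one_mul]
    exact_mod_cast Nat.lt_succ_self _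
  have hbound : ∀ t, (primeWeight α : ENNReal) ^ (s₀ + t) * wnorm (s₀ + t) tail ≤
      a ^ t * ((primeWeight α : ENNReal) ^ s₀ * wnorm s₀ tail) := by
    intro t
    have : wnorm (s₀ + t) tail ≤
        (((primeWeight α + 1 : ℕ) : ENNReal)⁻¹) ^ t * wnorm s₀ tail := by
      rw [wnorm, wnorm, ← ENNReal.tsum_mul_left]
      refine ENNReal.tsum_le_tsum fun γ => ?_
      by_cases h : coeff γ tail = 0
      · simp [h]
      · rw [radiusWeight, pow_add, mul_comm (_ ^ s₀), mul_left_comm]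
        gcongr
        · exact htail γ h
        · exact le_rfl
    calc (primeWeight α : ENNReal) ^ (s₀ + t) * wnorm (s₀ + t) tail
        ≤ (primeWeight α : ENNReal) ^ (s₀ + t) *
          ((((primeWeight α + 1 : ℕ) : ENNReal)⁻¹) ^ t * wnorm s₀ tail) := by gcongr
      _ = a ^ t * ((primeWeight α : ENNReal) ^ s₀ * wnorm s₀ tail) := by
        rw [ha, mul_pow, pow_add]
        ring
  have hlim : Filter.Tendsto
      (fun t : ℕ => a ^ t * ((primeWeight α : ENNReal) ^ s₀ * wnorm s₀ tail)) Filter.atTop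
      (nhds 0) := by
    have := ENNReal.Tendsto.mul_const (ENNReal.tendsto_pow_atTop_nhds_zero_of_lt_one ha1)
      (b := (primeWeight α : ENNReal) ^ s₀ * wnorm s₀ tail)
      (Or.inr (ENNReal.mul_ne_top (ENNReal.pow_ne_top (ENNReal.natCast_ne_top _)) hs₀))
    rwa [zero_mul] at this
  filter_upwards [hlim.eventually_le_const (by simp : (0 : ENNReal) < 2⁻¹)] with t ht
  exact (hbound t).trans ht

/-- A convergent power series lying formally in an ideal generated by convergent power series
vanishes at the common zeros of the generators in a polydisc. -/
theorem MvPowerSeries.exists_value_eq_zero_of_mem_span {n : ℕ} {ι : Type*} [Fintype ι]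
    (G : ι → MvPowerSeries (Fin n) ℝ) {s₀ : ℕ} (hG : ∀ i, wnorm s₀ (G i) ≠ ⊤)
    {F : MvPowerSeries (Fin n) ℝ} (hF : F ∈ Ideal.span (Set.range G)) (hF' : wnorm s₀ F ≠ ⊤) :
    ∃ s ≥ s₀, ∀ x : Fin n → ℝ, (∀ i, |x i| ≤ ((Nat.nth Nat.Prime i : ℝ)⁻¹) ^ s) →
      (∀ i, value x (G i) = 0) → value x F = 0 := by
  classical
  let E : Set (Fin n →₀ ℕ) :=
    {α | ∃ F ∈ Ideal.span (Set.range G), F.IsLeadingExponent α}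
  have hfin : {α | Minimal (· ∈ E) α}.Finite :=
    WellQuasiOrderedLE.finite_of_isAntichain (setOfPred_minimal_antichain _)
  set T := hfin.toFinset with hT
  have hTE : ∀ α, ∃ tail : MvPowerSeries (Fin n) ℝ, ∃ a : ι → MvPowerSeries (Fin n) ℝ, α ∈ T →
      (∀ γ, coeff γ tail ≠ 0 → primeWeight α < primeWeight γ) ∧
      (∀ i, {γ | coeff γ (a i) ≠ 0}.Finite) ∧ monomial α 1 + tail = ∑ i, a i * G i := by
    intro α
    by_cases hα : α ∈ T
    · obtain ⟨F, hF, hαF⟩ := ((hfin.mem_toFinset).1 hα).1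
      obtain ⟨tail, h1, a, h2, h3⟩ := hαF.exists_sum_mul hF
      exact ⟨tail, a, fun _ => ⟨h1, h2, h3⟩⟩
    · exact ⟨0, 0, fun h => absurd h hα⟩
  choose tail a hTa using hTE
  have hasg : ∀ γ, ∃ o : Option (Fin n →₀ ℕ), (∀ α, o = some α → α ∈ T ∧ α ≤ γ) ∧
      (γ ∈ E → o ≠ none) := by
    intro γ
    by_cases h : ∃ α ∈ T, α ≤ γ
    · obtain ⟨α, hα⟩ := h
      refine ⟨some α, ?_, by simp⟩
      rintro β ⟨⟩
      exact hα
    · refine ⟨none, by simp, fun hγ => ?_⟩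
      obtain ⟨α, hle, hα⟩ := exists_minimal_le_of_wellFoundedLT (· ∈ E) γ hγ
      exact absurd ⟨α, hfin.mem_toFinset.2 hα, hle⟩ h
  choose asg hasg1 hasg2 using hasg
  have hft : ∀ α ∈ T, wnorm s₀ (monomial α 1 + tail α) ≠ ⊤ := by
    intro α hα
    rw [(hTa α hα).2.2]
    refine ne_top_of_le_ne_top (ENNReal.sum_ne_top.2 fun i _ => ?_) (wnorm_sum_le s₀ _ _)
    exact ne_top_of_le_ne_top (ENNReal.mul_ne_top
      (wnorm_ne_top_of_finite s₀ ((hTa α hα).2.1 i)) (hG i)) (wnorm_mul_le s₀ _ _)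
  have hmon : ∀ α : Fin n →₀ ℕ, wnorm s₀ (monomial α (1 : ℝ)) ≠ ⊤ := by
    intro α
    refine wnorm_ne_top_of_finite s₀ ((Set.finite_singleton α).subset fun γ hγ => ?_)
    by_contra h
    exact hγ (coeff_monomial_ne h 1)
  have htt : ∀ α ∈ T, wnorm s₀ (tail α) ≠ ⊤ := by
    intro α hα
    have := wnorm_sub_le s₀ (monomial α 1 + tail α) (monomial α 1)
    rw [add_sub_cancel_left] at this
    exact ne_top_of_le_ne_top (ENNReal.add_ne_top.2 ⟨hft α hα, hmon α⟩) this
  obtain ⟨t, ht⟩ := ((Filter.eventually_all_finset T).2 fun α hα =>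
    eventually_primeWeight_pow_mul_wnorm_le (hTa α hα).1 (htt α hα)).exists
  have hle : s₀ ≤ s₀ + t := Nat.le_add_right _ _
  have hup : ∀ {H : MvPowerSeries (Fin n) ℝ}, wnorm s₀ H ≠ ⊤ → wnorm (s₀ + t) H ≠ ⊤ :=
    fun hH => ne_top_of_le_ne_top hH (wnorm_anti hle _)
  refine ⟨s₀ + t, hle, fun x hx h0 => ?_⟩
  obtain ⟨q, r, hq, hr, hFqr⟩ := exists_division T tail (fun α hα => (hTa α hα).1) asg hasg1
    (s₀ + t) ht F (hup hF')
  have hf0 : ∀ α ∈ T, value x (monomial α 1 + tail α) = 0 := by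
    intro α hα
    rw [(hTa α hα).2.2]
    exact value_sum_mul_eq_zero hx _ _ _
      (fun i _ => wnorm_ne_top_of_finite _ ((hTa α hα).2.1 i)) (fun i _ => hup (hG i))
      (fun i _ => h0 i)
  have hr0 : r = 0 := by
    by_contra hr0
    obtain ⟨γ, hγ⟩ := exists_isLeadingExponent hr0
    refine hγ.1 (hr γ (hasg2 γ ⟨r, ?_, hγ⟩))
    have : r = F - ∑ α ∈ T, q α * (monomial α 1 + tail α) := by
      rw [hFqr]
      abel
    rw [this]
    refine Ideal.sub_mem _ hF (Ideal.sum_mem _ fun α hα => Ideal.mul_mem_left _ _ ?_)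
    rw [(hTa α hα).2.2]
    exact Ideal.sum_mem _ fun i _ => Ideal.mul_mem_left _ _ (Ideal.subset_span ⟨i, rfl⟩)
  rw [hFqr, hr0, add_zero]
  exact value_sum_mul_eq_zero hx _ _ _ hq (fun α hα => hup (hft α hα)) hf0

theorem monomialValue_eq_prod {n : ℕ} (x : Fin n → ℝ) (α : Fin n →₀ ℕ) :
    monomialValue x α = ∏ i, x i ^ α i :=
  Finsupp.prod_fintype _ _ (by simp)

theorem abs_monomialValue_le {n : ℕ} {x r : Fin n → ℝ} (h : ∀ i, |x i| ≤ r i)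
    (α : Fin n →₀ ℕ) : |monomialValue x α| ≤ monomialValue r α := by
  rw [monomialValue_eq_prod, monomialValue_eq_prod, Finset.abs_prod]
  refine Finset.prod_le_prod (fun _ _ => abs_nonneg _) fun i _ => ?_
  rw [abs_pow]
  exact pow_le_pow_left₀ (abs_nonneg _) (h i) _

theorem hasDerivAt_monomialValue {n : ℕ} (y : Fin n → ℝ) (i : Fin n) (α : Fin n →₀ ℕ) (t : ℝ) :
    HasDerivAt (fun t => monomialValue (Function.update y i t) α)
      (α i * monomialValue (Function.update y i t) (α - Finsupp.single i 1)) t := by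
  have h : ∀ (β : Fin n →₀ ℕ) (t : ℝ), monomialValue (Function.update y i t) β =
      t ^ β i * ∏ j ∈ Finset.univ.erase i, y j ^ β j := by
    intro β t
    rw [monomialValue_eq_prod, ← Finset.mul_prod_erase _ _ (Finset.mem_univ i),
      Function.update_self]
    congr 1
    refine Finset.prod_congr rfl fun j hj => ?_
    rw [Function.update_of_ne (Finset.ne_of_mem_erase hj)]
  have h2 : ∏ j ∈ Finset.univ.erase i, y j ^ (α - Finsupp.single i 1 : Fin n →₀ ℕ) j =
      ∏ j ∈ Finset.univ.erase i, y j ^ α j := by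
    refine Finset.prod_congr rfl fun j hj => ?_
    rw [Finsupp.tsub_apply, Finsupp.single_eq_of_ne (Finset.ne_of_mem_erase hj), tsub_zero]
  simp only [h α]
  have h3 : (α - Finsupp.single i 1 : Fin n →₀ ℕ) i = α i - 1 := by simp
  rw [h, h2, h3, ← mul_assoc]
  exact (hasDerivAt_pow (α i) t).mul_const _

namespace MvPowerSeries

theorem wnorm_pderiv_ne_top {n s : ℕ} {F : MvPowerSeries (Fin n) ℝ} (hF : wnorm s F ≠ ⊤)
    (i : Fin n) : wnorm (s + 1) (pderiv ℝ i F) ≠ ⊤ := by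
  set P : ENNReal := (primeWeight (Finsupp.single i 1) : ENNReal) ^ (s + 1) with hP
  have hPt : P ≠ ⊤ := ENNReal.pow_ne_top (ENNReal.natCast_ne_top _)
  refine ne_top_of_le_ne_top (ENNReal.mul_ne_top hPt hF) ?_
  rw [wnorm, wnorm, ← ENNReal.tsum_mul_left]
  refine le_trans (ENNReal.tsum_le_tsum fun β => ?_)
    (ENNReal.tsum_comp_le_tsum_of_injective (add_left_injective (Finsupp.single i 1)) _)
  have h1 : radiusWeight (s + 1) β = P * radiusWeight (s + 1) (β + Finsupp.single i 1) := by
    rw [radiusWeight_add, mul_left_comm, primeWeight_pow_mul_radiusWeight, mul_one]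
  have h2 : β i + 1 ≤ primeWeight (β + Finsupp.single i 1) := by
    have h3 : (Nat.nth Nat.Prime i) ^ (β i + 1) ∣ primeWeight (β + Finsupp.single i 1) := by
      have : β + Finsupp.single i 1 = (β - Finsupp.single i (β i)) +
          Finsupp.single i (β i + 1) := by
        ext j
        by_cases hj : j = i
        · subst hj
          simp
        · simp [Finsupp.single_eq_of_ne hj]
      rw [this, primeWeight_add, primeWeight_single]
      exact dvd_mul_left _ _
    exact (Nat.lt_pow_self (Nat.prime_nth_prime i).one_lt).le.trans
      (Nat.le_of_dvd (primeWeight_pos _) h3)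
  rw [coeff_pderiv, h1, enorm_mul]
  set γ := β + Finsupp.single i 1
  have h4 : ‖((β i : ℝ) + 1)‖ₑ ≤ primeWeight γ := by
    have : ((β i : ℝ) + 1) = ((β i + 1 : ℕ) : ℝ) := by push_cast; ring
    rw [this, Real.enorm_natCast]
    exact_mod_cast h2
  calc ‖coeff γ F‖ₑ * ‖((β i : ℝ) + 1)‖ₑ * (P * radiusWeight (s + 1) γ)
      ≤ ‖coeff γ F‖ₑ * primeWeight γ * (P * radiusWeight (s + 1) γ) := by gcongr
    _ = P * (‖coeff γ F‖ₑ *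
          (radiusWeight s γ * (primeWeight γ * (primeWeight γ : ENNReal)⁻¹))) := by
      rw [radiusWeight, radiusWeight, pow_succ]
      ring
    _ = P * (‖coeff γ F‖ₑ * radiusWeight s γ) := by
      rw [ENNReal.mul_inv_cancel (primeWeight_cast_ne_zero γ) (ENNReal.natCast_ne_top _), mul_one]

/-- Termwise differentiation of convergent power series. -/
theorem hasDerivAt_value {n s : ℕ} {F : MvPowerSeries (Fin n) ℝ} (hF : wnorm s F ≠ ⊤)
    {y : Fin n → ℝ} (hy : ∀ j, |y j| < ((Nat.nth Nat.Prime j : ℝ)⁻¹) ^ (s + 1)) (i : Fin n) :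
    HasDerivAt (fun t => value (Function.update y i t) F) (value y (pderiv ℝ i F)) (y i) := by
  set r : Fin n → ℝ := fun j => ((Nat.nth Nat.Prime j : ℝ)⁻¹) ^ (s + 1) with hr
  have hr0 : ∀ j, 0 ≤ r j := fun j => by positivity
  have hinj := add_left_injective (Finsupp.single i 1 : Fin n →₀ ℕ)
  have hterm : ∀ (x : Fin n → ℝ) (β : Fin n →₀ ℕ),
      coeff (β + Finsupp.single i 1) F * (((β + Finsupp.single i 1 : Fin n →₀ ℕ) i : ℕ) *
        monomialValue x (β + Finsupp.single i 1 - Finsupp.single i 1)) =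
      coeff β (pderiv ℝ i F) * monomialValue x β := by
    intro x β
    rw [coeff_pderiv, add_tsub_cancel_right, ← mul_assoc]
    simp
  have hout : ∀ (x : Fin n → ℝ) (α : Fin n →₀ ℕ),
      α ∉ Set.range (fun β : Fin n →₀ ℕ => β + Finsupp.single i 1) →
      coeff α F * ((α i : ℕ) * monomialValue x (α - Finsupp.single i 1)) = 0 := by
    intro x α hα
    have : α i = 0 := by
      by_contra h
      refine hα ⟨α - Finsupp.single i 1, tsub_add_cancel_of_le ?_⟩
      simpa [Finsupp.single_le_iff] using Nat.one_le_iff_ne_zero.2 h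
    simp [this]
  have hsum : Summable fun α : Fin n →₀ ℕ =>
      ‖coeff α F * ((α i : ℕ) * monomialValue r (α - Finsupp.single i 1))‖ := by
    rw [← hinj.summable_iff fun α hα => by rw [hout r α hα, norm_zero]]
    refine (summable_norm_value (x := r) (s := s + 1) (fun j => (abs_of_nonneg (hr0 j)).le)
      (wnorm_pderiv_ne_top hF i)).congr fun β => ?_
    simp only [Function.comp_apply]
    rw [hterm]
  have hval : value y (pderiv ℝ i F) =
      ∑' α, coeff α F * ((α i : ℕ) * monomialValue (Function.update y i (y i))
        (α - Finsupp.single i 1)) := by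
    rw [Function.update_eq_self, ← hinj.tsum_eq fun α hα => by
      by_contra h
      exact hα (hout y α h)]
    exact tsum_congr fun β => (hterm y β).symm
  have hmem : ∀ t ∈ Metric.ball (0 : ℝ) (r i), ∀ j, |Function.update y i t j| ≤ r j := by
    intro t ht j
    by_cases hj : j = i
    · subst hj
      rw [Function.update_self]
      simpa using (mem_ball_zero_iff.1 ht).le
    · rw [Function.update_of_ne hj]
      exact (hy j).le
  have hyi : y i ∈ Metric.ball (0 : ℝ) (r i) := by
    rw [mem_ball_zero_iff]
    exact hy i
  rw [hval]
  refine hasDerivAt_tsum_of_isPreconnected hsum Metric.isOpen_ball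
    (convex_ball (0 : ℝ) (r i)).isPreconnected
    (fun α t _ => (hasDerivAt_monomialValue y i α t).const_mul _) (fun α t ht => ?_) hyi ?_ hyi
  · rw [norm_mul, norm_mul, norm_mul, norm_mul]
    gcongr
    rw [Real.norm_eq_abs, Real.norm_eq_abs]
    exact (abs_monomialValue_le (hmem t ht) _).trans (le_abs_self _)
  · rw [Function.update_eq_self]
    exact (summable_norm_value (s := s + 1) (fun j => (hy j).le)
      (ne_top_of_le_ne_top hF (wnorm_anti (Nat.le_succ s) F))).of_norm

end MvPowerSeries

/-- The number of occurrences of each letter in a word. -/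
noncomputable def letterCount {n : ℕ} (w : Σ k : ℕ, (Fin k → Fin n)) : Fin n →₀ ℕ :=
  ∑ j, Finsupp.single (w.2 j) 1

theorem monomialValue_letterCount {n : ℕ} (x : Fin n → ℝ) (w : Σ k : ℕ, (Fin k → Fin n)) :
    monomialValue x (letterCount w) = ∏ j, x (w.2 j) := by
  rw [monomialValue, letterCount, ← Finsupp.prod_finsetSum_index (by simp)
    (fun _ _ _ => pow_add _ _ _)]
  simp

theorem two_pow_le_primeWeight_letterCount {n : ℕ} (w : Σ k : ℕ, (Fin k → Fin n)) :
    2 ^ w.1 ≤ primeWeight (letterCount w) := by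
  rw [primeWeight, letterCount, ← Finsupp.prod_finsetSum_index (by simp)
    (fun _ _ _ => pow_add _ _ _)]
  have := Finset.pow_card_le_prod (Finset.univ : Finset (Fin w.1))
    (fun j => Nat.nth Nat.Prime (w.2 j)) 2 fun j _ => (Nat.prime_nth_prime _).two_le
  simpa using this

theorem radiusWeight_letterCount_le {n : ℕ} (s : ℕ) (w : Σ k : ℕ, (Fin k → Fin n)) :
    radiusWeight s (letterCount w) ≤ ((2⁻¹ : ENNReal) ^ s) ^ w.1 := by
  rw [radiusWeight, ← pow_mul, mul_comm s, pow_mul,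
    ← ENNReal.inv_pow (a := 2)]
  refine pow_le_pow_left' (ENNReal.inv_le_inv.2 ?_) s
  exact_mod_cast two_pow_le_primeWeight_letterCount w

/-- The coefficient of a word in a formal multilinear series on `ℝⁿ`. -/
noncomputable def FormalMultilinearSeries.wordCoeff {n : ℕ}
    (p : FormalMultilinearSeries ℝ (Fin n → ℝ) ℝ) (w : Σ k : ℕ, (Fin k → Fin n)) : ℝ :=
  p w.1 fun j => Pi.single (w.2 j) 1

theorem FormalMultilinearSeries.enorm_wordCoeff_le {n : ℕ}
    (p : FormalMultilinearSeries ℝ (Fin n → ℝ) ℝ) (w : Σ k : ℕ, (Fin k → Fin n)) :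
    ‖p.wordCoeff w‖ₑ ≤ ‖p w.1‖ₑ := by
  have : ‖p.wordCoeff w‖ ≤ ‖p w.1‖ := by
    refine ((p w.1).le_opNorm _).trans_eq ?_
    rw [Finset.prod_eq_one fun j _ => ?_, mul_one]
    rw [Pi.norm_single, norm_one]
  rw [← ofReal_norm, ← ofReal_norm]
  exact ENNReal.ofReal_le_ofReal this

theorem FormalMultilinearSeries.apply_eq_sum_wordCoeff {n : ℕ}
    (p : FormalMultilinearSeries ℝ (Fin n → ℝ) ℝ) (k : ℕ) (y : Fin n → ℝ) :
    p k (fun _ => y) = ∑ f : Fin k → Fin n,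
      p.wordCoeff ⟨k, f⟩ * monomialValue y (letterCount ⟨k, f⟩) := by
  classical
  have hy : (fun _ : Fin k => y) = fun _ => ∑ i, y i • (Pi.single i 1 : Fin n → ℝ) := by
    funext _
    exact pi_eq_sum_univ' y
  rw [hy, ContinuousMultilinearMap.map_sum]
  refine Finset.sum_congr rfl fun f _ => ?_
  rw [ContinuousMultilinearMap.map_smul_univ, monomialValue_letterCount, smul_eq_mul, mul_comm]
  rfl

/-- An analytic function on an open subset of `ℝⁿ` is locally the sum of a convergent power
series in several variables. -/
theorem AnalyticAt.exists_mvPowerSeries {n : ℕ} {h : (Fin n → ℝ) → ℝ} {x₀ : Fin n → ℝ}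
    (hh : AnalyticAt ℝ h x₀) :
    ∃ (s : ℕ) (F : MvPowerSeries (Fin n) ℝ), F.wnorm s ≠ ⊤ ∧
      ∀ y : Fin n → ℝ, (∀ i, |y i| ≤ ((Nat.nth Nat.Prime i : ℝ)⁻¹) ^ s) →
        h (x₀ + y) = F.value y := by
  obtain ⟨p, R, hp⟩ := hh
  obtain ⟨ρ, hρ0, hρR⟩ := ENNReal.lt_iff_exists_nnreal_btwn.1 hp.r_pos
  have hρ0' : 0 < ρ := by exact_mod_cast hρ0
  obtain ⟨s, hs⟩ := exists_pow_lt_of_lt_one (y := (2⁻¹ : NNReal))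
    (div_pos hρ0' (Nat.cast_add_one_pos (α := NNReal) n)) (by
      rw [← NNReal.coe_lt_coe]
      norm_num)
  have hs' : (n + 1 : NNReal) * 2⁻¹ ^ s ≤ ρ := by
    rw [lt_div_iff₀ (Nat.cast_add_one_pos n)] at hs
    rw [mul_comm]
    exact hs.le
  have hns : (n : NNReal) * 2⁻¹ ^ s ≤ ρ := le_trans (by gcongr; simp) hs'
  have h1s : (2⁻¹ : NNReal) ^ s ≤ ρ := le_trans (le_mul_of_one_le_left zero_le (by simp)) hs'
  let K : ENNReal := ∑' w, ‖p.wordCoeff w‖ₑ * radiusWeight s (letterCount w)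
  have hK : K ≠ ⊤ := by
    have hsum := p.summable_norm_mul_pow (hρR.trans_le hp.r_le)
    have hsum' : ∑' k, (‖p k‖ₑ * (ρ : ENNReal) ^ k) ≠ ⊤ := by
      have := tsum_enorm_ne_top_iff_summable_norm.2 hsum.norm
      simpa only [enorm_mul, enorm_pow, enorm_norm, NNReal.enorm_eq] using this
    refine ne_top_of_le_ne_top hsum' ?_
    simp only [K]
    rw [ENNReal.tsum_sigma']
    refine ENNReal.tsum_le_tsum fun k => ?_
    calc ∑' f : Fin k → Fin n, ‖p.wordCoeff ⟨k, f⟩‖ₑ * radiusWeight s (letterCount ⟨k, f⟩)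
        ≤ ∑' _ : Fin k → Fin n, ‖p k‖ₑ * ((2⁻¹ : ENNReal) ^ s) ^ k :=
          ENNReal.tsum_le_tsum fun f => mul_le_mul' (p.enorm_wordCoeff_le ⟨k, f⟩)
            (radiusWeight_letterCount_le s ⟨k, f⟩)
      _ = ‖p k‖ₑ * ((n : ENNReal) * (2⁻¹ : ENNReal) ^ s) ^ k := by
        rw [tsum_fintype, Finset.sum_const, Finset.card_univ, Fintype.card_fun, Fintype.card_fin,
          Fintype.card_fin, nsmul_eq_mul, mul_pow]
        push_cast
        ring
      _ ≤ ‖p k‖ₑ * (ρ : ENNReal) ^ k := by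
        gcongr
        have : ((n : ENNReal) * (2⁻¹ : ENNReal) ^ s) = ((n * 2⁻¹ ^ s : NNReal) : ENNReal) := by
          rw [ENNReal.coe_mul, ENNReal.coe_pow, ENNReal.coe_inv two_ne_zero]
          simp
        rw [this]
        exact_mod_cast hns
  obtain ⟨F, hF⟩ : ∃ F : MvPowerSeries (Fin n) ℝ, ∀ α, MvPowerSeries.coeff α F =
      ∑' w : {w // letterCount w = α}, p.wordCoeff w :=
    ⟨fun α => ∑' w : {w // letterCount w = α}, p.wordCoeff w, fun _ => rfl⟩
  let e := Equiv.sigmaFiberEquiv (letterCount (n := n))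
  refine ⟨s, F, ne_top_of_le_ne_top hK ?_, fun y hy => ?_⟩
  · simp only [K]
    rw [← e.tsum_eq, ENNReal.tsum_sigma']
    refine ENNReal.tsum_le_tsum fun α => ?_
    rw [hF]
    refine (mul_le_mul_left enorm_tsum_le_tsum_enorm _).trans_eq ?_
    rw [← ENNReal.tsum_mul_right]
    refine tsum_congr fun w => ?_
    obtain ⟨w, rfl⟩ := w
    rfl
  · have hyb : ∀ i, |y i| ≤ (ρ : ℝ) := by
      intro i
      refine (hy i).trans (le_trans ?_ (by exact_mod_cast h1s : ((2 : ℝ)⁻¹) ^ s ≤ ρ))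
      gcongr
      exact_mod_cast (Nat.prime_nth_prime i).two_le
    have hball : y ∈ Metric.eball (0 : Fin n → ℝ) R := by
      have : ‖y‖ ≤ ρ := (pi_norm_le_iff_of_nonneg ρ.2).2 hyb
      rw [Metric.mem_eball, edist_zero_right]
      refine lt_of_le_of_lt ?_ hρR
      rw [← ofReal_norm]
      exact ENNReal.ofReal_le_of_le_toReal this
    have hsumw : Summable fun w => ‖p.wordCoeff w * monomialValue y (letterCount w)‖ := by
      rw [← tsum_enorm_ne_top_iff_summable_norm]
      refine ne_top_of_le_ne_top hK (ENNReal.tsum_le_tsum fun w => ?_)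
      rw [enorm_mul]
      gcongr
      exact MvPowerSeries.enorm_monomialValue_le hy _
    have h1 : F.value y = ∑' w, p.wordCoeff w * monomialValue y (letterCount w) := by
      rw [← e.tsum_eq]
      refine Eq.trans ?_ (e.summable_iff.2 hsumw.of_norm).tsum_sigma.symm
      refine tsum_congr fun α => ?_
      rw [hF, ← tsum_mul_right]
      refine tsum_congr fun w => ?_
      obtain ⟨w, rfl⟩ := w
      rfl
    rw [h1, hsumw.of_norm.tsum_sigma, ← (hp.hasSum hball).tsum_eq]
    refine tsum_congr fun k => ?_
    rw [tsum_fintype]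
    exact p.apply_eq_sum_wordCoeff k y

theorem monomialValue_zero_left {n : ℕ} {α : Fin n →₀ ℕ} (hα : α ≠ 0) :
    monomialValue 0 α = 0 := by
  obtain ⟨i, hi⟩ := Finsupp.ne_iff.1 hα
  rw [monomialValue_eq_prod]
  exact Finset.prod_eq_zero (Finset.mem_univ i) (zero_pow hi)

namespace MvPowerSeries

theorem value_zero_left {n : ℕ} (F : MvPowerSeries (Fin n) ℝ) :
    value 0 F = constantCoeff F := by
  rw [value, tsum_eq_single 0 fun α hα => by rw [monomialValue_zero_left hα, mul_zero]]
  simp [monomialValue]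

theorem wnorm_one_ne_top {n : ℕ} (s : ℕ) : wnorm s (1 : MvPowerSeries (Fin n) ℝ) ≠ ⊤ := by
  classical
  refine wnorm_ne_top_of_finite s ((Set.finite_singleton 0).subset fun α hα => ?_)
  by_contra h
  exact hα (by rw [coeff_one, if_neg (Set.mem_singleton_iff.not.1 h)])

theorem wnorm_pow_ne_top {n s : ℕ} {F : MvPowerSeries (Fin n) ℝ} (hF : wnorm s F ≠ ⊤) (N : ℕ) :
    wnorm s (F ^ N) ≠ ⊤ := by
  induction N with
  | zero => simpa using wnorm_one_ne_top s
  | succ N ih =>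
    rw [pow_succ]
    exact ne_top_of_le_ne_top (ENNReal.mul_ne_top ih hF) (wnorm_mul_le s _ _)

theorem value_eq_zero_of_value_pow_eq_zero {n s : ℕ} {F : MvPowerSeries (Fin n) ℝ}
    {x : Fin n → ℝ} (hx : ∀ i, |x i| ≤ ((Nat.nth Nat.Prime i : ℝ)⁻¹) ^ s) (hF : wnorm s F ≠ ⊤)
    {N : ℕ} (h : value x (F ^ N) = 0) : value x F = 0 := by
  induction N with
  | zero =>
    have h1 := value_mul hx (wnorm_one_ne_top s) hF
    rw [pow_zero] at h
    rwa [one_mul, h, zero_mul] at h1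
  | succ N ih =>
    rw [pow_succ, value_mul hx (wnorm_pow_ne_top hF N) hF] at h
    exact (mul_eq_zero.1 h).elim ih id

end MvPowerSeries

theorem AnalyticAt.eventually_eq_of_fderiv_eq_zero {n : ℕ} {h : (Fin n → ℝ) → ℝ}
    {x₀ : Fin n → ℝ} (hh : AnalyticAt ℝ h x₀) :
    ∀ᶠ x in nhds x₀, fderiv ℝ h x = 0 → h x = h x₀ := by
  obtain ⟨s, F, hF, hval⟩ := (hh.sub (analyticAt_const (v := h x₀))).exists_mvPowerSeries
  have hc : MvPowerSeries.constantCoeff F = 0 := by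
    rw [← MvPowerSeries.value_zero_left, ← hval 0 (by simp)]
    simp
  obtain ⟨N, hN⟩ := MvPowerSeries.mem_radical_span_pderiv F hc
  obtain ⟨t, hst, ht⟩ := MvPowerSeries.exists_value_eq_zero_of_mem_span _
    (MvPowerSeries.wnorm_pderiv_ne_top hF) hN
    (MvPowerSeries.wnorm_pow_ne_top
      (ne_top_of_le_ne_top hF (MvPowerSeries.wnorm_anti (Nat.le_succ s) F)) N)
  have hmono : ∀ {a b : ℕ}, a ≤ b → ∀ i : ℕ,
      ((Nat.nth Nat.Prime i : ℝ)⁻¹) ^ b ≤ ((Nat.nth Nat.Prime i : ℝ)⁻¹) ^ a := fun hab i =>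
    pow_le_pow_of_le_one (by positivity)
      (inv_le_one_of_one_le₀ (by exact_mod_cast (Nat.prime_nth_prime i).one_le)) hab
  have hpos : ∀ i : ℕ, 0 < ((Nat.nth Nat.Prime i : ℝ)⁻¹) ^ t := fun i => by
    have : (0 : ℝ) < Nat.nth Nat.Prime i := by exact_mod_cast (Nat.prime_nth_prime i).pos
    positivity
  have hnhds : ∀ᶠ x in nhds x₀, ∀ i : Fin n, |(x - x₀) i| < ((Nat.nth Nat.Prime i : ℝ)⁻¹) ^ t := by
    refine Filter.eventually_all.2 fun i => ?_
    have hcont : ContinuousAt (fun x : Fin n → ℝ => |(x - x₀) i|) x₀ :=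
      (((continuous_apply i).sub continuous_const).abs).continuousAt
    exact hcont.eventually_lt continuousAt_const (by simpa using hpos i)
  filter_upwards [hh.eventually_analyticAt, hnhds] with x hx hlt hcrit
  set y := x - x₀ with hy
  have hxy : x₀ + y = x := by simp [hy]
  have hys : ∀ i : Fin n, |y i| < ((Nat.nth Nat.Prime i : ℝ)⁻¹) ^ (s + 1) := fun i =>
    (hlt i).trans_le (hmono hst i)
  have hys' : ∀ i : Fin n, |y i| < ((Nat.nth Nat.Prime i : ℝ)⁻¹) ^ s := fun i =>
    (hys i).trans_le (hmono (Nat.le_succ s) i)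
  have hpd : ∀ i, MvPowerSeries.value y (MvPowerSeries.pderiv ℝ i F) = 0 := by
    intro i
    have h1 := MvPowerSeries.hasDerivAt_value hF hys i
    have h2 : HasDerivAt (fun u => h (x₀ + Function.update y i u) - h x₀) 0 (y i) := by
      have h3 : HasDerivAt (fun u => x₀ + Function.update y i u) (Pi.single i 1) (y i) :=
        (hasDerivAt_update y i (y i)).const_add x₀
      have h4 : HasFDerivAt h (0 : (Fin n → ℝ) →L[ℝ] ℝ) (x₀ + Function.update y i (y i)) := by
        rw [Function.update_eq_self, hxy, ← hcrit]
        exact hx.differentiableAt.hasFDerivAt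
      simpa using (h4.comp_hasDerivAt (y i) h3).sub_const (h x₀)
    refine h1.unique (h2.congr_of_eventuallyEq ?_)
    have hcont : ContinuousAt (fun u : ℝ => |u|) (y i) := continuous_abs.continuousAt
    filter_upwards [hcont.eventually_lt continuousAt_const (hys' i)] with u hu
    refine (hval _ fun j => ?_).symm
    by_cases hj : j = i
    · subst hj
      rw [Function.update_self]
      exact hu.le
    · rw [Function.update_of_ne hj]
      exact (hys' j).le
  have h5 := MvPowerSeries.value_eq_zero_of_value_pow_eq_zero (fun i => (hys' i).le) hF
    (ht y (fun i => (hlt i).le) hpd)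
  rw [← hval y fun i => (hys' i).le, hxy] at h5
  exact sub_eq_zero.1 h5

/-- A non-constant real-analytic function has only finitely many critical values on a
suitable open neighborhood of a compact subset of its domain. -/
theorem analytic_finitely_many_critical_values_near_compact
    (n : ℕ) (V : Set (Fin n → ℝ)) (hVopen : IsOpen V) (hVne : V.Nonempty)
    (h : (Fin n → ℝ) → ℝ) (hh : AnalyticOnNhd ℝ h V)
    (hnc : ¬ ∃ c : ℝ, ∀ x ∈ V, h x = c)
    (D : Set (Fin n → ℝ)) (hDcomp : IsCompact D) (hDV : D ⊆ V) :
    ∃ W : Set (Fin n → ℝ), IsOpen W ∧ D ⊆ W ∧ W ⊆ V ∧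
      (h '' {x ∈ W | fderiv ℝ h x = 0}).Finite := by
  have hU : ∀ x₀ : Fin n → ℝ, x₀ ∈ D → ∃ U : Set (Fin n → ℝ), IsOpen U ∧ x₀ ∈ U ∧ U ⊆ V ∧
      ∀ x ∈ U, fderiv ℝ h x = 0 → h x = h x₀ := by
    intro x₀ hx₀
    obtain ⟨U, hU, hUo, hxU⟩ := eventually_nhds_iff.1
      ((hh x₀ (hDV hx₀)).eventually_eq_of_fderiv_eq_zero.and (hVopen.eventually_mem (hDV hx₀)))
    exact ⟨U, hUo, hxU, fun x hx => (hU x hx).2, fun x hx => (hU x hx).1⟩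
  choose! U hUo hxU hUV hUc using hU
  obtain ⟨T, hTD, hT⟩ := hDcomp.elim_nhds_subcover U fun x hx => (hUo x hx).mem_nhds (hxU x hx)
  refine ⟨⋃ x ∈ T, U x, isOpen_biUnion fun x hx => hUo x (hTD x hx), hT,
    Set.iUnion₂_subset fun x hx => hUV x (hTD x hx), ?_⟩
  refine (T.finite_toSet.image h).subset ?_
  rintro _ ⟨x, ⟨hx, hcrit⟩, rfl⟩
  obtain ⟨x₀, hx₀, hxU₀⟩ := Set.mem_iUnion₂.1 hx
  exact ⟨x₀, hx₀, (hUc x₀ (hTD x₀ hx₀) x hxU₀ hcrit).symm⟩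
end
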